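/- Let N ≥ 3, let ρ : ℝ^N → ℝ be continuous, bounded and strictly positive, and assume the weighted Poincaré inequality holds with some constant C_p > 0. Let 1 < p < m and let u0 ∈ L^m_ρ(ℝ^N) with u0 ≥ 0. Then for every T > 0 the problem ρ u_t = Δ(u^m) + ρ u^p in ℝ^N × (0,T), u(·,0) = u0, admits a very weak solution. -/

import Mathlib

open MeasureTheory

/-- The Laplacian of `f : ℝ^N → ℝ` at `x`, as the sum of the second derivatives of `f`
along the coordinate directions. -/
noncomputable def lap {N : ℕ} (f : EuclideanSpace ℝ (Fin N) → ℝ)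
    (x : EuclideanSpace ℝ (Fin N)) : ℝ :=
  ∑ i : Fin N, deriv (deriv fun t : ℝ => f (x + t • EuclideanSpace.single i (1 : ℝ))) 0

/-- A (very) weak solution `u` of `ρ ∂_t u = Δ(u^m) + ρ u^p` on `ℝ^N × (0,T)` with
initial datum `u0`: `u` is nonnegative, measurable, `∫∫ u^m ρ < ∞`, and the weak
formulation holds against every smooth compactly supported test function vanishing
at time `T`. -/
def IsVeryWeakSolution (N : ℕ) (m p T : ℝ)
    (ρ u0 : EuclideanSpace ℝ (Fin N) → ℝ) (u : EuclideanSpace ℝ (Fin N) → ℝ → ℝ) : Prop :=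
  (∀ x t, 0 ≤ u x t) ∧
  Measurable (fun q : EuclideanSpace ℝ (Fin N) × ℝ => u q.1 q.2) ∧
  Integrable (fun q : EuclideanSpace ℝ (Fin N) × ℝ => u q.1 q.2 ^ m * ρ q.1)
    (volume.prod (volume.restrict (Set.Ioo 0 T))) ∧
  ∀ φ : EuclideanSpace ℝ (Fin N) × ℝ → ℝ, ContDiff ℝ (⊤ : ℕ∞) φ → HasCompactSupport φ →
    (∀ x, φ (x, T) = 0) →
    -∫ t in Set.Ioo 0 T, ∫ x, u x t * deriv (fun s => φ (x, s)) t * ρ x =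
      (∫ t in Set.Ioo 0 T, ∫ x, u x t ^ m * lap (fun y => φ (y, t)) x) +
      (∫ t in Set.Ioo 0 T, ∫ x, u x t ^ p * φ (x, t) * ρ x) +
      ∫ x, u0 x * φ (x, 0) * ρ x


namespace VW
open Set Filter Topology
open scoped NNReal ENNReal

lemma gron {T C : ℝ} {y y' g r : ℝ → ℝ}
    (hy : ∀ t ∈ Icc 0 T, HasDerivWithinAt y (y' t) (Icc 0 T) t)
    (hg : ContinuousOn g (Icc 0 T)) (hr : ContinuousOn r (Icc 0 T))
    (h : ∀ t ∈ Icc 0 T, y' t + g t ≤ C * y t + r t) (t : ℝ) (ht : t ∈ Icc 0 T) :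
    Real.exp (-C * t) * y t + ∫ s in (0:ℝ)..t, Real.exp (-C * s) * (g s - r s) ≤ y 0 := by
  have hT : 0 ≤ T := ht.1.trans ht.2
  set q : ℝ → ℝ := fun s => Real.exp (-C * s) * (g s - r s) with hq
  have hqc : ContinuousOn q (Icc 0 T) := by
    apply ContinuousOn.mul _ (hg.sub hr)
    fun_prop
  have hqi : IntervalIntegrable q volume 0 T := by
    apply ContinuousOn.intervalIntegrable
    rwa [uIcc_of_le hT]
  set Y : ℝ → ℝ := fun t => Real.exp (-C * t) * y t + ∫ s in (0:ℝ)..t, q s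
  have hYc : ContinuousOn Y (Icc 0 T) := by
    apply ContinuousOn.add
    · apply ContinuousOn.mul (by fun_prop)
      exact fun t ht => (hy t ht).continuousWithinAt
    · have := intervalIntegral.continuousOn_primitive_interval' hqi (left_mem_uIcc)
      rwa [uIcc_of_le hT] at this
  have hYd : ∀ t ∈ Ioo 0 T, HasDerivAt Y
      ((Real.exp (-C * t) * (-C) * y t + Real.exp (-C * t) * y' t) + q t) t := by
    intro t ht
    have hn : Icc 0 T ∈ 𝓝 t := Icc_mem_nhds ht.1 ht.2
    apply HasDerivAt.add
    · apply HasDerivAt.mul _ ((hy t (Ioo_subset_Icc_self ht)).hasDerivAt hn)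
      have : HasDerivAt (fun t : ℝ => -C * t) (-C) t := by
        simpa using (hasDerivAt_id t).const_mul (-C)
      exact this.exp
    · apply intervalIntegral.integral_hasDerivAt_right
      · apply hqi.mono_set
        rw [uIcc_of_le ht.1.le, uIcc_of_le hT]
        exact Icc_subset_Icc le_rfl ht.2.le
      · exact hqc.stronglyMeasurableAtFilter_nhdsWithin measurableSet_Icc t |>.filter_mono
          (by rw [nhdsWithin_eq_nhds.2 hn])
      · exact hqc.continuousAt hn
  have hanti : AntitoneOn Y (Icc 0 T) := by
    apply antitoneOn_of_deriv_nonpos (convex_Icc 0 T) hYc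
    · rw [interior_Icc]
      exact fun t ht => (hYd t ht).differentiableAt.differentiableWithinAt
    · rw [interior_Icc]
      intro t ht
      rw [(hYd t ht).deriv]
      have h1 := h t (Ioo_subset_Icc_self ht)
      have : (Real.exp (-C * t) * (-C) * y t + Real.exp (-C * t) * y' t) + q t
        = Real.exp (-C * t) * (y' t + g t - (C * y t + r t)) := by simp only [hq]; ring
      rw [this]
      exact mul_nonpos_of_nonneg_of_nonpos (Real.exp_pos _).le (by linarith)
  have := hanti (left_mem_Icc.2 hT) ht ht.1
  simpa [Y] using this

/-- Gronwall, consequences. -/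
lemma gron' {T C : ℝ} (hC : 0 ≤ C) {y y' g r : ℝ → ℝ}
    (hy : ∀ t ∈ Icc 0 T, HasDerivWithinAt y (y' t) (Icc 0 T) t)
    (hy0 : ∀ t ∈ Icc 0 T, 0 ≤ y t)
    (hg : ContinuousOn g (Icc 0 T)) (hr : ContinuousOn r (Icc 0 T))
    (hg0 : ∀ t ∈ Icc 0 T, 0 ≤ g t) (hr0 : ∀ t ∈ Icc 0 T, 0 ≤ r t)
    (h : ∀ t ∈ Icc 0 T, y' t + g t ≤ C * y t + r t) (t : ℝ) (ht : t ∈ Icc 0 T) :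
    y t + ∫ s in (0:ℝ)..t, g s ≤ Real.exp (C * T) * (y 0 + ∫ s in (0:ℝ)..t, r s) := by
  have hT : 0 ≤ T := ht.1.trans ht.2
  have h1 := gron hy hg hr h t ht
  have hsub : Icc 0 t ⊆ Icc 0 T := Icc_subset_Icc le_rfl ht.2
  have ig : IntervalIntegrable g volume 0 t := by
    apply ContinuousOn.intervalIntegrable; rw [uIcc_of_le ht.1]; exact hg.mono hsub
  have ir : IntervalIntegrable r volume 0 t := by
    apply ContinuousOn.intervalIntegrable; rw [uIcc_of_le ht.1]; exact hr.mono hsub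
  have ce : ContinuousOn (fun s => Real.exp (-C * s)) (Icc 0 T) := by fun_prop
  have ig' : IntervalIntegrable (fun s => Real.exp (-C * s) * g s) volume 0 t := by
    apply ContinuousOn.intervalIntegrable; rw [uIcc_of_le ht.1]; exact (ce.mul hg).mono hsub
  have ir' : IntervalIntegrable (fun s => Real.exp (-C * s) * r s) volume 0 t := by
    apply ContinuousOn.intervalIntegrable; rw [uIcc_of_le ht.1]; exact (ce.mul hr).mono hsub
  have e1 : ∫ s in (0:ℝ)..t, Real.exp (-C * s) * (g s - r s)
      = (∫ s in (0:ℝ)..t, Real.exp (-C * s) * g s) - ∫ s in (0:ℝ)..t, Real.exp (-C * s) * r s := by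
    rw [← intervalIntegral.integral_sub ig' ir']
    congr 1; ext s; ring
  have e2 : ∫ s in (0:ℝ)..t, Real.exp (-C * s) * r s ≤ ∫ s in (0:ℝ)..t, r s := by
    apply intervalIntegral.integral_mono_on ht.1 ir' ir
    intro s hs
    have : Real.exp (-C * s) ≤ 1 := Real.exp_le_one_iff.2 (by nlinarith [hs.1])
    nlinarith [hr0 s (hsub hs)]
  have e3 : Real.exp (-(C * T)) * ∫ s in (0:ℝ)..t, g s ≤ ∫ s in (0:ℝ)..t, Real.exp (-C * s) * g s := by
    rw [← intervalIntegral.integral_const_mul]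
    apply intervalIntegral.integral_mono_on ht.1 (ig.const_mul _) ig'
    intro s hs
    have : Real.exp (-(C * T)) ≤ Real.exp (-C * s) := Real.exp_le_exp.2 (by nlinarith [hs.2, ht.2])
    exact mul_le_mul_of_nonneg_right this (hg0 s (hsub hs))
  have e4 : Real.exp (-(C * T)) * y t ≤ Real.exp (-C * t) * y t := by
    apply mul_le_mul_of_nonneg_right _ (hy0 t ht)
    exact Real.exp_le_exp.2 (by nlinarith [ht.2])
  have e5 : Real.exp (C * T) * Real.exp (-(C * T)) = 1 := by rw [← Real.exp_add]; simp
  have e6 : Real.exp (-(C * T)) * (y t + ∫ s in (0:ℝ)..t, g s) ≤ y 0 + ∫ s in (0:ℝ)..t, r s := by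
    linarith
  calc y t + ∫ s in (0:ℝ)..t, g s
      = Real.exp (C * T) * (Real.exp (-(C * T)) * (y t + ∫ s in (0:ℝ)..t, g s)) := by
        rw [← mul_assoc, e5, one_mul]
    _ ≤ _ := mul_le_mul_of_nonneg_left e6 (Real.exp_pos _).le

lemma exists_ode {E : Type*} [NormedAddCommGroup E] [NormedSpace ℝ E] [CompleteSpace E]
    {f : E → E} {K : ℝ≥0} (hf : LipschitzWith K f) (hf0 : f 0 = 0) (x : E) {T : ℝ} (hT : 0 ≤ T) :
    ∃ u : ℝ → E, u 0 = x ∧ ∀ t ∈ Icc 0 T, HasDerivWithinAt u (f (u t)) (Icc 0 T) t := by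
  set B : ℝ := ‖x‖ * Real.exp (K * T) + 1 with hB
  have hBpos : 0 < B := by positivity
  have hBc : (B.toNNReal : ℝ) = B := Real.coe_toNNReal _ hBpos.le
  have hTc : (T.toNNReal : ℝ) = T := Real.coe_toNNReal _ hT
  have hfn : ∀ z, ‖f z‖ ≤ K * ‖z‖ := by
    intro z; simpa [hf0] using hf.norm_sub_le z 0
  set c : E → ℝ := fun z => max 0 (min 1 (2 - ‖z‖ / B)) with hc
  have hc0 : ∀ z, 0 ≤ c z := fun z => le_max_left _ _
  have hc1 : ∀ z, c z ≤ 1 := fun z => max_le zero_le_one (min_le_left _ _)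
  have hcl : ∀ z w, |c z - c w| ≤ ‖z - w‖ / B := by
    intro z w
    have h1 : |c z - c w| ≤ |min 1 (2 - ‖z‖ / B) - min 1 (2 - ‖w‖ / B)| := by
      have := abs_max_sub_max_le_max (0:ℝ) (min 1 (2 - ‖z‖ / B)) 0 (min 1 (2 - ‖w‖ / B))
      simpa using this
    have h2 : |min 1 (2 - ‖z‖ / B) - min 1 (2 - ‖w‖ / B)| ≤ |(2 - ‖z‖ / B) - (2 - ‖w‖ / B)| := by
      have := abs_min_sub_min_le_max (1:ℝ) (2 - ‖z‖ / B) 1 (2 - ‖w‖ / B)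
      simpa using this
    refine h1.trans (h2.trans ?_)
    have : (2 - ‖z‖ / B) - (2 - ‖w‖ / B) = (‖w‖ - ‖z‖) / B := by ring
    rw [this, abs_div, abs_of_pos hBpos]
    gcongr
    rw [norm_sub_rev]
    exact abs_norm_sub_norm_le w z
  have hcz : ∀ z, 2 * B ≤ ‖z‖ → c z = 0 := by
    intro z hz
    have : 2 ≤ ‖z‖ / B := by rwa [le_div_iff₀ hBpos]
    simp only [hc]
    apply max_eq_left
    exact (min_le_right _ _).trans (by linarith)
  have hcB : ∀ z, ‖z‖ ≤ B → c z = 1 := by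
    intro z hz
    have : ‖z‖ / B ≤ 1 := by rwa [div_le_one hBpos]
    simp only [hc]
    rw [min_eq_left (by linarith)]
    simp
  set F : E → E := fun z => c z • f z with hF
  have hFb : ∀ z, ‖F z‖ ≤ K * (2 * B) := by
    intro z
    simp only [hF]
    rw [norm_smul, Real.norm_eq_abs, abs_of_nonneg (hc0 z)]
    by_cases hz : 2 * B ≤ ‖z‖
    · rw [hcz z hz]; simp; positivity
    · push Not at hz
      calc c z * ‖f z‖ ≤ 1 * (K * ‖z‖) := by
            apply mul_le_mul (hc1 z) (hfn z) (norm_nonneg _) zero_le_one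
        _ ≤ _ := by rw [one_mul]; gcongr
  set L : ℝ≥0 := K * (2 * B.toNNReal) with hL
  set a : ℝ≥0 := L * T.toNNReal with ha
  set M : ℝ≥0 := K * (‖x‖₊ + a) with hM
  have hlip : LipschitzOnWith (K + M / B.toNNReal) F (Metric.closedBall x a) := by
    apply LipschitzOnWith.of_dist_le_mul
    intro z hz w hw
    rw [dist_eq_norm, dist_eq_norm]
    have : F z - F w = c z • (f z - f w) + (c z - c w) • f w := by
      simp only [hF]; module
    rw [this]
    have hw' : ‖f w‖ ≤ M := by
      refine (hfn w).trans ?_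
      simp only [hM, NNReal.coe_mul, NNReal.coe_add, coe_nnnorm]
      gcongr
      have := norm_sub_norm_le w x
      rw [mem_closedBall_iff_norm] at hw
      linarith
    calc ‖c z • (f z - f w) + (c z - c w) • f w‖
        ≤ c z * ‖f z - f w‖ + |c z - c w| * ‖f w‖ := by
          refine (norm_add_le _ _).trans ?_
          rw [norm_smul, norm_smul, Real.norm_eq_abs, Real.norm_eq_abs, abs_of_nonneg (hc0 z)]
      _ ≤ 1 * (K * ‖z - w‖) + ‖z - w‖ / B * M := by
          gcongr
          · exact hc1 z
          · exact hf.norm_sub_le z w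
          · exact hcl z w
      _ = _ := by
          push_cast; rw [hBc]; ring
  have hPL : IsPicardLindelof (fun _ ↦ F) (tmin := 0) (tmax := T) ⟨0, left_mem_Icc.2 hT⟩ x a 0 L
      (K + M / B.toNNReal) := by
    apply IsPicardLindelof.of_time_independent
    · intro z _
      refine (hFb z).trans (le_of_eq ?_)
      simp only [hL, NNReal.coe_mul, hBc]; norm_num
    · exact hlip
    · simp only [ha, NNReal.coe_mul, hTc, NNReal.coe_zero, sub_zero, zero_sub]; simp [hT]
  obtain ⟨u, hu0, hu⟩ := hPL.exists_eq_forall_mem_Icc_hasDerivWithinAt₀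
  refine ⟨u, hu0, fun t ht => ?_⟩
  have hbd : ∀ t ∈ Icc 0 T, ‖u t‖ ≤ gronwallBound ‖x‖ K 0 (t - 0) := by
    apply norm_le_gronwallBound_of_norm_deriv_right_le (f' := fun t => F (u t))
    · exact fun t ht => (hu t ht).continuousWithinAt
    · intro t ht
      apply (hu t (Ico_subset_Icc_self ht)).mono_of_mem_nhdsWithin
      exact Icc_mem_nhdsGE_of_mem ht
    · exact (congrArg norm hu0).le
    · intro t ht
      simp only [hF, add_zero]
      rw [norm_smul, Real.norm_eq_abs, abs_of_nonneg (hc0 _)]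
      calc c (u t) * ‖f (u t)‖ ≤ 1 * (K * ‖u t‖) :=
            mul_le_mul (hc1 _) (hfn _) (norm_nonneg _) zero_le_one
        _ = _ := one_mul _
  have h1 := hbd t ht
  rw [gronwallBound_ε0, sub_zero] at h1
  have h2 : ‖u t‖ ≤ B := by
    refine h1.trans ?_
    rw [hB]
    have : Real.exp (K * t) ≤ Real.exp (K * T) := Real.exp_le_exp.2 (by gcongr; exact ht.2)
    nlinarith [norm_nonneg x]
  have h3 := hu t ht
  simp only [hF, hcB _ h2, one_smul] at h3
  exact h3

end VW


namespace VW
open Set Filter Topology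
open scoped NNReal ENNReal

/-- Lipschitz functions vanishing at zero. -/
def LZ (g : ℝ → ℝ) : Prop := (∃ c : ℝ≥0, LipschitzWith c g) ∧ g 0 = 0

lemma LZ.bound {g : ℝ → ℝ} (h : LZ g) :
    ∃ c : ℝ, 0 ≤ c ∧ (∀ a b, |g a - g b| ≤ c * |a - b|) ∧ ∀ a, |g a| ≤ c * |a| := by
  obtain ⟨⟨c, hc⟩, h0⟩ := h
  have h1 : ∀ a b, |g a - g b| ≤ c * |a - b| := fun a b => by
    simpa [Real.dist_eq] using hc.dist_le_mul a b
  exact ⟨c, c.2, h1, fun a => by simpa [h0] using h1 a 0⟩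

lemma LZ.of_bound {g : ℝ → ℝ} (h0 : g 0 = 0) {c : ℝ}
    (h : ∀ a b, |g a - g b| ≤ c * |a - b|) : LZ g := by
  refine ⟨⟨c.toNNReal, LipschitzWith.of_dist_le_mul fun a b => ?_⟩, h0⟩
  rw [Real.dist_eq, Real.dist_eq]
  exact (h a b).trans (mul_le_mul_of_nonneg_right (Real.le_coe_toNNReal c) (abs_nonneg _))

lemma LZ.continuous {g : ℝ → ℝ} (h : LZ g) : Continuous g := h.1.choose_spec.continuous

variable {α : Type*} [MeasurableSpace α] {μ : Measure α}

open Classical in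
/-- Nemytskii operator. -/
noncomputable def nem (μ : Measure α) (g : ℝ → ℝ) (f : Lp ℝ 2 μ) : Lp ℝ 2 μ :=
  if h : LZ g then h.1.choose_spec.compLp h.2 f else 0

lemma coe_nem {g : ℝ → ℝ} (h : LZ g) (f : Lp ℝ 2 μ) : ∀ᵐ x ∂μ, nem μ g f x = g (f x) := by
  unfold nem
  rw [dif_pos h]
  exact h.1.choose_spec.coeFn_compLp h.2 f

lemma nem_lip {g : ℝ → ℝ} (h : LZ g) : ∃ c : ℝ≥0, LipschitzWith c (nem μ g) := by
  refine ⟨h.1.choose, ?_⟩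
  have : nem μ g = h.1.choose_spec.compLp h.2 := by
    ext1 f; unfold nem; rw [dif_pos h]
  rw [this]
  exact h.1.choose_spec.lipschitzWith_compLp h.2

lemma nem_continuous {g : ℝ → ℝ} (h : LZ g) : Continuous (nem μ g) :=
  (nem_lip h).choose_spec.continuous

lemma nem_zero {g : ℝ → ℝ} (h : LZ g) : nem μ g 0 = 0 := by
  unfold nem; rw [dif_pos h]; exact h.1.choose_spec.compLp_zero h.2

lemma inner_eq (f g : Lp ℝ 2 μ) : inner ℝ f g = ∫ x, f x * g x ∂μ := by
  rw [L2.inner_def]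
  congr 1; ext x; simp [mul_comm]

lemma int_mul (f g : Lp ℝ 2 μ) : Integrable (fun x => f x * g x) μ := by
  have := L2.integrable_inner (𝕜 := ℝ) f g
  refine this.congr (ae_of_all _ fun x => ?_)
  simp [mul_comm]

lemma norm_sq (f : Lp ℝ 2 μ) : ‖f‖ ^ 2 = ∫ x, f x ^ 2 ∂μ := by
  rw [← real_inner_self_eq_norm_sq, inner_eq]
  congr 1; ext x; ring

lemma int_sq (f : Lp ℝ 2 μ) : Integrable (fun x => f x ^ 2) μ :=
  (int_mul f f).congr (ae_of_all _ fun x => by ring)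

lemma inner_mono {f g h k : Lp ℝ 2 μ} (H : ∀ᵐ x ∂μ, f x * g x ≤ h x * k x) :
    inner ℝ f g ≤ inner ℝ h k := by
  rw [inner_eq, inner_eq]
  exact integral_mono_ae (int_mul _ _) (int_mul _ _) H

lemma taylor_bound {η H : ℝ → ℝ} {c : ℝ} (hc : ∀ a b, |η a - η b| ≤ c * |a - b|) (hc0 : 0 ≤ c)
    (hH : ∀ s, HasDerivAt H (η s) s) (a b : ℝ) :
    |H b - H a - η a * (b - a)| ≤ c * (b - a) ^ 2 := by
  have h1 : ∀ s ∈ uIcc a b, HasDerivWithinAt (fun s => H s - η a * s) (η s - η a) (uIcc a b) s := by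
    intro s _
    have := (hH s).sub ((hasDerivAt_id s).const_mul (η a))
    simp only [mul_one] at this
    exact this.hasDerivWithinAt
  have h2 : ∀ s ∈ uIcc a b, ‖η s - η a‖ ≤ c * |b - a| := by
    intro s hs
    refine (hc s a).trans ?_
    exact mul_le_mul_of_nonneg_left (abs_sub_left_of_mem_uIcc hs) hc0
  have := Convex.norm_image_sub_le_of_norm_hasDerivWithin_le h1 h2 (convex_uIcc a b)
    left_mem_uIcc right_mem_uIcc
  rw [Real.norm_eq_abs, Real.norm_eq_abs, mul_assoc, abs_mul_abs_self] at this
  calc _ = |H b - η a * b - (H a - η a * a)| := by congr 1; ring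
    _ ≤ _ := this
    _ = _ := by ring

lemma H_bound {η H : ℝ → ℝ} {c : ℝ} (h0 : η 0 = 0) (H0 : H 0 = 0)
    (hc : ∀ a b, |η a - η b| ≤ c * |a - b|) (hc0 : 0 ≤ c)
    (hH : ∀ s, HasDerivAt H (η s) s) (b : ℝ) : |H b| ≤ c * b ^ 2 := by
  simpa [h0, H0] using taylor_bound hc hc0 hH 0 b

lemma int_H {η H : ℝ → ℝ} (hη : LZ η) (H0 : H 0 = 0) (hH : ∀ s, HasDerivAt H (η s) s)
    (f : Lp ℝ 2 μ) : Integrable (fun x => H (f x)) μ := by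
  obtain ⟨c, hc0, hc, -⟩ := hη.bound
  have hHc : Continuous H := continuous_iff_continuousAt.2 fun s => (hH s).continuousAt
  apply ((int_sq f).const_mul c).mono' (hHc.comp_aestronglyMeasurable (Lp.aestronglyMeasurable f))
  exact ae_of_all _ fun x => H_bound hη.2 H0 hc hc0 hH _

lemma chain {η H : ℝ → ℝ} (hη : LZ η) (H0 : H 0 = 0) (hH : ∀ s, HasDerivAt H (η s) s)
    {u : ℝ → Lp ℝ 2 μ} {u' : Lp ℝ 2 μ} {S : Set ℝ} {t : ℝ} (hu : HasDerivWithinAt u u' S t) :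
    HasDerivWithinAt (fun t => ∫ x, H (u t x) ∂μ) (inner ℝ (nem μ η (u t)) u') S t := by
  obtain ⟨c, hc0, hc, -⟩ := hη.bound
  have key : HasFDerivAt (fun f : Lp ℝ 2 μ => ∫ x, H (f x) ∂μ)
      (innerSL ℝ (nem μ η (u t))) (u t) := by
    rw [hasFDerivAt_iff_isLittleO]
    set f := u t
    have hb : (fun g : Lp ℝ 2 μ => (∫ x, H (g x) ∂μ) - (∫ x, H (f x) ∂μ)
        - innerSL ℝ (nem μ η f) (g - f)) =O[𝓝 f] fun g => ‖g - f‖ ^ 2 := by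
      apply Asymptotics.IsBigO.of_bound c
      refine Eventually.of_forall fun g => ?_
      have i1 : Integrable (fun x => H (g x) - H (f x)) μ :=
        (int_H hη H0 hH g).sub (int_H hη H0 hH f)
      rw [innerSL_apply_apply, inner_eq, ← integral_sub (int_H hη H0 hH g) (int_H hη H0 hH f),
        ← integral_sub i1 (int_mul _ _)]
      rw [norm_sq, Real.norm_of_nonneg (integral_nonneg fun x => sq_nonneg _),
        ← integral_const_mul]
      apply norm_integral_le_of_norm_le ((int_sq _).const_mul c)
      filter_upwards [coe_nem hη f, Lp.coeFn_sub g f] with x h1 h2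
      rw [h1, h2]
      exact taylor_bound hc hc0 hH _ _
    refine hb.trans_isLittleO ?_
    have : (fun g : Lp ℝ 2 μ => g - f) =o[𝓝 f] fun _ => (1:ℝ) := by
      rw [Asymptotics.isLittleO_one_iff]
      have : Tendsto (fun g : Lp ℝ 2 μ => g - f) (𝓝 f) (𝓝 (f - f)) :=
        (continuous_id.sub continuous_const).tendsto f
      simpa using this
    have h2 := this.norm_left.mul_isBigO (Asymptotics.isBigO_refl (fun g : Lp ℝ 2 μ => ‖g - f‖) (𝓝 f))
    simp only [one_mul] at h2
    refine (h2.congr_left fun g => ?_).of_norm_right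
    ring
  have := key.comp_hasDerivWithinAt t hu
  rw [innerSL_apply_apply] at this
  exact this

/-- Resolvent-type operators. -/
structure Res (μ : Measure α) (ε κ : ℝ) (A : Lp ℝ 2 μ →L[ℝ] Lp ℝ 2 μ) : Prop where
  eps : 0 < ε
  symm : ∀ f g, inner ℝ (A f) g = inner ℝ f (A g)
  coer : ∀ f, κ * ‖f‖ ^ 2 ≤ inner ℝ (A f) f
  bnd : ∀ f, ε * ‖A f‖ ^ 2 ≤ inner ℝ (A f) f
  mark : ∀ (v : Lp ℝ 2 μ) (c : ℝ), 0 ≤ c → (∀ᵐ x ∂μ, v x ≤ c) → ∀ᵐ x ∂μ, (v - ε • A v) x ≤ c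

namespace Res
variable {ε κ : ℝ} {A : Lp ℝ 2 μ →L[ℝ] Lp ℝ 2 μ}

/-- The Markov operator. -/
noncomputable def R (ε : ℝ) (A : Lp ℝ 2 μ →L[ℝ] Lp ℝ 2 μ) : Lp ℝ 2 μ →L[ℝ] Lp ℝ 2 μ :=
  ContinuousLinearMap.id ℝ _ - ε • A

lemma R_apply (v : Lp ℝ 2 μ) : R ε A v = v - ε • A v := rfl

lemma R_symm (h : Res μ ε κ A) (f g : Lp ℝ 2 μ) : inner ℝ (R ε A f) g = inner ℝ f (R ε A g) := by
  simp only [R_apply, inner_sub_left, inner_sub_right, inner_smul_left, inner_smul_right, h.symm]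
  simp

lemma R_le (h : Res μ ε κ A) (v : Lp ℝ 2 μ) (c : ℝ) (hc : 0 ≤ c) (hv : ∀ᵐ x ∂μ, v x ≤ c) :
    ∀ᵐ x ∂μ, R ε A v x ≤ c := h.mark v c hc hv

lemma R_mono (h : Res μ ε κ A) (v w : Lp ℝ 2 μ) (hv : ∀ᵐ x ∂μ, v x ≤ w x) :
    ∀ᵐ x ∂μ, R ε A v x ≤ R ε A w x := by
  have := h.R_le (v - w) 0 le_rfl (by
    filter_upwards [hv, Lp.coeFn_sub v w] with x h1 h2
    rw [h2, Pi.sub_apply]; linarith)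
  rw [map_sub] at this
  filter_upwards [this, Lp.coeFn_sub (R ε A v) (R ε A w)] with x h1 h2
  rw [h2, Pi.sub_apply] at h1; linarith

lemma R_nonneg (h : Res μ ε κ A) (v : Lp ℝ 2 μ) (hv : ∀ᵐ x ∂μ, 0 ≤ v x) :
    ∀ᵐ x ∂μ, 0 ≤ R ε A v x := by
  have := h.R_mono 0 v (by filter_upwards [hv, Lp.coeFn_zero ℝ 2 μ] with x h1 h2; rw [h2]; exact h1)
  rw [map_zero] at this
  filter_upwards [this, Lp.coeFn_zero ℝ 2 μ] with x h1 h2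
  rw [h2] at h1; exact h1

lemma A_eq (h : Res μ ε κ A) (f g : Lp ℝ 2 μ) :
    inner ℝ (A f) g = ε⁻¹ * (inner ℝ f g - inner ℝ (R ε A f) g) := by
  rw [R_apply, inner_sub_left, inner_smul_left]
  have := h.eps.ne'
  simp only [conj_trivial]
  field_simp
  ring

/-- Stroock–Varopoulos type inequality. -/
lemma SV [SigmaFinite μ] (h : Res μ ε κ A) {f g k l : ℝ → ℝ} {θ : ℝ} (hf : LZ f) (hg : LZ g)
    (hk : LZ k) (hl : LZ l) (hl' : ∀ a, l a = f a * g a - θ * k a ^ 2)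
    (H : ∀ a b, θ * (k a - k b) ^ 2 ≤ (f a - f b) * (g a - g b)) (u : Lp ℝ 2 μ) :
    θ * inner ℝ (A (nem μ k u)) (nem μ k u) ≤ inner ℝ (A (nem μ f u)) (nem μ g u) := by
  have hl0 : ∀ a, 0 ≤ l a := by
    intro a; have := H a 0; rw [hf.2, hg.2, hk.2] at this; rw [hl']; simp at this; linarith
  set Rr := R ε A
  -- step 1 : for each a
  have s1 : ∀ a : ℝ, ∀ᵐ z ∂μ, f a * Rr (nem μ g u) z + g a * Rr (nem μ f u) z
      - 2 * θ * k a * Rr (nem μ k u) z - Rr (nem μ l u) z ≤ l a := by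
    intro a
    set v : Lp ℝ 2 μ := f a • nem μ g u + g a • nem μ f u - (2 * θ * k a) • nem μ k u - nem μ l u
    have exp : ∀ p q r s : Lp ℝ 2 μ, ∀ᵐ z ∂μ, (f a • p + g a • q - (2 * θ * k a) • r - s) z
        = f a * p z + g a * q z - 2 * θ * k a * r z - s z := by
      intro p q r s
      filter_upwards [Lp.coeFn_sub (f a • p + g a • q - (2 * θ * k a) • r) s,
        Lp.coeFn_sub (f a • p + g a • q) ((2 * θ * k a) • r), Lp.coeFn_add (f a • p) (g a • q),
        Lp.coeFn_smul (f a) p, Lp.coeFn_smul (g a) q, Lp.coeFn_smul (2 * θ * k a) r]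
        with z h1 h2 h3 h4 h5 h6
      simp only [h1, h2, h3, h4, h5, h6, Pi.sub_apply, Pi.add_apply, Pi.smul_apply, smul_eq_mul]
    have hv : ∀ᵐ z ∂μ, v z ≤ l a := by
      filter_upwards [exp (nem μ g u) (nem μ f u) (nem μ k u) (nem μ l u), coe_nem hf u,
        coe_nem hg u, coe_nem hk u, coe_nem hl u] with z h1 h2 h3 h4 h5
      rw [h1, h2, h3, h4, h5, hl', hl']
      have := H a (u z)
      nlinarith
    have := h.R_le v (l a) (hl0 a) hv
    have e : R ε A v = f a • Rr (nem μ g u) + g a • Rr (nem μ f u)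
        - (2 * θ * k a) • Rr (nem μ k u) - Rr (nem μ l u) := by
      simp only [v, map_sub, map_add, map_smul, Rr]
    rw [e] at this
    filter_upwards [this, exp (Rr (nem μ g u)) (Rr (nem μ f u)) (Rr (nem μ k u)) (Rr (nem μ l u))]
      with z h1 h2
    rwa [h2] at h1
  have s2 : ∀ᵐ z ∂μ, ∀ a : ℝ, f a * Rr (nem μ g u) z + g a * Rr (nem μ f u) z
      - 2 * θ * k a * Rr (nem μ k u) z - Rr (nem μ l u) z ≤ l a := by
    have : ∀ᵐ z ∂μ, ∀ a : ℚ, f a * Rr (nem μ g u) z + g a * Rr (nem μ f u) z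
      - 2 * θ * k a * Rr (nem μ k u) z - Rr (nem μ l u) z ≤ l a := ae_all_iff.2 fun a => s1 a
    filter_upwards [this] with z hz
    have hcl : IsClosed {a : ℝ | f a * Rr (nem μ g u) z + g a * Rr (nem μ f u) z
      - 2 * θ * k a * Rr (nem μ k u) z - Rr (nem μ l u) z ≤ l a} := by
      have := hf.continuous; have := hg.continuous; have := hk.continuous; have := hl.continuous
      exact isClosed_le (by fun_prop) (by fun_prop)
    have hd : Dense (Set.range ((↑) : ℚ → ℝ)) := Rat.denseRange_cast
    intro a
    have hsub : closure (Set.range ((↑) : ℚ → ℝ)) ⊆ _ :=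
      hcl.closure_subset_iff.2 (by rintro _ ⟨q, rfl⟩; exact hz q)
    exact hsub (hd a)
  -- Q
  set Q : α → ℝ := fun z => nem μ f u z * Rr (nem μ g u) z + nem μ g u z * Rr (nem μ f u) z
      - 2 * θ * (nem μ k u z * Rr (nem μ k u) z)
      - (nem μ f u z * nem μ g u z - θ * (nem μ k u z * nem μ k u z)) with hQ
  have iL : Integrable (fun z => nem μ f u z * nem μ g u z - θ * (nem μ k u z * nem μ k u z)) μ :=
    (int_mul _ _).sub ((int_mul _ _).const_mul θ)
  have iQ : Integrable Q μ :=
    (((int_mul _ _).add (int_mul _ _)).sub ((int_mul _ _).const_mul (2 * θ))).sub iL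
  have s3 : ∀ᵐ z ∂μ, Q z ≤ Rr (nem μ l u) z := by
    filter_upwards [s2, coe_nem hf u, coe_nem hg u, coe_nem hk u] with z h1 h2 h3 h4
    have := h1 (u z)
    rw [hl'] at this
    simp only [hQ, h2, h3, h4]
    nlinarith
  have sB : ∀ j : ℕ, ∫ z in spanningSets μ j, Q z ∂μ ≤
      ∫ z, (nem μ f u z * nem μ g u z - θ * (nem μ k u z * nem μ k u z)) ∂μ := by
    intro j
    have hB := measurableSet_spanningSets μ j
    have hBf := (measure_spanningSets_lt_top μ j).ne
    set χ : Lp ℝ 2 μ := indicatorConstLp 2 hB hBf (1:ℝ)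
    have hχ : ∀ᵐ z ∂μ, χ z = (spanningSets μ j).indicator (fun _ => (1:ℝ)) z := indicatorConstLp_coeFn
    have hRχ : ∀ᵐ z ∂μ, Rr χ z ≤ 1 := by
      apply h.R_le χ 1 zero_le_one
      filter_upwards [hχ] with z hz
      rw [hz]; by_cases hh : z ∈ spanningSets μ j <;> simp [hh]
    calc ∫ z in spanningSets μ j, Q z ∂μ
        ≤ ∫ z in spanningSets μ j, Rr (nem μ l u) z ∂μ := by
          apply setIntegral_mono_ae iQ.integrableOn _ s3
          apply integrableOn_Lp_of_measure_ne_top _ (by norm_num) hBf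
      _ = inner ℝ χ (Rr (nem μ l u)) := by
          rw [inner_eq, ← integral_indicator hB]
          apply integral_congr_ae
          filter_upwards [hχ] with z hz
          rw [hz]; by_cases hh : z ∈ spanningSets μ j <;> simp [hh]
      _ = inner ℝ (Rr χ) (nem μ l u) := (h.R_symm _ _).symm
      _ ≤ _ := by
          rw [inner_eq]
          apply integral_mono_ae (int_mul _ _) iL
          filter_upwards [hRχ, coe_nem hf u, coe_nem hg u, coe_nem hk u, coe_nem hl u]
            with z h1 h2 h3 h4 h5
          simp only [h2, h3, h4, h5]
          have := hl0 (u z)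
          have e := hl' (u z)
          nlinarith
  have s4 : ∫ z, Q z ∂μ ≤
      ∫ z, (nem μ f u z * nem μ g u z - θ * (nem μ k u z * nem μ k u z)) ∂μ := by
    have ht := tendsto_setIntegral_of_monotone (fun j => measurableSet_spanningSets μ j)
      (monotone_spanningSets μ) (f := Q) (μ := μ) iQ.integrableOn
    rw [iUnion_spanningSets, setIntegral_univ] at ht
    exact le_of_tendsto' ht sB
  have eL : ∫ z, (nem μ f u z * nem μ g u z - θ * (nem μ k u z * nem μ k u z)) ∂μ
      = inner ℝ (nem μ f u) (nem μ g u) - θ * inner ℝ (nem μ k u) (nem μ k u) := by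
    rw [integral_sub (int_mul _ _) ((int_mul _ _).const_mul θ), integral_const_mul,
      ← inner_eq, ← inner_eq]
  have eQ : ∫ z, Q z ∂μ = inner ℝ (nem μ f u) (Rr (nem μ g u)) + inner ℝ (nem μ g u) (Rr (nem μ f u))
      - 2 * θ * inner ℝ (nem μ k u) (Rr (nem μ k u))
      - (inner ℝ (nem μ f u) (nem μ g u) - θ * inner ℝ (nem μ k u) (nem μ k u)) := by
    rw [← eL, hQ, integral_sub, integral_sub, integral_add, integral_const_mul,
      ← inner_eq, ← inner_eq, ← inner_eq]
    · exact int_mul _ _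
    · exact int_mul _ _
    · exact (int_mul _ _).add (int_mul _ _)
    · exact (int_mul _ _).const_mul (2 * θ)
    · exact ((int_mul _ _).add (int_mul _ _)).sub ((int_mul _ _).const_mul (2 * θ))
    · exact iL
  rw [eQ, eL] at s4
  have e1 : inner ℝ (nem μ f u) (Rr (nem μ g u)) = inner ℝ (Rr (nem μ f u)) (nem μ g u) :=
    (h.R_symm _ _).symm
  have e2 : inner ℝ (nem μ g u) (Rr (nem μ f u)) = inner ℝ (Rr (nem μ f u)) (nem μ g u) :=
    real_inner_comm _ _
  have e3 : inner ℝ (nem μ k u) (Rr (nem μ k u)) = inner ℝ (Rr (nem μ k u)) (nem μ k u) :=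
    real_inner_comm _ _
  rw [e1, e2, e3] at s4
  rw [h.A_eq, h.A_eq, mul_left_comm]
  apply mul_le_mul_of_nonneg_left _ (inv_nonneg.2 h.eps.le)
  linarith

end Res
end VW


namespace VW
open Set Filter Topology
open scoped NNReal ENNReal

/-- Lipschitz on a compact interval. -/
def LB (r : ℝ) (h : ℝ → ℝ) : Prop :=
  ∃ c : ℝ, 0 ≤ c ∧ ∀ x ∈ Icc 0 r, ∀ y ∈ Icc 0 r, |h x - h y| ≤ c * |x - y|

lemma LB.const (r a : ℝ) : LB r fun _ => a := ⟨0, le_rfl, by simp⟩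
lemma LB.id (r : ℝ) : LB r fun x => x := ⟨1, zero_le_one, by simp⟩

lemma LB.sub {r : ℝ} {f g : ℝ → ℝ} (hf : LB r f) (hg : LB r g) : LB r fun x => f x - g x := by
  obtain ⟨c, hc, h1⟩ := hf
  obtain ⟨d, hd, h2⟩ := hg
  refine ⟨c + d, by positivity, fun x hx y hy => ?_⟩
  have := abs_sub (f x - f y) (g x - g y)
  have e : f x - g x - (f y - g y) = (f x - f y) - (g x - g y) := by ring
  rw [e]
  nlinarith [h1 x hx y hy, h2 x hx y hy, add_mul c d |x - y|]

lemma LB.bdd {r : ℝ} {f : ℝ → ℝ} (hf : LB r f) : ∃ B, 0 ≤ B ∧ ∀ x ∈ Icc 0 r, |f x| ≤ B := by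
  obtain ⟨c, hc, h1⟩ := hf
  by_cases hr : 0 ≤ r
  · refine ⟨c * r + |f 0|, by positivity, fun x hx => ?_⟩
    have h2 := h1 x hx 0 ⟨le_rfl, hr⟩
    have h3 : |f x| ≤ |f x - f 0| + |f 0| := by
      have := abs_add_le (f x - f 0) (f 0); simpa using this
    rw [sub_zero, abs_of_nonneg hx.1] at h2
    nlinarith [hx.2, hx.1]
  · exact ⟨0, le_rfl, fun x hx => absurd (hx.1.trans hx.2) hr⟩

lemma LB.mul {r : ℝ} {f g : ℝ → ℝ} (hf : LB r f) (hg : LB r g) : LB r fun x => f x * g x := by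
  obtain ⟨B, hB, h3⟩ := hf.bdd
  obtain ⟨D, hD, h4⟩ := hg.bdd
  obtain ⟨c, hc, h1⟩ := hf
  obtain ⟨d, hd, h2⟩ := hg
  refine ⟨B * d + D * c, by positivity, fun x hx y hy => ?_⟩
  have e : f x * g x - f y * g y = f x * (g x - g y) + g y * (f x - f y) := by ring
  rw [e]
  refine (abs_add_le _ _).trans ?_
  rw [abs_mul, abs_mul, add_mul]
  apply add_le_add
  · rw [mul_assoc]
    exact mul_le_mul (h3 x hx) (h2 x hx y hy) (abs_nonneg _) hB
  · rw [mul_assoc]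
    exact mul_le_mul (h4 y hy) (h1 x hx y hy) (abs_nonneg _) hD

lemma LB.min {r : ℝ} {f g : ℝ → ℝ} (hf : LB r f) (hg : LB r g) : LB r fun x => min (f x) (g x) := by
  obtain ⟨c, hc, h1⟩ := hf
  obtain ⟨d, hd, h2⟩ := hg
  refine ⟨c + d, by positivity, fun x hx y hy => ?_⟩
  refine (abs_min_sub_min_le_max _ _ _ _).trans (max_le ?_ ?_)
  · nlinarith [h1 x hx y hy, abs_nonneg (x - y)]
  · nlinarith [h2 x hx y hy, abs_nonneg (x - y)]

lemma LB.max {r : ℝ} {f g : ℝ → ℝ} (hf : LB r f) (hg : LB r g) : LB r fun x => max (f x) (g x) := by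
  obtain ⟨c, hc, h1⟩ := hf
  obtain ⟨d, hd, h2⟩ := hg
  refine ⟨c + d, by positivity, fun x hx y hy => ?_⟩
  refine (abs_max_sub_max_le_max _ _ _ _).trans (max_le ?_ ?_)
  · nlinarith [h1 x hx y hy, abs_nonneg (x - y)]
  · nlinarith [h2 x hx y hy, abs_nonneg (x - y)]

lemma rpow_lip {a b q : ℝ} (ha : 0 ≤ a) (h : 0 < a ∨ 1 ≤ q) :
    ∃ c : ℝ, 0 ≤ c ∧ ∀ x ∈ Icc a b, ∀ y ∈ Icc a b, |x ^ q - y ^ q| ≤ c * |x - y| := by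
  have hne : ∀ x ∈ Icc a b, x ≠ 0 ∨ 1 ≤ q := fun x hx => by
    rcases h with h | h
    · exact Or.inl (by have := hx.1; linarith)
    · exact Or.inr h
  have hne' : ∀ x ∈ Icc a b, x ≠ 0 ∨ 0 ≤ q - 1 := fun x hx => by
    rcases hne x hx with h | h
    · exact Or.inl h
    · exact Or.inr (by linarith)
  have hcont : ContinuousOn (fun x : ℝ => q * x ^ (q - 1)) (Icc a b) :=
    continuousOn_const.mul (continuousOn_id.rpow_const hne')
  obtain ⟨C, hC⟩ := isCompact_Icc.exists_bound_of_continuousOn hcont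
  refine ⟨|C|, abs_nonneg _, fun x hx y hy => ?_⟩
  have := Convex.norm_image_sub_le_of_norm_hasDerivWithin_le (f := fun x : ℝ => x ^ q)
    (f' := fun x : ℝ => q * x ^ (q - 1)) (s := Icc a b) (C := |C|)
    (fun z hz => (Real.hasDerivAt_rpow_const (hne z hz)).hasDerivWithinAt)
    (fun z hz => (hC z hz).trans (le_abs_self _)) (convex_Icc a b) hy hx
  simpa using this

lemma LB.rpow {r q : ℝ} (hq : 1 ≤ q) : LB r fun x => x ^ q :=
  rpow_lip le_rfl (Or.inr hq)

lemma LB.rpow_max {r d q : ℝ} (hd : 0 < d) : LB r fun x => (Max.max x d) ^ q := by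
  obtain ⟨c, hc, h⟩ := rpow_lip (a := d) (b := Max.max r d) (q := q) hd.le (Or.inl hd)
  refine ⟨c, hc, fun x hx y hy => (h _ ⟨le_max_right _ _, max_le_max hx.2 le_rfl⟩ _
    ⟨le_max_right _ _, max_le_max hy.2 le_rfl⟩).trans ?_⟩
  exact mul_le_mul_of_nonneg_left (abs_max_sub_max_le_abs _ _ _) hc

/-- clip to `[0,r]` -/
noncomputable def clp (r s : ℝ) : ℝ := max 0 (min s r)

lemma clp_mem {r : ℝ} (hr : 0 ≤ r) (s : ℝ) : clp r s ∈ Icc 0 r :=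
  ⟨le_max_left _ _, max_le hr (min_le_right _ _)⟩
lemma clp_zero {r : ℝ} (hr : 0 ≤ r) : clp r 0 = 0 := by simp [clp, hr]
lemma clp_eq {r s : ℝ} (h0 : 0 ≤ s) (h : s ≤ r) : clp r s = s := by simp [clp, h, h0]
lemma clp_top {r s : ℝ} (hr : 0 ≤ r) (h : r ≤ s) : clp r s = r := by simp [clp, h, hr]
lemma clp_bot {r s : ℝ} (h : s ≤ 0) : clp r s = 0 := by
  unfold clp; exact max_eq_left ((min_le_left _ _).trans h)
lemma clp_mono {r a b : ℝ} (h : a ≤ b) : clp r a ≤ clp r b :=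
  max_le_max le_rfl (min_le_min h le_rfl)
lemma clp_lip (r a b : ℝ) : |clp r a - clp r b| ≤ |a - b| := by
  unfold clp
  rw [max_comm, max_comm 0]
  refine (abs_max_sub_max_le_abs _ _ _).trans ?_
  have := abs_min_sub_min_le_max a r b r
  simpa using this

lemma LZ.of_LB {r : ℝ} (hr : 0 ≤ r) {h g : ℝ → ℝ} (hh : LB r h) (h0 : h 0 = 0)
    (hg : ∀ s, g s = h (clp r s)) : LZ g := by
  obtain ⟨c, hc, H⟩ := hh
  refine LZ.of_bound (c := c) (by rw [hg, clp_zero hr, h0]) fun a b => ?_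
  rw [hg, hg]
  exact (H _ (clp_mem hr a) _ (clp_mem hr b)).trans (mul_le_mul_of_nonneg_left (clp_lip r a b) hc)

lemma LZ.zero : LZ (fun _ => 0) := LZ.of_bound rfl (c := 0) (by simp)
lemma LZ.id : LZ (fun s => s) := LZ.of_bound rfl (c := 1) (by simp)
lemma clp_LZ {r : ℝ} (hr : 0 ≤ r) : LZ (clp r) := LZ.of_LB hr (LB.id r) rfl fun _ => rfl

/-- truncated porous medium nonlinearity -/
noncomputable def Ph (m r s : ℝ) : ℝ := clp r s ^ m

section Ph
variable {m r : ℝ}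
lemma Ph_LZ (hm : 1 ≤ m) (hr : 0 ≤ r) : LZ (Ph m r) :=
  LZ.of_LB hr (LB.rpow hm) (Real.zero_rpow (by linarith)) fun _ => rfl
lemma Ph_nonneg (hr : 0 ≤ r) (s : ℝ) : 0 ≤ Ph m r s := Real.rpow_nonneg (clp_mem hr s).1 _
lemma Ph_mono (hm : 1 ≤ m) (hr : 0 ≤ r) : Monotone (Ph m r) := fun a b h =>
  Real.rpow_le_rpow (clp_mem hr a).1 (clp_mono h) (by linarith)
lemma Ph_le (hm : 1 ≤ m) (hr : 0 ≤ r) (s : ℝ) : Ph m r s ≤ r ^ m :=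
  Real.rpow_le_rpow (clp_mem hr s).1 (clp_mem hr s).2 (by linarith)
lemma Ph_top (hr : 0 ≤ r) {s : ℝ} (h : r ≤ s) : Ph m r s = r ^ m := by rw [Ph, clp_top hr h]
lemma Ph_eq {s : ℝ} (h0 : 0 ≤ s) (h : s ≤ r) : Ph m r s = s ^ m := by rw [Ph, clp_eq h0 h]
lemma Ph_bot (hm : 1 ≤ m) {s : ℝ} (h : s ≤ 0) : Ph m r s = 0 := by
  rw [Ph, clp_bot h, Real.zero_rpow (by linarith)]
end Ph

lemma LZ.sq_le {g : ℝ → ℝ} (hg : LZ g) (hm : Monotone g) :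
    ∃ L, 0 < L ∧ ∀ a b, (g a - g b) ^ 2 ≤ L * ((g a - g b) * (a - b)) := by
  obtain ⟨c, hc, h, -⟩ := hg.bound
  have key : ∀ a b, b ≤ a → (g a - g b) ^ 2 ≤ (c + 1) * ((g a - g b) * (a - b)) := by
    intro a b hab
    have h1 := h a b
    have h2 := sub_nonneg.2 (hm hab)
    rw [abs_of_nonneg h2, abs_of_nonneg (sub_nonneg.2 hab)] at h1
    nlinarith [mul_nonneg h2 (sub_nonneg.2 hab)]
  refine ⟨c + 1, by linarith, fun a b => ?_⟩
  rcases le_total b a with hab | hab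
  · exact key a b hab
  · have := key b a hab
    nlinarith

/-- truncated reaction -/
noncomputable def Fr (p r s : ℝ) : ℝ :=
  min ((max s 0) ^ p) (min (max (r * s - 1) 0) (r * max (r - s) 0))

section Fr
variable {p r : ℝ}
lemma Fr_nonneg (hr : 0 ≤ r) (s : ℝ) : 0 ≤ Fr p r s :=
  le_min (Real.rpow_nonneg (le_max_right _ _) _) (le_min (le_max_right _ _)
    (mul_nonneg hr (le_max_right _ _)))
lemma Fr_le (s : ℝ) : Fr p r s ≤ (max s 0) ^ p := min_le_left _ _
lemma Fr_low (hr : 0 ≤ r) {s : ℝ} (h : r * s ≤ 1) : Fr p r s = 0 := by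
  apply le_antisymm _ (Fr_nonneg hr s)
  refine (min_le_right _ _).trans ((min_le_left _ _).trans ?_)
  exact (max_eq_right (by linarith)).le
lemma Fr_top (hr : 0 ≤ r) {s : ℝ} (h : r ≤ s) : Fr p r s = 0 := by
  apply le_antisymm _ (Fr_nonneg hr s)
  refine (min_le_right _ _).trans ((min_le_right _ _).trans ?_)
  rw [max_eq_right (by linarith), mul_zero]
lemma Fr_bot (hr : 0 ≤ r) {s : ℝ} (h : s ≤ 0) : Fr p r s = 0 :=
  Fr_low hr (by nlinarith)
lemma Fr_mono {r' : ℝ} (hr : 0 ≤ r) (h : r ≤ r') (s : ℝ) : Fr p r s ≤ Fr p r' s := by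
  rcases le_total s 0 with hs | hs
  · rw [Fr_bot hr hs]; exact Fr_nonneg (hr.trans h) s
  · refine min_le_min le_rfl (min_le_min (max_le_max ?_ le_rfl) ?_)
    · nlinarith
    · exact mul_le_mul h (max_le_max (by linarith) le_rfl) (le_max_right _ _) (hr.trans h)
lemma Fr_clp (hr : 0 ≤ r) (s : ℝ) : Fr p r s = Fr p r (clp r s) := by
  rcases le_total s 0 with hs | hs
  · rw [clp_bot hs, Fr_bot hr hs, Fr_bot hr le_rfl]
  · rcases le_total s r with h | h
    · rw [clp_eq hs h]
    · rw [clp_top hr h, Fr_top hr h, Fr_top hr le_rfl]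
lemma Fr_LB (hp : 1 ≤ p) (hr : 0 ≤ r) : LB r (Fr p r) := by
  have h1 : LB r fun x => (max x 0) ^ p := by
    obtain ⟨c, hc, h⟩ := LB.rpow (r := r) hp
    refine ⟨c, hc, fun x hx y hy => ?_⟩
    simp only [max_eq_left hx.1, max_eq_left hy.1]
    exact h x hx y hy
  exact h1.min ((((((LB.const r r).mul (LB.id r)).sub (LB.const r 1)).max (LB.const r 0)).min
    ((LB.const r r).mul (((LB.const r r).sub (LB.id r)).max (LB.const r 0)))))
lemma Fr_LZ (hp : 1 ≤ p) (hr : 0 ≤ r) : LZ (Fr p r) :=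
  LZ.of_LB hr (Fr_LB hp hr) (Fr_bot hr le_rfl) (Fr_clp hr)

lemma Fr_Ph {m : ℝ} (hp : 1 ≤ p) (hm : 1 ≤ m) (hr : 1 ≤ r) :
    ∃ C, 0 ≤ C ∧ ∀ a b, |Fr p r a - Fr p r b| ≤ C * |Ph m r a - Ph m r b| := by
  have hr0 : 0 ≤ r := by linarith
  have hrp : 0 < r := by linarith
  obtain ⟨c, hc, h⟩ := Fr_LB hp hr0
  set d := r⁻¹ with hd
  have hdp : 0 < d := inv_pos.2 hrp
  have hdr : d ≤ r := (inv_le_one_of_one_le₀ hr).trans hr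
  have hd1 : r * d = 1 := mul_inv_cancel₀ hrp.ne'
  -- inverse power lipschitz
  obtain ⟨e, he, h2⟩ := rpow_lip (a := d ^ m) (b := r ^ m) (q := m⁻¹) (Real.rpow_nonneg hdp.le _)
    (Or.inl (Real.rpow_pos_of_pos hdp _))
  have hm0 : m ≠ 0 := by linarith
  have red : ∀ a, Fr p r a = Fr p r ((max (Ph m r a) (d ^ m)) ^ m⁻¹) ∧
      max (Ph m r a) (d ^ m) ∈ Icc (d ^ m) (r ^ m) := by
    intro a
    refine ⟨?_, le_max_right _ _, max_le (Ph_le hm hr0 a)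
      (Real.rpow_le_rpow hdp.le hdr (by linarith))⟩
    rw [Fr_clp hr0 a, Ph]
    obtain ⟨h3, h4⟩ := clp_mem hr0 a
    rcases le_total (clp r a) d with h5 | h5
    · rw [max_eq_right (Real.rpow_le_rpow h3 h5 (by linarith)), Real.rpow_rpow_inv hdp.le hm0,
        Fr_low hr0 (by nlinarith), Fr_low hr0 hd1.le]
    · rw [max_eq_left (Real.rpow_le_rpow hdp.le h5 (by linarith)), Real.rpow_rpow_inv h3 hm0]
  have mem : ∀ z ∈ Icc (d ^ m) (r ^ m), z ^ m⁻¹ ∈ Icc 0 r := by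
    intro z hz
    have hz0 : 0 ≤ z := (Real.rpow_nonneg hdp.le _).trans hz.1
    refine ⟨Real.rpow_nonneg hz0 _, ?_⟩
    have := Real.rpow_le_rpow hz0 hz.2 (z := m⁻¹) (by positivity)
    rwa [Real.rpow_rpow_inv hr0 hm0] at this
  refine ⟨c * e, by positivity, fun a b => ?_⟩
  obtain ⟨ea, ma⟩ := red a
  obtain ⟨eb, mb⟩ := red b
  rw [ea, eb]
  refine (h _ (mem _ ma) _ (mem _ mb)).trans ?_
  rw [mul_assoc]
  apply mul_le_mul_of_nonneg_left _ hc
  exact (h2 _ ma _ mb).trans (mul_le_mul_of_nonneg_left (abs_max_sub_max_le_abs _ _ _) he)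

lemma Fr_tendsto {v : ℕ → ℝ} {w : ℝ} {ρ : ℕ → ℝ} (hp : 1 ≤ p) (hv : Tendsto v atTop (𝓝 w))
    (hρ : Tendsto ρ atTop atTop) (h0 : ∀ n, 0 ≤ v n) :
    Tendsto (fun n => Fr p (ρ n) (v n)) atTop (𝓝 (w ^ p)) := by
  have hp0 : 0 < p := by linarith
  have hw : 0 ≤ w := ge_of_tendsto' hv h0
  have hvp : Tendsto (fun n => v n ^ p) atTop (𝓝 (w ^ p)) := hv.rpow_const (Or.inr hp0.le)
  rcases hw.eq_or_lt with hw | hw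
  · rw [← hw, Real.zero_rpow hp0.ne'] at hvp ⊢
    refine tendsto_of_tendsto_of_tendsto_of_le_of_le' tendsto_const_nhds hvp ?_ ?_
    · filter_upwards [hρ.eventually_ge_atTop 0] with n hn using Fr_nonneg hn _
    · refine Eventually.of_forall fun n => (Fr_le _).trans ?_
      rw [max_eq_left (h0 n)]
  · apply hvp.congr'
    have e1 : Tendsto (fun n => ρ n * v n) atTop atTop := hρ.atTop_mul_pos hw hv
    have e2 : Tendsto (fun n => ρ n - v n) atTop atTop := by
      simpa [sub_eq_add_neg] using hρ.atTop_add hv.neg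
    have e3 : ∀ᶠ n in atTop, v n ^ p < w ^ p + 1 := hvp.eventually_lt_const (by linarith)
    filter_upwards [hρ.eventually_ge_atTop 1, e1.eventually_ge_atTop (w ^ p + 2),
      e2.eventually_ge_atTop (w ^ p + 2), e3] with n a1 a2 a3 a4
    have hwp : 0 ≤ w ^ p := Real.rpow_nonneg hw.le _
    rw [Fr, max_eq_left (h0 n), min_eq_left]
    apply le_min
    · exact le_trans (by linarith) (le_max_left _ _)
    · have : ρ n - v n ≤ max (ρ n - v n) 0 := le_max_left _ _
      nlinarith
end Fr

lemma abs_sub_le_pow {m lam a b : ℝ} (hm : 1 ≤ m) (hl : 0 < lam) (ha : 0 ≤ a) (hb : 0 ≤ b) :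
    |a - b| ≤ lam + lam ^ (1 - m) * |a ^ m - b ^ m| := by
  wlog hab : b ≤ a generalizing a b
  · have := this hb ha (le_of_not_ge hab)
    rwa [abs_sub_comm a, abs_sub_comm (a ^ m)]
  have h1 : b ^ m ≤ a ^ m := Real.rpow_le_rpow hb hab (by linarith)
  rw [abs_of_nonneg (sub_nonneg.2 hab), abs_of_nonneg (sub_nonneg.2 h1)]
  have h3 : 0 ≤ lam ^ (1 - m) := Real.rpow_nonneg hl.le _
  rcases le_or_gt (a - b) lam with h2 | h2
  · have : 0 ≤ lam ^ (1 - m) * (a ^ m - b ^ m) := mul_nonneg h3 (sub_nonneg.2 h1)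
    linarith
  · have h4 : (a - b) ^ m + b ^ m ≤ a ^ m := by
      have := Real.add_rpow_le_rpow_add (sub_nonneg.2 hab) hb hm
      simpa using this
    have h5 : lam ^ (m - 1) * (a - b) ≤ (a - b) ^ m := by
      have hpos : 0 < a - b := by linarith
      have : (a - b) ^ m = (a - b) ^ (m - 1) * (a - b) := by
        rw [← Real.rpow_add_one hpos.ne']; congr 1; ring
      rw [this]
      exact mul_le_mul_of_nonneg_right (Real.rpow_le_rpow hl.le h2.le (by linarith)) hpos.le
    have h6 : lam ^ (1 - m) * lam ^ (m - 1) = 1 := by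
      rw [← Real.rpow_add hl]; simp
    have h7 : a - b ≤ lam ^ (1 - m) * (a ^ m - b ^ m) := by
      calc a - b = lam ^ (1 - m) * (lam ^ (m - 1) * (a - b)) := by rw [← mul_assoc, h6, one_mul]
        _ ≤ _ := mul_le_mul_of_nonneg_left (by linarith) h3
    linarith

/-- primitive -/
noncomputable def prim (η : ℝ → ℝ) (s : ℝ) : ℝ := ∫ x in (0:ℝ)..s, η x

lemma prim_zero (η : ℝ → ℝ) : prim η 0 = 0 := by simp [prim]
lemma prim_deriv {η : ℝ → ℝ} (h : LZ η) (s : ℝ) : HasDerivAt (prim η) (η s) s :=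
  intervalIntegral.integral_hasDerivAt_right (h.continuous.intervalIntegrable _ _)
    (h.continuous.stronglyMeasurableAtFilter _ _) h.continuous.continuousAt
lemma prim_nonneg {η : ℝ → ℝ} (h : LZ η) (hm : Monotone η) (s : ℝ) : 0 ≤ prim η s := by
  rcases le_total 0 s with hs | hs
  · exact intervalIntegral.integral_nonneg hs fun x hx => by rw [← h.2]; exact hm hx.1
  · rw [prim, intervalIntegral.integral_symm, ← intervalIntegral.integral_neg]
    refine intervalIntegral.integral_nonneg hs fun x hx => ?_
    have := hm hx.2
    rw [h.2] at this; linarith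
lemma prim_le {η : ℝ → ℝ} (h : LZ η) (hm : Monotone η) {s : ℝ} (hs : 0 ≤ s) :
    prim η s ≤ s * η s := by
  have := intervalIntegral.integral_mono_on hs (h.continuous.intervalIntegrable (μ := volume) _ _)
    (continuous_const.intervalIntegrable (μ := volume) 0 s) (g := fun _ => η s) fun x hx => hm hx.2
  simpa [prim] using this
lemma le_prim {η : ℝ → ℝ} (h : LZ η) (hm : Monotone η) {s : ℝ} (hs : 0 ≤ s) :
    s / 4 * η (3 / 4 * s) ≤ prim η s := by
  have h1 := prim_nonneg h hm (3 / 4 * s)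
  have h2 : prim η (3 / 4 * s) + ∫ x in (3 / 4 * s)..s, η x = prim η s :=
    intervalIntegral.integral_add_adjacent_intervals (h.continuous.intervalIntegrable _ _)
      (h.continuous.intervalIntegrable _ _)
  have h3 := intervalIntegral.integral_mono_on (a := 3 / 4 * s) (b := s) (by linarith)
    (continuous_const.intervalIntegrable (μ := volume) _ _) (f := fun _ => η (3 / 4 * s))
    (h.continuous.intervalIntegrable (μ := volume) _ _) fun x hx => hm hx.1
  simp only [intervalIntegral.integral_const, smul_eq_mul] at h3
  linarith

end VW


namespace VW
open Set Filter Topology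
open scoped NNReal ENNReal

lemma two_point {m a b : ℝ} (hm : 1 < m) (hb : 0 < b) (hab : b ≤ a) :
    (m - 1) / (m - 1 / 2) * (a ^ (m - 1 / 2) - b ^ (m - 1 / 2)) ^ 2 ≤
      (a ^ m - b ^ m) * (a ^ (m - 1) - b ^ (m - 1)) := by
  have ha : 0 < a := hb.trans_le hab
  set q := a ^ (m - 1 / 2) with hq
  set k := b ^ (m - 1 / 2) with hk
  have hqp : 0 < q := Real.rpow_pos_of_pos ha _
  have hkp : 0 < k := Real.rpow_pos_of_pos hb _
  have hkq : k ≤ q := Real.rpow_le_rpow hb.le hab (by linarith)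
  set θ := (m - 1) / (m - 1 / 2) with hθ
  have hθ0 : 0 ≤ θ := div_nonneg (by linarith) (by linarith)
  have hθ1 : θ ≤ 1 := by rw [hθ, div_le_one (by linarith)]; linarith
  set x := a ^ (1 / 2 : ℝ) with hx
  have hxp : 0 < x := Real.rpow_pos_of_pos ha _
  have e1 : a ^ m = x * q := by rw [hx, hq, ← Real.rpow_add ha]; congr 1; ring
  have e2 : b ^ m = b ^ (1 / 2 : ℝ) * k := by rw [hk, ← Real.rpow_add hb]; congr 1; ring
  have e3 : b ^ (1 / 2 : ℝ) ≤ x := Real.rpow_le_rpow hb.le hab (by norm_num)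
  have i1 : x * (q - k) ≤ a ^ m - b ^ m := by rw [e1, e2]; nlinarith
  have e4 : a ^ (m - 1) = q / x := by
    rw [hx, hq, ← Real.rpow_sub ha]; congr 1; ring
  have e5 : b ^ (m - 1) = k ^ θ := by
    rw [hk, ← Real.rpow_mul hb.le]; congr 1; rw [hθ]
    have : m - 1 / 2 ≠ 0 := by linarith
    rw [mul_div_cancel₀ _ this]
  have e6 : q ^ θ = q / x := by
    rw [← e4, hq, ← Real.rpow_mul ha.le]; congr 1; rw [hθ]
    have : m - 1 / 2 ≠ 0 := by linarith
    rw [mul_div_cancel₀ _ this]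
  have bern : (k / q) ^ θ ≤ 1 + θ * (k / q - 1) := by
    have := rpow_one_add_le_one_add_mul_self (s := k / q - 1) (p := θ)
      (by have : 0 ≤ k / q := by positivity
          linarith) hθ0 hθ1
    simpa using this
  have i2 : θ * (q - k) / x ≤ a ^ (m - 1) - b ^ (m - 1) := by
    rw [e4, e5]
    have : k ^ θ = q ^ θ * (k / q) ^ θ := by
      rw [← Real.mul_rpow hqp.le (by positivity), mul_div_cancel₀ _ hqp.ne']
    rw [this, e6]
    have h2 : q / x * (k / q) ^ θ ≤ q / x * (1 + θ * (k / q - 1)) :=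
      mul_le_mul_of_nonneg_left bern (by positivity)
    have h3 : q / x * (1 + θ * (k / q - 1)) = q / x - θ * (q - k) / x := by
      field_simp; ring
    linarith
  calc θ * (q - k) ^ 2 = (x * (q - k)) * (θ * (q - k) / x) := by field_simp
    _ ≤ _ := mul_le_mul i1 i2 (div_nonneg (mul_nonneg hθ0 (by linarith)) hxp.le)
        (le_trans (mul_nonneg hxp.le (by linarith)) i1)

set_option maxHeartbeats 800000 in
lemma energy_scalars {m p κ : ℝ} (hp : 1 < p) (hpm : p < m) (hκ : 0 < κ) :
    ∃ θ C c2 : ℝ, 0 ≤ θ ∧ 0 ≤ C ∧ 0 < c2 ∧ ∀ r : ℝ, 1 ≤ r → ∃ η k l : ℝ → ℝ,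
      LZ η ∧ LZ k ∧ LZ l ∧ (∀ a, l a = Ph m r a * η a - θ * k a ^ 2) ∧
      (∀ a b, θ * (k a - k b) ^ 2 ≤ (Ph m r a - Ph m r b) * (η a - η b)) ∧
      (∀ s, Fr p r s * η s ≤ θ * κ * k s ^ 2 + C * prim η s) ∧
      (∀ s, 0 ≤ prim η s) ∧ (∀ s, 0 ≤ s → prim η s ≤ s ^ m) ∧
      (∀ s, s ≤ r → c2 * (max (s - r⁻¹) 0) ^ m ≤ prim η s) := by
  have hm : 1 < m := hp.trans hpm
  set θ := (m - 1) / (m - 1 / 2) with hθ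
  have hθ0 : 0 < θ := div_pos (by linarith) (by linarith)
  set c1 : ℝ := 1 - (1 / 2) ^ (m - 1 / 2) with hc1
  have hc1p : 0 < c1 := by
    have := Real.rpow_lt_one (x := 1 / 2) (by norm_num) (by norm_num) (show 0 < m - 1 / 2 by linarith)
    linarith
  set c2 : ℝ := 1 / 4 * ((3 / 4) ^ (m - 1) - (1 / 2) ^ (m - 1)) with hc2
  have hc2p : 0 < c2 := by
    have := Real.rpow_lt_rpow (x := 1 / 2) (y := 3 / 4) (by norm_num) (by norm_num)
      (show 0 < m - 1 by linarith)
    rw [hc2]; linarith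
  set lam := θ * κ * c1 ^ 2 with hlam
  have hlamp : 0 < lam := by positivity
  set s0 := lam⁻¹ ^ (m - p)⁻¹ with hs0
  have hs0p : 0 < s0 := by positivity
  set C0 := s0 ^ (p - 1) with hC0
  have hC0p : 0 < C0 := by positivity
  refine ⟨θ, C0 / c2, c2, hθ0.le, by positivity, hc2p, fun r hr => ?_⟩
  have hr0 : 0 ≤ r := by linarith
  have hrp : 0 < r := by linarith
  set d := (2 * r)⁻¹ with hd
  have hdp : 0 < d := by positivity
  have h2d : 2 * d = r⁻¹ := by rw [hd, mul_inv]; ring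
  have h2dr : 2 * d ≤ r := by rw [h2d]; exact (inv_le_one_of_one_le₀ hr).trans hr
  set η : ℝ → ℝ := fun s => (max (clp r s) d) ^ (m - 1) - d ^ (m - 1) with hη
  set k : ℝ → ℝ := fun s => (max (clp r s) d) ^ (m - 1 / 2) - d ^ (m - 1 / 2) with hk
  set l : ℝ → ℝ := fun a => Ph m r a * η a - θ * k a ^ 2 with hl
  have Lη : LB r fun x => (max x d) ^ (m - 1) - d ^ (m - 1) := (LB.rpow_max hdp).sub (LB.const _ _)
  have Lk : LB r fun x => (max x d) ^ (m - 1 / 2) - d ^ (m - 1 / 2) :=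
    (LB.rpow_max hdp).sub (LB.const _ _)
  have zη : LZ η := LZ.of_LB hr0 Lη (by simp [hdp.le]) fun s => rfl
  have zk : LZ k := LZ.of_LB hr0 Lk (by simp [hdp.le]) fun s => rfl
  have zl : LZ l := LZ.of_LB hr0 (((LB.rpow hm.le).mul Lη).sub ((LB.const _ θ).mul (Lk.mul Lk)))
    (by simp [hdp.le]) fun s => by simp only [hl, hη, hk, Ph]; ring
  have mη : Monotone η := fun a b hab => by
    have : (max (clp r a) d) ^ (m - 1) ≤ (max (clp r b) d) ^ (m - 1) :=
      Real.rpow_le_rpow (hdp.le.trans (le_max_right _ _)) (max_le_max (clp_mono hab) le_rfl)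
        (by linarith)
    simp only [hη]; linarith
  have hdm : 0 ≤ d ^ (m - 1) := by positivity
  have ηle : ∀ s, 0 ≤ s → η s ≤ s ^ (m - 1) := by
    intro s hs
    simp only [hη]
    have hcs : clp r s ≤ s := max_le hs (min_le_left _ _)
    rcases le_total (clp r s) d with h | h
    · rw [max_eq_right h, sub_self]; positivity
    · rw [max_eq_left h]
      have := Real.rpow_le_rpow (clp_mem hr0 s).1 hcs (show 0 ≤ m - 1 by linarith)
      linarith
  have main : ∀ s, 2 * d ≤ s → s ≤ r → c2 * s ^ m ≤ prim η s := by
    intro s h1 h2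
    have hs : 0 < s := by linarith
    refine le_trans ?_ (le_prim zη mη hs.le)
    have e : η (3 / 4 * s) = (3 / 4 * s) ^ (m - 1) - d ^ (m - 1) := by
      simp only [hη]
      rw [clp_eq (by linarith) (by linarith), max_eq_left (by linarith)]
    have e2 : d ^ (m - 1) ≤ (1 / 2) ^ (m - 1) * s ^ (m - 1) := by
      rw [← Real.mul_rpow (by norm_num) hs.le]
      exact Real.rpow_le_rpow hdp.le (by linarith) (by linarith)
    rw [e, Real.mul_rpow (by norm_num) hs.le]
    have e3 : s ^ m = s * s ^ (m - 1) := by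
      rw [mul_comm, ← Real.rpow_add_one hs.ne']; congr 1; ring
    rw [e3, hc2]
    have : s / 4 * ((3 / 4) ^ (m - 1) * s ^ (m - 1) - d ^ (m - 1)) ≥
      s / 4 * ((3 / 4) ^ (m - 1) * s ^ (m - 1) - (1 / 2) ^ (m - 1) * s ^ (m - 1)) := by
      apply mul_le_mul_of_nonneg_left _ (by positivity)
      linarith
    calc _ = s / 4 * ((3 / 4) ^ (m - 1) * s ^ (m - 1) - (1 / 2) ^ (m - 1) * s ^ (m - 1)) := by ring
      _ ≤ _ := this
  refine ⟨η, k, l, zη, zk, zl, fun a => rfl, ?_, ?_, prim_nonneg zη mη, ?_, ?_⟩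
  · intro a b
    wlog hab : b ≤ a generalizing a b
    · have := this b a (le_of_not_ge hab)
      nlinarith
    have hb' : 0 < max (clp r b) d := hdp.trans_le (le_max_right _ _)
    have hle : max (clp r b) d ≤ max (clp r a) d := max_le_max (clp_mono hab) le_rfl
    have h1 := two_point hm hb' hle
    have h2 : (max (clp r a) d) ^ m - (max (clp r b) d) ^ m ≤ Ph m r a - Ph m r b := by
      have e : ∀ z, (max (clp r z) d) ^ m = max (Ph m r z) (d ^ m) := by
        intro z
        have hz := (clp_mem hr0 z).1
        rw [Ph]
        rcases le_total (clp r z) d with h | h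
        · rw [max_eq_right h, max_eq_right (Real.rpow_le_rpow hz h (by linarith))]
        · rw [max_eq_left h, max_eq_left (Real.rpow_le_rpow hdp.le h (by linarith))]
      rw [e, e]
      have h3 := Ph_mono hm.le hr0 hab
      have h4 := abs_max_sub_max_le_abs (Ph m r a) (Ph m r b) (d ^ m)
      rw [abs_of_nonneg (sub_nonneg.2 h3)] at h4
      exact (le_abs_self _).trans h4
    have h3 : 0 ≤ (max (clp r a) d) ^ (m - 1) - (max (clp r b) d) ^ (m - 1) :=
      sub_nonneg.2 (Real.rpow_le_rpow hb'.le hle (by linarith))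
    have e1 : k a - k b = (max (clp r a) d) ^ (m - 1 / 2) - (max (clp r b) d) ^ (m - 1 / 2) := by
      simp only [hk]; ring
    have e2 : η a - η b = (max (clp r a) d) ^ (m - 1) - (max (clp r b) d) ^ (m - 1) := by
      simp only [hη]; ring
    rw [e1, e2]
    exact h1.trans (mul_le_mul_of_nonneg_right h2 h3)
  · intro s
    have hP := prim_nonneg zη mη s
    have hR : 0 ≤ θ * κ * k s ^ 2 + C0 / c2 * prim η s := by positivity
    rcases le_total (r * s) 1 with h1 | h1
    · rw [Fr_low hr0 h1, zero_mul]; exact hR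
    rcases le_total r s with h2 | h2
    · rw [Fr_top hr0 h2, zero_mul]; exact hR
    have hsd : 2 * d ≤ s := by
      rw [h2d]; rw [inv_le_iff_one_le_mul₀ hrp]; linarith
    have hs : 0 < s := by linarith
    have f1 : Fr p r s ≤ s ^ p := by have := Fr_le (p := p) (r := r) s; rwa [max_eq_left hs.le] at this
    have f2 := ηle s hs.le
    have f3 : c1 * s ^ (m - 1 / 2) ≤ k s := by
      simp only [hk]
      rw [clp_eq hs.le h2, max_eq_left (by linarith), hc1]
      have : d ^ (m - 1 / 2) ≤ (1 / 2) ^ (m - 1 / 2) * s ^ (m - 1 / 2) := by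
        rw [← Real.mul_rpow (by norm_num) hs.le]
        exact Real.rpow_le_rpow hdp.le (by linarith) (by linarith)
      linarith
    have f4 := main s hsd h2
    have f5 : c1 ^ 2 * s ^ (2 * m - 1) ≤ k s ^ 2 := by
      have h3 : (c1 * s ^ (m - 1 / 2)) ^ 2 ≤ k s ^ 2 := by
        apply pow_le_pow_left₀ (by positivity) f3
      have h4 : s ^ (2 * m - 1) = (s ^ (m - 1 / 2)) ^ 2 := by
        rw [← Real.rpow_natCast, ← Real.rpow_mul hs.le]; congr 1; push_cast; ring
      rw [h4]; linarith [mul_pow c1 (s ^ (m - 1 / 2)) 2]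
    have f6 : s ^ p * s ^ (m - 1) ≤ lam * s ^ (2 * m - 1) + C0 * s ^ m := by
      have g1 : s ^ p * s ^ (m - 1) = s ^ m * s ^ (p - 1) := by
        rw [← Real.rpow_add hs, ← Real.rpow_add hs]; congr 1; ring
      have g2 : s ^ (2 * m - 1) = s ^ m * (s ^ (m - p) * s ^ (p - 1)) := by
        rw [← Real.rpow_add hs, ← Real.rpow_add hs]; congr 1; ring
      rw [g1, g2]
      have g3 : s ^ (p - 1) ≤ lam * (s ^ (m - p) * s ^ (p - 1)) + C0 := by
        rcases le_total s s0 with h | h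
        · have : s ^ (p - 1) ≤ C0 := Real.rpow_le_rpow hs.le h (by linarith)
          have : 0 ≤ lam * (s ^ (m - p) * s ^ (p - 1)) := by positivity
          linarith
        · have g4 : lam⁻¹ ≤ s ^ (m - p) := by
            have := Real.rpow_le_rpow hs0p.le h (show 0 ≤ m - p by linarith)
            rwa [hs0, Real.rpow_inv_rpow (by positivity) (by linarith)] at this
          have g5 : 1 ≤ lam * s ^ (m - p) := by
            rw [inv_le_iff_one_le_mul₀ hlamp] at g4; linarith
          have g6 : 0 ≤ s ^ (p - 1) := by positivity
          calc s ^ (p - 1) = 1 * s ^ (p - 1) := (one_mul _).symm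
            _ ≤ (lam * s ^ (m - p)) * s ^ (p - 1) := mul_le_mul_of_nonneg_right g5 g6
            _ = lam * (s ^ (m - p) * s ^ (p - 1)) := by ring
            _ ≤ _ := by linarith
      have : 0 ≤ s ^ m := by positivity
      calc _ ≤ s ^ m * (lam * (s ^ (m - p) * s ^ (p - 1)) + C0) := mul_le_mul_of_nonneg_left g3 this
        _ = _ := by ring
    calc Fr p r s * η s ≤ s ^ p * s ^ (m - 1) := by
          apply mul_le_mul f1 f2 _ (by positivity)
          rw [← zη.2]; exact mη hs.le
      _ ≤ _ := f6
      _ = θ * κ * (c1 ^ 2 * s ^ (2 * m - 1)) + C0 / c2 * (c2 * s ^ m) := by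
          rw [hlam]; field_simp
      _ ≤ _ := by gcongr
  · intro s hs
    refine (prim_le zη mη hs).trans ?_
    rcases hs.eq_or_lt with h | h
    · rw [← h]; simp; positivity
    · have e3 : s ^ m = s * s ^ (m - 1) := by
        rw [mul_comm, ← Real.rpow_add_one h.ne']; congr 1; ring
      rw [e3]; exact mul_le_mul_of_nonneg_left (ηle s hs) hs
  · intro s hs
    rw [← h2d]
    rcases le_total s (2 * d) with h | h
    · rw [max_eq_right (by linarith), Real.zero_rpow (by linarith), mul_zero]
      exact prim_nonneg zη mη s
    · rw [max_eq_left (by linarith)]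
      refine le_trans ?_ (main s h hs)
      apply mul_le_mul_of_nonneg_left _ hc2p.le
      exact Real.rpow_le_rpow (by linarith) (by linarith) (by linarith)

end VW


namespace VW
open Set Filter Topology
open scoped NNReal ENNReal

/-- shifted positive part -/
noncomputable def pp (a s : ℝ) : ℝ := max (s - a) 0

lemma pp_LZ {a : ℝ} (ha : 0 ≤ a) : LZ (pp a) := by
  refine LZ.of_bound (by simp [pp, ha]) (c := 1) fun x y => ?_
  have := abs_max_sub_max_le_abs (x - a) (y - a) 0
  simpa [pp] using this

lemma pp_nonneg (a s : ℝ) : 0 ≤ pp a s := le_max_right _ _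

lemma prim_pp {a : ℝ} (ha : 0 ≤ a) (s : ℝ) : prim (pp a) s = pp a s ^ 2 / 2 := by
  have low : ∀ s, s ≤ a → prim (pp a) s = 0 := by
    intro s hs
    rw [prim]
    have : ∫ x in (0:ℝ)..s, pp a x = ∫ x in (0:ℝ)..s, (0:ℝ) := by
      apply intervalIntegral.integral_congr
      intro x hx
      have h2 : x ≤ max 0 s := hx.2
      exact max_eq_right (by linarith [h2.trans (max_le ha hs)])
    rw [this]; simp
  rcases le_total s a with hs | hs
  · rw [low s hs, pp, max_eq_right (by linarith)]; simp
  · have h2 : prim (pp a) a + ∫ x in a..s, pp a x = prim (pp a) s :=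
      intervalIntegral.integral_add_adjacent_intervals
        ((pp_LZ ha).continuous.intervalIntegrable _ _) ((pp_LZ ha).continuous.intervalIntegrable _ _)
    have h3 : ∫ x in a..s, pp a x = ∫ x in a..s, (x - a) := by
      apply intervalIntegral.integral_congr
      intro x hx
      rw [uIcc_of_le hs] at hx
      exact max_eq_left (by linarith [hx.1])
    rw [← h2, low a le_rfl, h3, pp, max_eq_left (by linarith),
      intervalIntegral.integral_sub (by simp) (by simp)]
    simp
    ring

variable {α : Type*} [MeasurableSpace α] {μ : Measure α}

/-- Solution of the regularized ODE. -/
def Sol (A : Lp ℝ 2 μ →L[ℝ] Lp ℝ 2 μ) (Φ F : ℝ → ℝ) (T : ℝ) (u0 : Lp ℝ 2 μ)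
    (u : ℝ → Lp ℝ 2 μ) : Prop :=
  u 0 = u0 ∧ ∀ t ∈ Icc 0 T, HasDerivWithinAt u (-(A (nem μ Φ (u t))) + nem μ F (u t)) (Icc 0 T) t

lemma Sol.cont {A : Lp ℝ 2 μ →L[ℝ] Lp ℝ 2 μ} {Φ F : ℝ → ℝ} {T : ℝ} {u0 : Lp ℝ 2 μ}
    {u : ℝ → Lp ℝ 2 μ} (h : Sol A Φ F T u0 u) : ContinuousOn u (Icc 0 T) :=
  fun t ht => (h.2 t ht).continuousWithinAt

lemma exists_sol (A : Lp ℝ 2 μ →L[ℝ] Lp ℝ 2 μ) {Φ F : ℝ → ℝ} (hΦ : LZ Φ) (hF : LZ F) {T : ℝ}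
    (hT : 0 ≤ T) (u0 : Lp ℝ 2 μ) : ∃ u, Sol A Φ F T u0 u := by
  obtain ⟨c, hc⟩ := nem_lip (μ := μ) hΦ
  obtain ⟨d, hd⟩ := nem_lip (μ := μ) hF
  have h1 : LipschitzWith (‖A‖₊ * c + d) fun v => -(A (nem μ Φ v)) + nem μ F v :=
    ((A.lipschitz.comp hc).neg).add hd
  exact exists_ode h1 (by rw [nem_zero hΦ, nem_zero hF]; simp) u0 hT

lemma ae_zero_of_prim {η : ℝ → ℝ} (hη : LZ η) (h0 : ∀ s, 0 ≤ prim η s) {w : Lp ℝ 2 μ}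
    (h : ∫ x, prim η (w x) ∂μ ≤ 0) : ∀ᵐ x ∂μ, prim η (w x) = 0 := by
  have h1 : ∫ x, prim η (w x) ∂μ = 0 := le_antisymm h (integral_nonneg fun x => h0 _)
  exact (integral_eq_zero_iff_of_nonneg (fun x => h0 (w x))
    (int_H hη (prim_zero _) (prim_deriv hη) w)).1 h1

lemma comparison {ε κ : ℝ} {A : Lp ℝ 2 μ →L[ℝ] Lp ℝ 2 μ} (hA : Res μ ε κ A) {Φ F G : ℝ → ℝ}
    (hΦ : LZ Φ) (hΦm : Monotone Φ) (hF : LZ F) (hG : LZ G) (hFG : ∀ s, F s ≤ G s) {T : ℝ}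
    {u0 v0 : Lp ℝ 2 μ} {u v : ℝ → Lp ℝ 2 μ} (hu : Sol A Φ F T u0 u) (hv : Sol A Φ G T v0 v)
    (h0 : ∀ᵐ x ∂μ, u0 x ≤ v0 x) : ∀ t ∈ Icc 0 T, ∀ᵐ x ∂μ, u t x ≤ v t x := by
  set η := pp 0
  have zη : LZ η := pp_LZ le_rfl
  have hH : ∀ s, prim η s = η s ^ 2 / 2 := prim_pp le_rfl
  have hH0 : ∀ s, 0 ≤ prim η s := fun s => by rw [hH]; positivity
  obtain ⟨Λ, hΛ, hΛ1, -⟩ := hΦ.bound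
  obtain ⟨L, hL, hL1, -⟩ := hG.bound
  set w : ℝ → Lp ℝ 2 μ := fun t => u t - v t with hw
  set w' : ℝ → Lp ℝ 2 μ := fun t => -(A (nem μ Φ (u t))) + nem μ F (u t)
    - (-(A (nem μ Φ (v t))) + nem μ G (v t)) with hw'
  have hwd : ∀ t ∈ Icc 0 T, HasDerivWithinAt w (w' t) (Icc 0 T) t := fun t ht =>
    (hu.2 t ht).sub (hv.2 t ht)
  have hyd : ∀ t ∈ Icc 0 T, HasDerivWithinAt (fun t => ∫ x, prim η (w t x) ∂μ)
      (inner ℝ (nem μ η (w t)) (w' t)) (Icc 0 T) t := fun t ht =>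
    chain zη (prim_zero _) (prim_deriv zη) (hwd t ht)
  have hPn : ∀ t, ‖nem μ η (w t)‖ ^ 2 = 2 * ∫ x, prim η (w t x) ∂μ := by
    intro t
    rw [norm_sq, ← integral_const_mul]
    apply integral_congr_ae
    filter_upwards [coe_nem zη (w t)] with x hx
    rw [hx, hH]; ring
  set C := 2 * (ε⁻¹ * (Λ * ‖Res.R ε A‖) + L) with hC
  have hε := hA.eps
  have hC0 : 0 ≤ C := by positivity
  have main : ∀ t ∈ Icc 0 T, inner ℝ (nem μ η (w t)) (w' t) + 0 ≤
      C * (∫ x, prim η (w t x) ∂μ) + 0 := by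
    intro t _
    set P := nem μ η (w t) with hP
    set D := nem μ Φ (u t) - nem μ Φ (v t) with hD
    have e1 : w' t = -(A D) + (nem μ F (u t) - nem μ G (v t)) := by
      simp only [hw', hD, map_sub]; abel
    have aeD : ∀ᵐ x ∂μ, D x = Φ (u t x) - Φ (v t x) := by
      filter_upwards [coe_nem hΦ (u t), coe_nem hΦ (v t),
        Lp.coeFn_sub (nem μ Φ (u t)) (nem μ Φ (v t))] with x h1 h2 h3
      rw [h3, Pi.sub_apply, h1, h2]
    have aeP : ∀ᵐ x ∂μ, P x = max (u t x - v t x) 0 := by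
      filter_upwards [coe_nem zη (w t), Lp.coeFn_sub (u t) (v t)] with x h1 h2
      rw [h1, h2, Pi.sub_apply]; simp [η, pp]
    have i1 : 0 ≤ inner ℝ D P := by
      rw [inner_eq]
      apply integral_nonneg_of_ae
      filter_upwards [aeD, aeP] with x h1 h2
      simp only [Pi.zero_apply]
      rw [h1, h2]
      rcases le_total (u t x) (v t x) with h | h
      · rw [max_eq_right (by linarith)]; simp
      · exact mul_nonneg (sub_nonneg.2 (hΦm h)) (le_max_right _ _)
    have i2 : inner ℝ (Res.R ε A D) P ≤ Λ * ‖Res.R ε A‖ * ‖P‖ ^ 2 := by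
      have h1 : ∀ᵐ x ∂μ, D x ≤ (Λ • P) x := by
        filter_upwards [aeD, aeP, Lp.coeFn_smul Λ P] with x h1 h2 h3
        rw [h3, Pi.smul_apply, smul_eq_mul, h1, h2]
        rcases le_total (u t x) (v t x) with h | h
        · have := hΦm h
          rw [max_eq_right (by linarith)]; simp; exact this
        · rw [max_eq_left (by linarith)]
          have := hΛ1 (u t x) (v t x)
          rw [abs_of_nonneg (sub_nonneg.2 h)] at this
          exact (le_abs_self _).trans this
      have h2 := hA.R_mono _ _ h1
      have h3 : inner ℝ (Res.R ε A D) P ≤ inner ℝ (Res.R ε A (Λ • P)) P := by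
        apply inner_mono
        filter_upwards [h2, aeP] with x h4 h5
        apply mul_le_mul_of_nonneg_right h4
        rw [h5]; exact le_max_right _ _
      refine h3.trans ?_
      rw [map_smul, inner_smul_left]
      simp only [conj_trivial]
      rw [mul_assoc]
      apply mul_le_mul_of_nonneg_left _ hΛ
      calc _ ≤ ‖Res.R ε A P‖ * ‖P‖ := real_inner_le_norm _ _
        _ ≤ (‖Res.R ε A‖ * ‖P‖) * ‖P‖ := by gcongr; exact (Res.R ε A).le_opNorm P
        _ = _ := by ring
    have i3 : inner ℝ P (nem μ F (u t) - nem μ G (v t)) ≤ L * ‖P‖ ^ 2 := by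
      have e : L * ‖P‖ ^ 2 = inner ℝ P (L • P) := by
        rw [inner_smul_right, real_inner_self_eq_norm_sq]
      rw [e]
      apply inner_mono
      filter_upwards [aeP, Lp.coeFn_smul L P, coe_nem hF (u t), coe_nem hG (v t),
        Lp.coeFn_sub (nem μ F (u t)) (nem μ G (v t))] with x h1 h2 h3 h4 h5
      rw [h2, h5, Pi.smul_apply, Pi.sub_apply, h3, h4, smul_eq_mul, h1]
      rcases le_total (u t x) (v t x) with h | h
      · rw [max_eq_right (by linarith)]; simp
      · rw [max_eq_left (by linarith)]
        apply mul_le_mul_of_nonneg_left _ (sub_nonneg.2 h)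
        have h6 := hL1 (u t x) (v t x)
        rw [abs_of_nonneg (sub_nonneg.2 h)] at h6
        linarith [hFG (u t x), le_abs_self (G (u t x) - G (v t x))]
    rw [e1, inner_add_right, inner_neg_right, real_inner_comm, hA.A_eq]
    have := hPn t
    rw [← hP] at this
    have i4 : ε⁻¹ * (inner ℝ D P - inner ℝ (Res.R ε A D) P) ≥
      ε⁻¹ * (0 - Λ * ‖Res.R ε A‖ * ‖P‖ ^ 2) := by
      apply mul_le_mul_of_nonneg_left _ (inv_nonneg.2 hε.le)
      linarith
    rw [this] at i3 i4
    rw [hC]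
    nlinarith
  intro t ht
  have g := gron' hC0 hyd (fun t _ => integral_nonneg fun x => hH0 _) continuousOn_const
    continuousOn_const (fun _ _ => le_rfl) (fun _ _ => le_rfl) main t ht
  have y0 : ∫ x, prim η (w 0 x) ∂μ = 0 := by
    rw [integral_eq_zero_of_ae]
    filter_upwards [h0, Lp.coeFn_sub (u 0) (v 0)] with x h1 h2
    rw [← hu.1, ← hv.1] at h1
    simp only [hw, Pi.zero_apply]
    rw [hH, h2, Pi.sub_apply]
    simp only [η, pp]
    rw [max_eq_right (by linarith)]; simp
  rw [y0] at g
  simp only [intervalIntegral.integral_zero, add_zero, mul_zero] at g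
  filter_upwards [ae_zero_of_prim zη hH0 g, Lp.coeFn_sub (u t) (v t)] with x h1 h2
  simp only [hw] at h1
  rw [hH, h2, Pi.sub_apply] at h1
  have h3 : η (u t x - v t x) = 0 := by nlinarith
  have h4 : u t x - v t x - 0 ≤ η (u t x - v t x) := le_max_left _ _
  linarith

lemma pos_sol {ε κ : ℝ} {A : Lp ℝ 2 μ →L[ℝ] Lp ℝ 2 μ} (hA : Res μ ε κ A) {Φ F : ℝ → ℝ}
    (hΦ : LZ Φ) (hΦm : Monotone Φ) (hF : LZ F) (hF0 : ∀ s, 0 ≤ F s) {T : ℝ}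
    {u0 : Lp ℝ 2 μ} {u : ℝ → Lp ℝ 2 μ} (hu : Sol A Φ F T u0 u)
    (h0 : ∀ᵐ x ∂μ, 0 ≤ u0 x) : ∀ t ∈ Icc 0 T, ∀ᵐ x ∂μ, 0 ≤ u t x := by
  have hz : Sol A Φ (fun _ => 0) T (0 : Lp ℝ 2 μ) (fun _ => 0) := by
    refine ⟨rfl, fun t _ => ?_⟩
    rw [nem_zero hΦ, nem_zero LZ.zero]
    simpa using hasDerivWithinAt_const (x := t) (s := Icc 0 T) (c := (0 : Lp ℝ 2 μ))
  have := comparison hA hΦ hΦm LZ.zero hF hF0 hz hu (by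
    filter_upwards [h0, Lp.coeFn_zero ℝ 2 μ] with x h1 h2
    rw [h2]; exact h1)
  intro t ht
  filter_upwards [this t ht, Lp.coeFn_zero ℝ 2 μ] with x h1 h2
  rw [h2] at h1; exact h1

lemma cap {ε κ : ℝ} {A : Lp ℝ 2 μ →L[ℝ] Lp ℝ 2 μ} (hA : Res μ ε κ A) {Φ F : ℝ → ℝ}
    (hΦ : LZ Φ) (hF : LZ F) {r M : ℝ} (hr : 0 ≤ r) (hM : 0 ≤ M)
    (hΦM : ∀ s, Φ s ≤ M) (hΦr : ∀ s, r ≤ s → Φ s = M) (hFr : ∀ s, r ≤ s → F s = 0) {T : ℝ}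
    {u0 : Lp ℝ 2 μ} {u : ℝ → Lp ℝ 2 μ} (hu : Sol A Φ F T u0 u)
    (h0 : ∀ᵐ x ∂μ, u0 x ≤ r) : ∀ t ∈ Icc 0 T, ∀ᵐ x ∂μ, u t x ≤ r := by
  set η := pp r
  have zη : LZ η := pp_LZ hr
  have hH : ∀ s, prim η s = η s ^ 2 / 2 := prim_pp hr
  have hH0 : ∀ s, 0 ≤ prim η s := fun s => by rw [hH]; positivity
  have hyd : ∀ t ∈ Icc 0 T, HasDerivWithinAt (fun t => ∫ x, prim η (u t x) ∂μ)
      (inner ℝ (nem μ η (u t)) (-(A (nem μ Φ (u t))) + nem μ F (u t))) (Icc 0 T) t := fun t ht =>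
    chain zη (prim_zero _) (prim_deriv zη) (hu.2 t ht)
  have main : ∀ t ∈ Icc 0 T, inner ℝ (nem μ η (u t)) (-(A (nem μ Φ (u t))) + nem μ F (u t)) + 0 ≤
      0 * (∫ x, prim η (u t x) ∂μ) + 0 := by
    intro t _
    have aeP := coe_nem zη (u t)
    have aeD := coe_nem hΦ (u t)
    have i3 : inner ℝ (nem μ η (u t)) (nem μ F (u t)) = 0 := by
      rw [inner_eq]
      apply integral_eq_zero_of_ae
      filter_upwards [aeP, coe_nem hF (u t)] with x h1 h2
      rw [h1, h2, Pi.zero_apply]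
      rcases le_total r (u t x) with h | h
      · rw [hFr _ h, mul_zero]
      · simp only [η, pp]; rw [max_eq_right (by linarith), zero_mul]
    have i1 : inner ℝ (Res.R ε A (nem μ Φ (u t))) (nem μ η (u t)) ≤
        inner ℝ (nem μ Φ (u t)) (nem μ η (u t)) := by
      have := hA.R_le (nem μ Φ (u t)) M hM (by filter_upwards [aeD] with x h1; rw [h1]; exact hΦM _)
      apply inner_mono
      filter_upwards [aeP, aeD, this] with x h1 h2 h3
      rw [h1, h2]
      rcases le_total r (u t x) with h | h
      · rw [hΦr _ h]; exact mul_le_mul_of_nonneg_right h3 (le_max_right _ _)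
      · simp only [η, pp]; rw [max_eq_right (by linarith), mul_zero, mul_zero]
    rw [inner_add_right, inner_neg_right, real_inner_comm, hA.A_eq, i3]
    have := mul_nonneg (inv_nonneg.2 hA.eps.le) (sub_nonneg.2 i1)
    linarith
  intro t ht
  have g := gron' le_rfl hyd (fun t _ => integral_nonneg fun x => hH0 _) continuousOn_const
    continuousOn_const (fun _ _ => le_rfl) (fun _ _ => le_rfl) main t ht
  have y0 : ∫ x, prim η (u 0 x) ∂μ = 0 := by
    rw [integral_eq_zero_of_ae]
    filter_upwards [h0] with x h1
    rw [← hu.1] at h1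
    rw [hH]
    simp only [η, pp]
    rw [max_eq_right (by linarith)]; simp
  rw [y0] at g
  simp only [intervalIntegral.integral_zero, add_zero, mul_zero] at g
  filter_upwards [ae_zero_of_prim zη hH0 g] with x h1
  rw [hH] at h1
  have h3 : η (u t x) = 0 := by nlinarith
  have h4 : u t x - r ≤ η (u t x) := le_max_left _ _
  linarith

end VW


namespace VW
open Set Filter Topology
open scoped NNReal ENNReal

variable {α : Type*} [MeasurableSpace α] {μ : Measure α}

lemma nem_norm {g : ℝ → ℝ} (h : LZ g) : ∃ c : ℝ, 0 ≤ c ∧ ∀ f : Lp ℝ 2 μ, ‖nem μ g f‖ ≤ c * ‖f‖ := by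
  obtain ⟨c, hc⟩ := nem_lip (μ := μ) h
  refine ⟨c, c.2, fun f => ?_⟩
  have := hc.norm_sub_le f 0
  simpa [nem_zero h] using this

lemma sol_mem {ε κ : ℝ} {A : Lp ℝ 2 μ →L[ℝ] Lp ℝ 2 μ} (hA : Res μ ε κ A) {m p r T : ℝ}
    (hp : 1 ≤ p) (hm : 1 ≤ m) (hr : 0 ≤ r) {u0 : Lp ℝ 2 μ} {u : ℝ → Lp ℝ 2 μ}
    (hu : Sol A (Ph m r) (Fr p r) T u0 u) (h0 : ∀ᵐ x ∂μ, u0 x ∈ Icc 0 r) :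
    ∀ t ∈ Icc 0 T, ∀ᵐ x ∂μ, u t x ∈ Icc 0 r := by
  intro t ht
  filter_upwards [pos_sol hA (Ph_LZ hm hr) (Ph_mono hm hr) (Fr_LZ hp hr) (Fr_nonneg hr) hu
      (h0.mono fun x h => h.1) t ht,
    cap hA (Ph_LZ hm hr) (Fr_LZ hp hr) hr (Real.rpow_nonneg hr m) (Ph_le hm hr)
      (fun s hs => Ph_top hr hs) (fun s hs => Fr_top hr hs) hu (h0.mono fun x h => h.2) t ht]
    with x h1 h2 using ⟨h1, h2⟩

lemma sol_mono {ε κ : ℝ} {A : Lp ℝ 2 μ →L[ℝ] Lp ℝ 2 μ} (hA : Res μ ε κ A) {m p r r' T : ℝ}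
    (hp : 1 ≤ p) (hm : 1 ≤ m) (hr : 0 ≤ r) (hrr : r ≤ r') {u0 v0 : Lp ℝ 2 μ} {u v : ℝ → Lp ℝ 2 μ}
    (hu : Sol A (Ph m r) (Fr p r) T u0 u) (hv : Sol A (Ph m r') (Fr p r') T v0 v)
    (h0 : ∀ᵐ x ∂μ, u0 x ∈ Icc 0 r) (huv : ∀ᵐ x ∂μ, u0 x ≤ v0 x) :
    ∀ t ∈ Icc 0 T, ∀ᵐ x ∂μ, u t x ≤ v t x := by
  have hr' : 0 ≤ r' := hr.trans hrr
  have hu' : Sol A (Ph m r') (Fr p r) T u0 u := by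
    refine ⟨hu.1, fun t ht => ?_⟩
    have : nem μ (Ph m r') (u t) = nem μ (Ph m r) (u t) := by
      apply Lp.ext
      filter_upwards [coe_nem (Ph_LZ hm hr') (u t), coe_nem (Ph_LZ hm hr) (u t),
        sol_mem hA hp hm hr hu h0 t ht] with x h1 h2 h3
      rw [h1, h2, Ph_eq h3.1 h3.2, Ph_eq h3.1 (h3.2.trans hrr)]
    rw [this]
    exact hu.2 t ht
  exact comparison hA (Ph_LZ hm hr') (Ph_mono hm hr') (Fr_LZ hp hr) (Fr_LZ hp hr')
    (Fr_mono hr hrr) hu' hv huv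

lemma sol_bound [SigmaFinite μ] {m p r T : ℝ} (hp : 1 ≤ p) (hm : 1 ≤ m) (hr : 0 ≤ r)
    {u0 : Lp ℝ 2 μ} (h0 : ∀ᵐ x ∂μ, u0 x ∈ Icc 0 r) :
    ∃ B : ℝ, 0 ≤ B ∧ ∀ (ε κ : ℝ) (A : Lp ℝ 2 μ →L[ℝ] Lp ℝ 2 μ) (u : ℝ → Lp ℝ 2 μ),
      Res μ ε κ A → Sol A (Ph m r) (Fr p r) T u0 u → ∀ t ∈ Icc 0 T, ‖u t‖ ≤ B := by
  obtain ⟨L, hL0, hL⟩ := nem_norm (μ := μ) (Fr_LZ (p := p) hp hr)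
  set D := Real.exp (2 * L * T) * ‖u0‖ ^ 2
  have hD : 0 ≤ D := by positivity
  refine ⟨√D, Real.sqrt_nonneg _, fun ε κ A u hA hu t ht => ?_⟩
  have hyd : ∀ t ∈ Icc 0 T, HasDerivWithinAt (fun t => ‖u t‖ ^ 2)
      (2 * inner ℝ (u t) (-(A (nem μ (Ph m r) (u t))) + nem μ (Fr p r) (u t))) (Icc 0 T) t :=
    fun t ht => (hu.2 t ht).norm_sq
  have main : ∀ t ∈ Icc 0 T, 2 * inner ℝ (u t) (-(A (nem μ (Ph m r) (u t))) + nem μ (Fr p r) (u t))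
      + 0 ≤ (2 * L) * ‖u t‖ ^ 2 + 0 := by
    intro t ht
    have e : nem μ (clp r) (u t) = u t := by
      apply Lp.ext
      filter_upwards [coe_nem (clp_LZ hr) (u t), sol_mem hA hp hm hr hu h0 t ht] with x h1 h2
      rw [h1, clp_eq h2.1 h2.2]
    have i1 : 0 ≤ inner ℝ (A (nem μ (Ph m r) (u t))) (nem μ (clp r) (u t)) := by
      have := hA.SV (f := Ph m r) (g := clp r) (k := fun _ => 0)
        (l := fun a => Ph m r a * clp r a) (θ := 0) (Ph_LZ hm hr) (clp_LZ hr) LZ.zero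
        (LZ.of_LB hr ((LB.rpow hm).mul (LB.id r)) (by simp) fun s => rfl) (by simp) (by
          intro a b
          rw [zero_mul]
          rcases le_total a b with h | h
          · exact mul_nonneg_of_nonpos_of_nonpos (sub_nonpos.2 (Ph_mono hm hr h))
              (sub_nonpos.2 (clp_mono h))
          · exact mul_nonneg (sub_nonneg.2 (Ph_mono hm hr h)) (sub_nonneg.2 (clp_mono h))) (u t)
      rwa [zero_mul] at this
    rw [e] at i1
    have i2 : inner ℝ (u t) (nem μ (Fr p r) (u t)) ≤ L * ‖u t‖ ^ 2 := by
      calc _ ≤ ‖u t‖ * ‖nem μ (Fr p r) (u t)‖ := real_inner_le_norm _ _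
        _ ≤ ‖u t‖ * (L * ‖u t‖) := by gcongr; exact hL _
        _ = _ := by ring
    rw [inner_add_right, inner_neg_right, real_inner_comm]
    linarith
  have g := gron' (by positivity) hyd (fun t _ => by positivity) continuousOn_const
    continuousOn_const (fun _ _ => le_rfl) (fun _ _ => le_rfl) main t ht
  simp only [intervalIntegral.integral_zero, add_zero, hu.1] at g
  exact Real.le_sqrt_of_sq_le g

lemma sol_energy [SigmaFinite μ] {m p r T : ℝ} (hp : 1 ≤ p) (hm : 1 ≤ m) (hr : 0 ≤ r)
    {u0 : Lp ℝ 2 μ} (h0 : ∀ᵐ x ∂μ, u0 x ∈ Icc 0 r) (hT : 0 ≤ T) :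
    ∃ B : ℝ, 0 ≤ B ∧ ∀ (ε κ : ℝ) (A : Lp ℝ 2 μ →L[ℝ] Lp ℝ 2 μ) (u : ℝ → Lp ℝ 2 μ),
      Res μ ε κ A → Sol A (Ph m r) (Fr p r) T u0 u →
      ∫ t in (0:ℝ)..T, ε * ‖A (nem μ (Ph m r) (u t))‖ ^ 2 ≤ B := by
  obtain ⟨L, hL0, hL⟩ := nem_norm (μ := μ) (Fr_LZ (p := p) hp hr)
  obtain ⟨M, hM0, hM⟩ := nem_norm (μ := μ) (Ph_LZ (m := m) hm hr)
  obtain ⟨B, hB0, hB⟩ := sol_bound (μ := μ) (T := T) hp hm hr h0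
  set y0 := ∫ x, prim (Ph m r) (u0 x) ∂μ
  refine ⟨|y0| + T * (M * B * (L * B)), by positivity, fun ε κ A u hA hu => ?_⟩
  have zΦ := Ph_LZ hm hr
  have hyd : ∀ t ∈ Icc 0 T, HasDerivWithinAt (fun t => ∫ x, prim (Ph m r) (u t x) ∂μ)
      (inner ℝ (nem μ (Ph m r) (u t)) (-(A (nem μ (Ph m r) (u t))) + nem μ (Fr p r) (u t)))
      (Icc 0 T) t := fun t ht =>
    chain zΦ (prim_zero _) (prim_deriv zΦ) (hu.2 t ht)
  have main : ∀ t ∈ Icc 0 T, inner ℝ (nem μ (Ph m r) (u t))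
      (-(A (nem μ (Ph m r) (u t))) + nem μ (Fr p r) (u t))
      + ε * ‖A (nem μ (Ph m r) (u t))‖ ^ 2 ≤
      0 * (∫ x, prim (Ph m r) (u t x) ∂μ) + M * B * (L * B) := by
    intro t ht
    have hb := hB ε κ A u hA hu t ht
    have i1 := hA.bnd (nem μ (Ph m r) (u t))
    have i2 : inner ℝ (nem μ (Ph m r) (u t)) (nem μ (Fr p r) (u t)) ≤ M * B * (L * B) := by
      calc _ ≤ ‖nem μ (Ph m r) (u t)‖ * ‖nem μ (Fr p r) (u t)‖ := real_inner_le_norm _ _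
        _ ≤ (M * B) * (L * B) := by
          gcongr
          · exact (hM _).trans (by gcongr)
          · exact (hL _).trans (by gcongr)
    rw [inner_add_right, inner_neg_right, real_inner_comm]
    linarith
  have hc : ContinuousOn (fun t => ε * ‖A (nem μ (Ph m r) (u t))‖ ^ 2) (Icc 0 T) :=
    continuousOn_const.mul
      (((A.continuous.comp (nem_continuous zΦ)).comp_continuousOn hu.cont).norm.pow 2)
  have g := gron' le_rfl hyd (fun t _ => integral_nonneg fun x =>
    prim_nonneg zΦ (Ph_mono hm hr) _) hc
    continuousOn_const (fun _ _ => by have := hA.eps; positivity) (fun _ _ => by positivity) main T ⟨hT, le_rfl⟩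
  simp only [intervalIntegral.integral_const, hu.1, zero_mul, Real.exp_zero, one_mul, smul_eq_mul,
    sub_zero] at g
  have h1 : 0 ≤ ∫ x, prim (Ph m r) (u T x) ∂μ :=
    integral_nonneg fun x => prim_nonneg zΦ (Ph_mono hm hr) _
  have h2 := le_abs_self y0
  linarith

lemma sol_unif [SigmaFinite μ] {m p κ T : ℝ} (hp : 1 < p) (hpm : p < m) (hκ : 0 < κ) :
    ∃ C : ℝ, 0 ≤ C ∧ ∀ (r : ℝ), 1 ≤ r → ∀ (u0 : Lp ℝ 2 μ), (∀ᵐ x ∂μ, u0 x ∈ Icc 0 r) →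
      Integrable (fun x => u0 x ^ m) μ →
      ∀ (ε : ℝ) (A : Lp ℝ 2 μ →L[ℝ] Lp ℝ 2 μ) (u : ℝ → Lp ℝ 2 μ),
      Res μ ε κ A → Sol A (Ph m r) (Fr p r) T u0 u → ∀ t ∈ Icc 0 T,
      ∫⁻ x, ENNReal.ofReal ((max (u t x - r⁻¹) 0) ^ m) ∂μ
        ≤ ENNReal.ofReal (C * ∫ x, u0 x ^ m ∂μ) := by
  have hm : 1 < m := hp.trans hpm
  obtain ⟨θ, C, c2, hθ, hC, hc2, hes⟩ := energy_scalars hp hpm hκ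
  refine ⟨c2⁻¹ * Real.exp (C * T), by positivity, fun r hr u0 h0 hi ε A u hA hu t ht => ?_⟩
  have hr0 : 0 ≤ r := by linarith
  obtain ⟨η, k, l, zη, zk, zl, hl, h2p, hF, hpn, hple, hpge⟩ := hes r hr
  have hyd : ∀ t ∈ Icc 0 T, HasDerivWithinAt (fun t => ∫ x, prim η (u t x) ∂μ)
      (inner ℝ (nem μ η (u t)) (-(A (nem μ (Ph m r) (u t))) + nem μ (Fr p r) (u t)))
      (Icc 0 T) t := fun t ht =>
    chain zη (prim_zero _) (prim_deriv zη) (hu.2 t ht)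
  have main : ∀ t ∈ Icc 0 T, inner ℝ (nem μ η (u t))
      (-(A (nem μ (Ph m r) (u t))) + nem μ (Fr p r) (u t)) + 0 ≤
      C * (∫ x, prim η (u t x) ∂μ) + 0 := by
    intro t ht
    have i1 := hA.SV (Ph_LZ hm.le hr0) zη zk zl hl h2p (u t)
    have i2 := mul_le_mul_of_nonneg_left (hA.coer (nem μ k (u t))) hθ
    have i3 : inner ℝ (nem μ η (u t)) (nem μ (Fr p r) (u t)) ≤
        θ * κ * ‖nem μ k (u t)‖ ^ 2 + C * ∫ x, prim η (u t x) ∂μ := by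
      rw [inner_eq, norm_sq, ← integral_const_mul, ← integral_const_mul, ← integral_add
        ((int_sq _).const_mul _) ((int_H zη (prim_zero _) (prim_deriv zη) _).const_mul _)]
      apply integral_mono_ae (int_mul _ _) (((int_sq _).const_mul _).add
        ((int_H zη (prim_zero _) (prim_deriv zη) _).const_mul _))
      filter_upwards [coe_nem zη (u t), coe_nem (Fr_LZ hp.le hr0) (u t), coe_nem zk (u t)]
        with x h1 h2 h3
      simp only [Pi.add_apply]
      rw [h1, h2, h3, mul_comm]
      exact hF _
    rw [inner_add_right, inner_neg_right, real_inner_comm]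
    linarith
  have g := gron' hC hyd (fun t _ => integral_nonneg fun x => hpn _) continuousOn_const
    continuousOn_const (fun _ _ => le_rfl) (fun _ _ => le_rfl) main t ht
  simp only [intervalIntegral.integral_zero, add_zero, hu.1] at g
  have iP := int_H (μ := μ) zη (prim_zero _) (prim_deriv zη)
  have h1 : ∫ x, prim η (u0 x) ∂μ ≤ ∫ x, u0 x ^ m ∂μ := by
    apply integral_mono_ae (iP u0) hi
    filter_upwards [h0] with x hx using hple _ hx.1
  calc ∫⁻ x, ENNReal.ofReal ((max (u t x - r⁻¹) 0) ^ m) ∂μ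
      ≤ ∫⁻ x, ENNReal.ofReal (c2⁻¹ * prim η (u t x)) ∂μ := by
        apply lintegral_mono_ae
        filter_upwards [sol_mem hA hp.le hm.le hr0 hu h0 t ht] with x hx
        apply ENNReal.ofReal_le_ofReal
        rw [inv_mul_eq_div, le_div_iff₀ hc2, mul_comm]
        exact hpge _ hx.2
    _ = ENNReal.ofReal (∫ x, c2⁻¹ * prim η (u t x) ∂μ) := by
        rw [ofReal_integral_eq_lintegral_ofReal ((iP _).const_mul _)]
        exact ae_of_all _ fun x => mul_nonneg (by positivity) (hpn _)
    _ ≤ _ := by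
        apply ENNReal.ofReal_le_ofReal
        rw [integral_const_mul, mul_assoc]
        apply mul_le_mul_of_nonneg_left _ (by positivity)
        exact g.trans (mul_le_mul_of_nonneg_left h1 (Real.exp_nonneg _))

lemma nem_sq_le {g h : ℝ → ℝ} (hg : LZ g) (hh : LZ h) {C : ℝ} (hC : 0 ≤ C)
    (H : ∀ a b, |h a - h b| ≤ C * |g a - g b|) (u v : Lp ℝ 2 μ) :
    ‖nem μ h u - nem μ h v‖ ≤ C * ‖nem μ g u - nem μ g v‖ := by
  apply Lp.norm_le_mul_norm_of_ae_le_mul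
  filter_upwards [coe_nem hg u, coe_nem hg v, coe_nem hh u, coe_nem hh v,
    Lp.coeFn_sub (nem μ h u) (nem μ h v), Lp.coeFn_sub (nem μ g u) (nem μ g v)]
    with x h1 h2 h3 h4 h5 h6
  rw [h5, h6, Pi.sub_apply, Pi.sub_apply, h1, h2, h3, h4]
  exact H _ _

lemma sol_cauchy [SigmaFinite μ] {V : Type*} [NormedAddCommGroup V] [InnerProductSpace ℝ V]
    (j : Lp ℝ 2 μ →L[ℝ] V) {m p r T : ℝ} (hp : 1 ≤ p) (hm : 1 ≤ m) (hr : 1 ≤ r)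
    {u0 : Lp ℝ 2 μ} (h0 : ∀ᵐ x ∂μ, u0 x ∈ Icc 0 r) (hT : 0 ≤ T) :
    ∃ C : ℝ, 0 ≤ C ∧ ∀ (ε ε' κ : ℝ) (A A' : Lp ℝ 2 μ →L[ℝ] Lp ℝ 2 μ) (u v : ℝ → Lp ℝ 2 μ),
      Res μ ε κ A → Res μ ε' κ A' →
      (∀ f g, inner ℝ (j (A f)) (j g) = inner ℝ f g - ε * inner ℝ (A f) g) →
      (∀ f g, inner ℝ (j (A' f)) (j g) = inner ℝ f g - ε' * inner ℝ (A' f) g) →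
      Sol A (Ph m r) (Fr p r) T u0 u → Sol A' (Ph m r) (Fr p r) T u0 v →
      ∫ t in (0:ℝ)..T, ‖nem μ (Ph m r) (u t) - nem μ (Ph m r) (v t)‖ ^ 2 ≤ C * (√ε + √ε') := by
  have hr0 : 0 ≤ r := by linarith
  have zΦ := Ph_LZ (m := m) hm hr0
  have zF := Fr_LZ (p := p) hp hr0
  obtain ⟨B, hB0, hB⟩ := sol_bound (μ := μ) (T := T) (m := m) hp hm hr0 h0
  obtain ⟨D, hD0, hD⟩ := sol_energy (μ := μ) (T := T) (m := m) hp hm hr0 h0 hT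
  obtain ⟨Λ, hΛ0, hΛ⟩ := zΦ.sq_le (Ph_mono hm hr0)
  obtain ⟨c, hc0, hc⟩ := Fr_Ph (m := m) hp hm hr
  set b := ‖j‖ * c with hb
  have hb0 : 0 ≤ b := by positivity
  set E := Real.exp (Λ * b ^ 2 * T)
  refine ⟨2 * Λ * (E * (B * (T + D))), by positivity,
    fun ε ε' κ A A' u v hA hA' hK hK' hu hv => ?_⟩
  have hε := hA.eps
  have hε' := hA'.eps
  set Pu : ℝ → Lp ℝ 2 μ := fun t => nem μ (Ph m r) (u t)
  set Pv : ℝ → Lp ℝ 2 μ := fun t => nem μ (Ph m r) (v t)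
  set Fu : ℝ → Lp ℝ 2 μ := fun t => nem μ (Fr p r) (u t)
  set Fv : ℝ → Lp ℝ 2 μ := fun t => nem μ (Fr p r) (v t)
  set z : ℝ → V := fun t => j (u t - v t) with hz
  have hzd : ∀ t ∈ Icc 0 T, HasDerivWithinAt (fun t => ‖z t‖ ^ 2)
      (2 * inner ℝ (z t) (j ((-(A (Pu t)) + Fu t) - (-(A' (Pv t)) + Fv t)))) (Icc 0 T) t := by
    intro t ht
    have := j.hasFDerivAt.comp_hasDerivWithinAt t ((hu.2 t ht).sub (hv.2 t ht))
    exact this.norm_sq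
  have cu : ContinuousOn (fun t => ε * ‖A (Pu t)‖ ^ 2) (Icc 0 T) :=
    continuousOn_const.mul
      (((A.continuous.comp (nem_continuous zΦ)).comp_continuousOn hu.cont).norm.pow 2)
  have cv : ContinuousOn (fun t => ε' * ‖A' (Pv t)‖ ^ 2) (Icc 0 T) :=
    continuousOn_const.mul
      (((A'.continuous.comp (nem_continuous zΦ)).comp_continuousOn hv.cont).norm.pow 2)
  have cg : ContinuousOn (fun t => Λ⁻¹ * ‖Pu t - Pv t‖ ^ 2) (Icc 0 T) :=
    continuousOn_const.mul ((((nem_continuous zΦ).comp_continuousOn hu.cont).sub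
      ((nem_continuous zΦ).comp_continuousOn hv.cont)).norm.pow 2)
  set rr : ℝ → ℝ := fun t => 2 * B * (√ε * (1 + ε * ‖A (Pu t)‖ ^ 2) +
    √ε' * (1 + ε' * ‖A' (Pv t)‖ ^ 2)) with hrr
  have cr : ContinuousOn rr (Icc 0 T) :=
    continuousOn_const.mul ((continuousOn_const.mul (continuousOn_const.add cu)).add
      (continuousOn_const.mul (continuousOn_const.add cv)))
  have main : ∀ t ∈ Icc 0 T,
      2 * inner ℝ (z t) (j ((-(A (Pu t)) + Fu t) - (-(A' (Pv t)) + Fv t)))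
      + Λ⁻¹ * ‖Pu t - Pv t‖ ^ 2 ≤ (Λ * b ^ 2) * ‖z t‖ ^ 2 + rr t := by
    intro t ht
    set w := u t - v t with hw
    have e1 : inner ℝ (z t) (j ((-(A (Pu t)) + Fu t) - (-(A' (Pv t)) + Fv t))) =
        - inner ℝ (Pu t - Pv t) w + (ε * inner ℝ (A (Pu t)) w - ε' * inner ℝ (A' (Pv t)) w)
        + inner ℝ (z t) (j (Fu t - Fv t)) := by
      have : j ((-(A (Pu t)) + Fu t) - (-(A' (Pv t)) + Fv t)) =
        -(j (A (Pu t))) + j (A' (Pv t)) + j (Fu t - Fv t) := by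
        simp only [map_sub, map_add, map_neg]; abel
      rw [this, inner_add_right, inner_add_right, inner_neg_right,
        real_inner_comm (j (A (Pu t))), real_inner_comm (j (A' (Pv t)))]
      simp only [hz]
      rw [hK, hK', inner_sub_left]; ring
    have i1 : Λ⁻¹ * ‖Pu t - Pv t‖ ^ 2 ≤ inner ℝ (Pu t - Pv t) w := by
      rw [inv_mul_eq_div, div_le_iff₀ hΛ0, mul_comm, norm_sq, inner_eq, ← integral_const_mul]
      apply integral_mono_ae (int_sq _) ((int_mul _ _).const_mul _)
      filter_upwards [coe_nem zΦ (u t), coe_nem zΦ (v t), Lp.coeFn_sub (Pu t) (Pv t),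
        Lp.coeFn_sub (u t) (v t)] with x h1 h2 h3 h4
      rw [hw, h3, h4, Pi.sub_apply, Pi.sub_apply]
      simp only [Pu, Pv]
      rw [h1, h2]
      exact hΛ _ _
    have hwB : ‖w‖ ≤ 2 * B := by
      have := norm_sub_le (u t) (v t)
      linarith [hB ε κ A u hA hu t ht, hB ε' κ A' v hA' hv t ht]
    have sq : ∀ (e : ℝ) (f : Lp ℝ 2 μ), 0 < e → |e * inner ℝ f w| ≤ B * (√e * (1 + e * ‖f‖ ^ 2)) := by
      intro e f he
      rw [abs_mul, abs_of_pos he]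
      have h1 : |inner ℝ f w| ≤ ‖f‖ * (2 * B) :=
        (abs_real_inner_le_norm f w).trans (by gcongr)
      have hs : √e * √e = e := Real.mul_self_sqrt he.le
      have h2 : 2 * (√e * ‖f‖) ≤ 1 + e * ‖f‖ ^ 2 := by
        nlinarith [sq_nonneg (√e * ‖f‖ - 1)]
      calc e * |inner ℝ f w| ≤ e * (‖f‖ * (2 * B)) := by gcongr
        _ = √e * √e * (‖f‖ * (2 * B)) := by rw [hs]
        _ = B * (√e * (2 * (√e * ‖f‖))) := by ring
        _ ≤ _ := by gcongr
    have i2 := sq ε (A (Pu t)) hε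
    have i3 := sq ε' (A' (Pv t)) hε'
    have i4 : 2 * inner ℝ (z t) (j (Fu t - Fv t)) ≤
        Λ⁻¹ * ‖Pu t - Pv t‖ ^ 2 + (Λ * b ^ 2) * ‖z t‖ ^ 2 := by
      have h1 : inner ℝ (z t) (j (Fu t - Fv t)) ≤ ‖z t‖ * (b * ‖Pu t - Pv t‖) := by
        refine (real_inner_le_norm _ _).trans ?_
        gcongr
        refine (j.le_opNorm _).trans ?_
        rw [hb, mul_assoc]
        gcongr
        exact nem_sq_le zΦ zF hc0 hc _ _
      set d := ‖Pu t - Pv t‖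
      have h3 : 0 ≤ Λ⁻¹ * (d - Λ * b * ‖z t‖) ^ 2 := by positivity
      have h4 : Λ⁻¹ * (d - Λ * b * ‖z t‖) ^ 2 =
        Λ⁻¹ * d ^ 2 - 2 * (‖z t‖ * (b * d)) + (Λ * b ^ 2) * ‖z t‖ ^ 2 := by
        field_simp; ring
      linarith
    rw [e1, hrr]
    have := le_abs_self (ε * inner ℝ (A (Pu t)) w)
    have := neg_abs_le (ε' * inner ℝ (A' (Pv t)) w)
    linarith
  have g := gron' (by positivity) hzd (fun t _ => by positivity) cg cr
    (fun _ _ => by positivity) (fun _ _ => by positivity) main T ⟨hT, le_rfl⟩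
  have z0 : ‖z 0‖ ^ 2 = 0 := by simp [hz, hu.1, hv.1]
  rw [z0, zero_add, intervalIntegral.integral_const_mul] at g
  have iu := cu.intervalIntegrable_of_Icc (μ := volume) hT
  have iv := cv.intervalIntegrable_of_Icc (μ := volume) hT
  have ir : ∫ t in (0:ℝ)..T, rr t ≤ 2 * B * ((√ε + √ε') * (T + D)) := by
    rw [hrr, intervalIntegral.integral_const_mul, intervalIntegral.integral_add
      ((intervalIntegrable_const.add iu).const_mul _) ((intervalIntegrable_const.add iv).const_mul _),
      intervalIntegral.integral_const_mul, intervalIntegral.integral_const_mul,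
      intervalIntegral.integral_add intervalIntegrable_const iu,
      intervalIntegral.integral_add intervalIntegrable_const iv]
    simp only [intervalIntegral.integral_const, smul_eq_mul, mul_one, sub_zero]
    have h1 := hD ε κ A u hA hu
    have h2 := hD ε' κ A' v hA' hv
    apply mul_le_mul_of_nonneg_left _ (by positivity)
    rw [add_mul]
    gcongr
  have hzT : 0 ≤ ‖z T‖ ^ 2 := by positivity
  have g2 : Λ⁻¹ * ∫ t in (0:ℝ)..T, ‖Pu t - Pv t‖ ^ 2 ≤ E * (2 * B * ((√ε + √ε') * (T + D))) := by
    have : E * ∫ t in (0:ℝ)..T, rr t ≤ E * (2 * B * ((√ε + √ε') * (T + D))) :=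
      mul_le_mul_of_nonneg_left ir (Real.exp_nonneg _)
    linarith
  rw [inv_mul_eq_div, div_le_iff₀ hΛ0] at g2
  calc _ ≤ _ := g2
    _ = _ := by ring

end VW


namespace VW
open Set Filter Topology
open scoped NNReal ENNReal

lemma ae_summable {β : Type*} [MeasurableSpace β] {ν : Measure β} {f : ℕ → β → ℝ} {c : ℕ → ℝ}
    (h0 : ∀ k x, 0 ≤ f k x) (hi : ∀ k, Integrable (f k) ν) (hc : ∀ k, ∫ x, f k x ∂ν ≤ c k)
    (hs : Summable c) : ∀ᵐ x ∂ν, Summable fun k => f k x := by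
  have hc0 : ∀ k, 0 ≤ c k := fun k => (integral_nonneg (h0 k)).trans (hc k)
  have h1 : ∫⁻ x, ∑' k, ENNReal.ofReal (f k x) ∂ν ≠ ∞ := by
    rw [lintegral_tsum fun k => (hi k).aestronglyMeasurable.aemeasurable.ennreal_ofReal]
    have h2 : ∀ k, ∫⁻ x, ENNReal.ofReal (f k x) ∂ν ≤ ENNReal.ofReal (c k) := by
      intro k
      rw [← ofReal_integral_eq_lintegral_ofReal (hi k) (ae_of_all _ (h0 k))]
      exact ENNReal.ofReal_le_ofReal (hc k)
    refine ne_top_of_le_ne_top ?_ (ENNReal.tsum_le_tsum h2)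
    rw [← ENNReal.ofReal_tsum_of_nonneg hc0 hs]
    exact ENNReal.ofReal_ne_top
  have h3 := ae_lt_top' (AEMeasurable.tsum fun k =>
    (hi k).aestronglyMeasurable.aemeasurable.ennreal_ofReal) h1
  filter_upwards [h3] with x hx
  have := ENNReal.summable_toReal hx.ne
  refine this.congr fun k => ?_
  rw [ENNReal.toReal_ofReal (h0 k x)]

lemma ae_converge {E : Type*} [NormedAddCommGroup E] [CompleteSpace E] {P : ℕ → ℝ → E} {T C : ℝ}
    (hT : 0 ≤ T) (hP : ∀ k, ContinuousOn (P k) (Icc 0 T))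
    (h : ∀ k, ∫ t in (0:ℝ)..T, ‖P (k+1) t - P k t‖ ^ 2 ≤ C * (1/4) ^ k) :
    ∀ᵐ t ∂(volume.restrict (Ioo 0 T)), ∃ l, Tendsto (fun k => P k t) atTop (𝓝 l) := by
  have hcont : ∀ k, ContinuousOn (fun t => (2:ℝ) ^ k * ‖P (k+1) t - P k t‖ ^ 2) (Icc 0 T) := fun k =>
    continuousOn_const.mul (((hP (k+1)).sub (hP k)).norm.pow 2)
  have h1 : ∀ᵐ t ∂(volume.restrict (Ioo 0 T)),
      Summable fun k : ℕ => (2:ℝ) ^ k * ‖P (k+1) t - P k t‖ ^ 2 := by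
    refine ae_summable (c := fun k => C * (1/2) ^ k) (fun k x => by positivity)
      (fun k => ((hcont k).integrableOn_compact isCompact_Icc).mono_set Ioo_subset_Icc_self) ?_
      (summable_geometric_two.mul_left C)
    intro k
    rw [← integral_Ioc_eq_integral_Ioo, ← intervalIntegral.integral_of_le hT,
      intervalIntegral.integral_const_mul]
    calc _ ≤ (2:ℝ) ^ k * (C * (1/4) ^ k) := by gcongr; exact h k
      _ = C * (1/2) ^ k := by
        have : (1/2:ℝ) ^ k = 2 ^ k * (1/4) ^ k := by rw [← mul_pow]; norm_num
        rw [this]; ring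
  filter_upwards [h1] with t ht
  have h2 : Summable fun k => ‖P (k+1) t - P k t‖ := by
    refine Summable.of_nonneg_of_le (fun k => norm_nonneg _) (fun k => ?_)
      (ht.add summable_geometric_two)
    set d := ‖P (k+1) t - P k t‖
    have e : (1/2:ℝ) ^ k = (2 ^ k)⁻¹ := by rw [one_div, inv_pow]
    rw [e]
    have h2k : (0:ℝ) < 2 ^ k := by positivity
    set a := (2:ℝ) ^ k
    have : 0 ≤ a⁻¹ * ((a * d - 1) ^ 2 + a * d) := by positivity
    have e2 : a⁻¹ * ((a * d - 1) ^ 2 + a * d) = a * d ^ 2 + a⁻¹ - d := by field_simp; ring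
    linarith
  have h3 : Summable fun k => dist (P k t) (P (k+1) t) := by
    refine h2.congr fun k => ?_
    rw [dist_eq_norm, norm_sub_rev]
  exact cauchySeq_tendsto_of_complete (cauchySeq_of_summable_dist h3)

variable {α : Type*} [MeasurableSpace α] {μ : Measure α}

lemma ae_tendsto_Lp {e : ℕ → Lp ℝ 2 μ} {w : Lp ℝ 2 μ} (h : ∀ j, ‖e j - w‖ ≤ (1/2) ^ j) :
    ∀ᵐ x ∂μ, Tendsto (fun j => e j x) atTop (𝓝 (w x)) := by
  have h1 : ∀ᵐ x ∂μ, Summable fun j => (e j - w) x ^ 2 := by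
    refine ae_summable (c := fun j => (1/4) ^ j) (fun k x => sq_nonneg _) (fun k => int_sq _) ?_
      (summable_geometric_of_lt_one (by norm_num) (by norm_num))
    intro k
    rw [← norm_sq]
    calc _ ≤ ((1/2 : ℝ) ^ k) ^ 2 := by gcongr; exact h k
      _ = _ := by rw [← pow_mul, mul_comm, pow_mul]; norm_num
  filter_upwards [h1, ae_all_iff.2 fun j => Lp.coeFn_sub (e j) w] with x hx h2
  have h3 := hx.tendsto_atTop_zero
  have h4 : Tendsto (fun j => |e j x - w x|) atTop (𝓝 0) := by
    have := (Real.continuous_sqrt.tendsto 0).comp h3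
    rw [Real.sqrt_zero] at this
    refine this.congr fun j => ?_
    simp only [Function.comp, h2, Pi.sub_apply, Real.sqrt_sq_eq_abs]
  rw [tendsto_iff_dist_tendsto_zero]
  exact h4

lemma exists_subseq_ae {e : ℕ → Lp ℝ 2 μ} {w : Lp ℝ 2 μ} (h : Tendsto e atTop (𝓝 w)) :
    ∃ φ : ℕ → ℕ, StrictMono φ ∧ ∀ᵐ x ∂μ, Tendsto (fun j => e (φ j) x) atTop (𝓝 (w x)) := by
  have h1 : ∀ j : ℕ, ∃ K, ∀ k ≥ K, ‖e k - w‖ ≤ (1/2) ^ j := by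
    intro j
    obtain ⟨K, hK⟩ := Metric.tendsto_atTop.1 h ((1/2) ^ j) (by positivity)
    exact ⟨K, fun k hk => by rw [← dist_eq_norm]; exact (hK k hk).le⟩
  obtain ⟨φ, hφ, h2⟩ := extraction_forall_of_eventually' h1
  exact ⟨φ, hφ, ae_tendsto_Lp h2⟩

lemma meas_idx {β : Type*} [MeasurableSpace β] {v : ℕ → β → ℝ} (hv : ∀ n, Measurable (v n))
    {i : β → ℕ} (hi : Measurable i) : Measurable fun q => v (i q) q := by
  have h1 : Measurable (fun q : ℕ × β => v q.1 q.2) :=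
    measurable_from_prod_countable_right fun n => hv n
  exact h1.comp (hi.prodMk measurable_id)

lemma joint_meas {W : ℝ → Lp ℝ 2 μ} (hW : StronglyMeasurable W) :
    ∃ w : α × ℝ → ℝ, Measurable w ∧ ∀ t, ∀ᵐ x ∂μ, w (x, t) = W t x := by
  classical
  obtain ⟨s, hs⟩ := id hW
  set v : ℕ → α × ℝ → ℝ := fun n q => ∑ e ∈ (s n).range, (s n ⁻¹' {e}).indicator (fun _ => e q.1) q.2
  have hv : ∀ n, Measurable (v n) := by
    intro n
    refine Finset.measurable_fun_sum _ fun e _ => ?_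
    have : (fun q : α × ℝ => (s n ⁻¹' {e}).indicator (fun _ => e q.1) q.2)
        = (Prod.snd ⁻¹' (s n ⁻¹' {e})).indicator (fun q : α × ℝ => e q.1) := by
      ext q; simp [indicator]
    rw [this]
    exact ((Lp.stronglyMeasurable e).measurable.comp measurable_fst).indicator
      (measurable_snd ((s n).measurableSet_fiber e))
  have hv' : ∀ n x t, v n (x, t) = s n t x := by
    intro n x t
    simp only [v]
    rw [Finset.sum_eq_single (s n t)]
    · simp [indicator]
    · intro b _ hb
      apply indicator_of_notMem
      simpa using hb.symm
    · intro h; exact absurd (SimpleFunc.mem_range_self _ t) h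
  have hp : ∀ (j : ℕ) (t : ℝ), ∃ n, ‖s n t - W t‖ < (1/2) ^ j := by
    intro j t
    obtain ⟨K, hK⟩ := Metric.tendsto_atTop.1 (hs t) ((1/2) ^ j) (by positivity)
    exact ⟨K, by rw [← dist_eq_norm]; exact hK K le_rfl⟩
  set idx : ℕ → ℝ → ℕ := fun j t => Nat.find (hp j t)
  have hidx : ∀ j, Measurable (idx j) := by
    intro j
    refine measurable_find (hp j) fun k => ?_
    have h1 : StronglyMeasurable (fun t => ‖s k t - W t‖) :=
      ((s k).stronglyMeasurable.sub hW).norm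
    have h2 : MeasurableSet {t | ‖s k t - W t‖ < (1/2) ^ j} :=
      measurableSet_lt h1.measurable measurable_const
    exact h2
  set z : ℕ → α × ℝ → ℝ := fun j q => v (idx j q.2) q
  have hz : ∀ j, Measurable (z j) := by
    intro j
    exact meas_idx hv ((hidx j).comp measurable_snd)
  refine ⟨fun q => limUnder atTop fun j => z j q, ?_, ?_⟩
  · exact (StronglyMeasurable.limUnder (l := atTop) fun j => (hz j).stronglyMeasurable).measurable
  · intro t
    have := ae_tendsto_Lp (e := fun j => s (idx j t) t) (w := W t)
      (fun j => (Nat.find_spec (hp j t)).le)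
    filter_upwards [this] with x hx
    refine Tendsto.limUnder_eq ?_
    refine hx.congr fun j => ?_
    simp only [z, hv']

lemma conv {e : ℕ → Lp ℝ 2 μ} {w : Lp ℝ 2 μ} (h : Tendsto e atTop (𝓝 w)) {g : ℝ → ℝ}
    (hg : Continuous g) {M : ℝ} (hM : ∀ k, ∀ᵐ x ∂μ, |g (e k x)| ≤ M) {Q : α → ℝ}
    (hQ : Integrable Q μ) :
    Tendsto (fun k => ∫ x, g (e k x) * Q x ∂μ) atTop (𝓝 (∫ x, g (w x) * Q x ∂μ)) := by
  apply tendsto_of_subseq_tendsto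
  intro ns hns
  obtain ⟨φ, hφ, hx⟩ := exists_subseq_ae (h.comp hns)
  refine ⟨φ, ?_⟩
  refine tendsto_integral_of_dominated_convergence (fun x => M * |Q x|) (fun k => ?_)
    (hQ.abs.const_mul M) (fun k => ?_) ?_
  · exact (hg.comp_aestronglyMeasurable (Lp.aestronglyMeasurable _)).mul hQ.aestronglyMeasurable
  · filter_upwards [hM (ns (φ k))] with x h1
    rw [Real.norm_eq_abs, abs_mul]
    gcongr
  · filter_upwards [hx] with x h1
    exact ((hg.tendsto _).comp h1).mul tendsto_const_nhds

end VW


namespace VW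
open Set Filter Topology
open scoped NNReal ENNReal

variable {α : Type*} [MeasurableSpace α] {μ : Measure α}
  {V : Type*} [NormedAddCommGroup V] [InnerProductSpace ℝ V]

/-- Integrable and bounded elements. -/
def IB (M : ℝ) (f : Lp ℝ 2 μ) : Prop :=
  Integrable f μ ∧ ∫ x, |f x| ∂μ ≤ M ∧ ∀ᵐ x ∂μ, |f x| ≤ M

/-- Abstract test triples. -/
structure Test (j : Lp ℝ 2 μ →L[ℝ] V) (T M : ℝ) (P Q S : ℝ → Lp ℝ 2 μ) : Prop where
  dP : ∀ t ∈ Icc 0 T, HasDerivWithinAt P (Q t) (Icc 0 T) t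
  PT : P T = 0
  cQ : ContinuousOn Q (Icc 0 T)
  cS : ContinuousOn S (Icc 0 T)
  rel : ∀ t ∈ Icc 0 T, ∀ f, inner ℝ (j f) (j (S t)) = inner ℝ f (P t)
  iP : ∀ t ∈ Icc 0 T, IB M (P t)
  iQ : ∀ t ∈ Icc 0 T, IB M (Q t)
  iS : ∀ t ∈ Icc 0 T, IB M (S t)

lemma Test.cP {j : Lp ℝ 2 μ →L[ℝ] V} {T M : ℝ} {P Q S : ℝ → Lp ℝ 2 μ} (h : Test j T M P Q S) :
    ContinuousOn P (Icc 0 T) := fun t ht => (h.dP t ht).continuousWithinAt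

lemma weak_eps {j : Lp ℝ 2 μ →L[ℝ] V} {T M : ℝ} {P Q S : ℝ → Lp ℝ 2 μ} (h : Test j T M P Q S)
    (hT : 0 ≤ T) {ε : ℝ} {A : Lp ℝ 2 μ →L[ℝ] Lp ℝ 2 μ}
    (hj : ∀ f g, inner ℝ (j (A f)) (j g) = inner ℝ f g - ε * inner ℝ (A f) g)
    {Φ F : ℝ → ℝ} (hΦ : LZ Φ) (hF : LZ F) {u0 : Lp ℝ 2 μ} {u : ℝ → Lp ℝ 2 μ}
    (hu : Sol A Φ F T u0 u) :
    (∫ t in (0:ℝ)..T, inner ℝ (u t) (Q t)) - (∫ t in (0:ℝ)..T, inner ℝ (nem μ Φ (u t)) (S t))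
      + (∫ t in (0:ℝ)..T, ε * inner ℝ (A (nem μ Φ (u t))) (S t))
      + (∫ t in (0:ℝ)..T, inner ℝ (nem μ F (u t)) (P t)) = - inner ℝ u0 (P 0) := by
  have cu := hu.cont
  have c1 : ContinuousOn (fun t => nem μ Φ (u t)) (Icc 0 T) := (nem_continuous hΦ).comp_continuousOn cu
  have c2 : ContinuousOn (fun t => nem μ F (u t)) (Icc 0 T) := (nem_continuous hF).comp_continuousOn cu
  have c3 : ContinuousOn (fun t => A (nem μ Φ (u t))) (Icc 0 T) := A.continuous.comp_continuousOn c1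
  have i1 : IntervalIntegrable (fun t => inner ℝ (u t) (Q t)) volume 0 T :=
    (ContinuousOn.inner cu h.cQ).intervalIntegrable_of_Icc hT
  have i2 : IntervalIntegrable (fun t => inner ℝ (nem μ Φ (u t)) (S t)) volume 0 T :=
    (ContinuousOn.inner c1 h.cS).intervalIntegrable_of_Icc hT
  have i3 : IntervalIntegrable (fun t => ε * inner ℝ (A (nem μ Φ (u t))) (S t)) volume 0 T :=
    (continuousOn_const.mul (ContinuousOn.inner c3 h.cS)).intervalIntegrable_of_Icc hT
  have i4 : IntervalIntegrable (fun t => inner ℝ (nem μ F (u t)) (P t)) volume 0 T :=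
    (ContinuousOn.inner c2 h.cP).intervalIntegrable_of_Icc hT
  have ftc := intervalIntegral.integral_eq_sub_of_hasDerivAt_of_le (f := fun t => inner ℝ (u t) (P t))
    (f' := fun t => inner ℝ (u t) (Q t) - inner ℝ (nem μ Φ (u t)) (S t)
      + ε * inner ℝ (A (nem μ Φ (u t))) (S t) + inner ℝ (nem μ F (u t)) (P t)) hT
    (ContinuousOn.inner cu h.cP) (fun t ht => by
      have ht' := Ioo_subset_Icc_self ht
      have h1 := (hu.2 t ht').hasDerivAt (Icc_mem_nhds ht.1 ht.2)
      have h2 := (h.dP t ht').hasDerivAt (Icc_mem_nhds ht.1 ht.2)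
      have h3 := h1.inner ℝ h2
      have e : inner ℝ (A (nem μ Φ (u t))) (P t) = inner ℝ (nem μ Φ (u t)) (S t)
        - ε * inner ℝ (A (nem μ Φ (u t))) (S t) := by rw [← h.rel t ht', hj]
      refine h3.congr_deriv ?_
      rw [inner_add_left, inner_neg_left, e]; ring) (((i1.sub i2).add i3).add i4)
  rw [intervalIntegral.integral_add ((i1.sub i2).add i3) i4,
    intervalIntegral.integral_add (i1.sub i2) i3, intervalIntegral.integral_sub i1 i2] at ftc
  rw [ftc, h.PT, hu.1]; simp

/-- The inverse of the power. -/
noncomputable def G (m s : ℝ) : ℝ := (max s 0) ^ (1 / m)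

lemma G_cont {m : ℝ} (hm : 1 < m) : Continuous (G m) :=
  (continuous_id.max continuous_const).rpow_const fun x => Or.inr (by positivity)

lemma G_nonneg (m s : ℝ) : 0 ≤ G m s := Real.rpow_nonneg (le_max_right _ _) _

lemma G_mono {m : ℝ} (hm : 1 < m) : Monotone (G m) := fun a b h =>
  Real.rpow_le_rpow (le_max_right _ _) (max_le_max_right 0 h) (by positivity)

lemma G_pow {m s : ℝ} (hm : 1 < m) (hs : 0 ≤ s) : G m s ^ m = s := by
  unfold G; rw [max_eq_left hs, ← Real.rpow_mul hs, one_div, inv_mul_cancel₀ (by linarith), Real.rpow_one]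

lemma G_Ph {m r s : ℝ} (hm : 1 < m) (h : s ∈ Icc 0 r) : G m (Ph m r s) = s := by
  unfold G; rw [max_eq_left (Ph_nonneg (h.1.trans h.2) _), Ph_eq h.1 h.2, ← Real.rpow_mul h.1, one_div,
    mul_inv_cancel₀ (by linarith), Real.rpow_one]

/-- Level data. -/
structure Lev (μ : Measure α) (j : Lp ℝ 2 μ →L[ℝ] V) (m p r T κ : ℝ) (u0 : Lp ℝ 2 μ)
    (A : ℕ → Lp ℝ 2 μ →L[ℝ] Lp ℝ 2 μ) (U : ℕ → ℝ → Lp ℝ 2 μ) : Prop where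
  hp : 1 < p
  hpm : p < m
  hr : 1 ≤ r
  hT : 0 < T
  h0 : ∀ᵐ x ∂μ, u0 x ∈ Icc 0 r
  res : ∀ k, Res μ ((1/16) ^ k) κ (A k)
  hj : ∀ k f g, inner ℝ (j (A k f)) (j g) = inner ℝ f g - (1/16) ^ k * inner ℝ (A k f) g
  sol : ∀ k, Sol (A k) (Ph m r) (Fr p r) T u0 (U k)

namespace Lev
variable {j : Lp ℝ 2 μ →L[ℝ] V} {m p r T κ : ℝ} {u0 : Lp ℝ 2 μ}
    {A : ℕ → Lp ℝ 2 μ →L[ℝ] Lp ℝ 2 μ} {U : ℕ → ℝ → Lp ℝ 2 μ}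

lemma hm (h : Lev μ j m p r T κ u0 A U) : 1 < m := h.hp.trans h.hpm
lemma hr0 (h : Lev μ j m p r T κ u0 A U) : 0 ≤ r := zero_le_one.trans h.hr
lemma zΦ (h : Lev μ j m p r T κ u0 A U) : LZ (Ph m r) := Ph_LZ h.hm.le h.hr0
lemma zF (h : Lev μ j m p r T κ u0 A U) : LZ (Fr p r) := Fr_LZ h.hp.le h.hr0

lemma sq16 (k : ℕ) : √((1/16 : ℝ) ^ k) = (1/4) ^ k := by
  have : (1/16 : ℝ) ^ k = ((1/4) ^ k) ^ 2 := by rw [← pow_mul, mul_comm, pow_mul]; norm_num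
  rw [this, Real.sqrt_sq (by positivity)]

lemma lim [SigmaFinite μ] (h : Lev μ j m p r T κ u0 A U) : ∃ W : ℝ → Lp ℝ 2 μ, StronglyMeasurable W ∧
    ∀ᵐ t ∂(volume.restrict (Ioo 0 T)),
      Tendsto (fun k => nem μ (Ph m r) (U k t)) atTop (𝓝 (W t)) := by
  obtain ⟨C, hC0, hC⟩ := sol_cauchy (T := T) j h.hp.le h.hm.le h.hr h.h0 h.hT.le
  have hcont : ∀ k, ContinuousOn (fun t => nem μ (Ph m r) (U k t)) (Icc 0 T) := fun k =>
    (nem_continuous h.zΦ).comp_continuousOn (h.sol k).cont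
  have h1 := ae_converge (P := fun k t => nem μ (Ph m r) (U k t)) (C := C * 2) h.hT.le hcont
    (fun k => by
      refine (hC _ _ κ _ _ _ _ (h.res (k+1)) (h.res k) (h.hj _) (h.hj _) (h.sol _) (h.sol _)).trans ?_
      rw [sq16, sq16, mul_assoc]
      apply mul_le_mul_of_nonneg_left _ hC0
      have : (1/4 : ℝ) ^ (k+1) ≤ (1/4) ^ k := pow_le_pow_of_le_one (by norm_num) (by norm_num) (by simp)
      linarith)
  obtain ⟨f, hf, hlim⟩ := exists_stronglyMeasurable_limit_of_tendsto_ae (fun k =>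
    ((hcont k).mono Ioo_subset_Icc_self).aestronglyMeasurable measurableSet_Ioo) h1
  exact ⟨f, hf, hlim⟩

lemma mem (h : Lev μ j m p r T κ u0 A U) (k : ℕ) {t : ℝ} (ht : t ∈ Icc 0 T) :
    ∀ᵐ x ∂μ, U k t x ∈ Icc 0 r ∧ nem μ (Ph m r) (U k t) x = U k t x ^ m ∧
      G m (nem μ (Ph m r) (U k t) x) = U k t x := by
  filter_upwards [sol_mem (h.res k) h.hp.le h.hm.le h.hr0 (h.sol k) h.h0 t ht,
    coe_nem h.zΦ (U k t)] with x h1 h2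
  exact ⟨h1, by rw [h2, Ph_eq h1.1 h1.2], by rw [h2, G_Ph h.hm h1]⟩

lemma nonneg (h : Lev μ j m p r T κ u0 A U) {t : ℝ} (ht : t ∈ Icc 0 T) {w : Lp ℝ 2 μ}
    (hw : Tendsto (fun k => nem μ (Ph m r) (U k t)) atTop (𝓝 w)) : ∀ᵐ x ∂μ, 0 ≤ w x := by
  obtain ⟨φ, hφ, hx⟩ := exists_subseq_ae hw
  filter_upwards [hx, ae_all_iff.2 fun k => h.mem k ht] with x h1 h2
  refine ge_of_tendsto' h1 fun k => ?_
  rw [(h2 _).2.1]; exact Real.rpow_nonneg (h2 _).1.1 _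

lemma mono {r' : ℝ} {v0 : Lp ℝ 2 μ} {U' : ℕ → ℝ → Lp ℝ 2 μ} (h : Lev μ j m p r T κ u0 A U)
    (h' : Lev μ j m p r' T κ v0 A U') (hrr : r ≤ r') (huv : ∀ᵐ x ∂μ, u0 x ≤ v0 x)
    {t : ℝ} (ht : t ∈ Icc 0 T) {w w' : Lp ℝ 2 μ}
    (hw : Tendsto (fun k => nem μ (Ph m r) (U k t)) atTop (𝓝 w))
    (hw' : Tendsto (fun k => nem μ (Ph m r') (U' k t)) atTop (𝓝 w')) : ∀ᵐ x ∂μ, w x ≤ w' x := by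
  obtain ⟨φ, hφ, hx⟩ := exists_subseq_ae (hw'.sub hw)
  filter_upwards [hx, ae_all_iff.2 fun k => h.mem k ht, ae_all_iff.2 fun k => h'.mem k ht,
    ae_all_iff.2 fun k => Lp.coeFn_sub (nem μ (Ph m r') (U' k t)) (nem μ (Ph m r) (U k t)),
    Lp.coeFn_sub w' w, ae_all_iff.2 fun k => sol_mono (h.res k) h.hp.le h.hm.le h.hr0 hrr (h.sol k)
      (h'.sol k) h.h0 huv t ht] with x h1 h2 h3 h4 h5 h6
  have : 0 ≤ (w' - w) x := by
    refine ge_of_tendsto' h1 fun k => ?_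
    rw [h4, Pi.sub_apply, (h2 _).2.1, (h3 _).2.1, sub_nonneg]
    exact Real.rpow_le_rpow (h2 _).1.1 (h6 _) (by linarith [h.hm])
  rw [h5, Pi.sub_apply] at this; linarith

lemma fatou (h : Lev μ j m p r T κ u0 A U) {K : ℝ≥0∞}
    {t : ℝ} (ht : t ∈ Icc 0 T) (hK : ∀ k, ∫⁻ x, ENNReal.ofReal ((max (U k t x - r⁻¹) 0) ^ m) ∂μ ≤ K)
    {w : Lp ℝ 2 μ} (hw : Tendsto (fun k => nem μ (Ph m r) (U k t)) atTop (𝓝 w)) :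
    ∫⁻ x, ENNReal.ofReal ((max (G m (w x) - r⁻¹) 0) ^ m) ∂μ ≤ K := by
  obtain ⟨φ, hφ, hx⟩ := exists_subseq_ae hw
  have hc : Continuous fun s => ENNReal.ofReal ((max (G m s - r⁻¹) 0) ^ m) := by
    refine ENNReal.continuous_ofReal.comp (Continuous.rpow_const ?_ fun x => Or.inr (by linarith [h.hm]))
    exact ((G_cont h.hm).sub continuous_const).max continuous_const
  calc ∫⁻ x, ENNReal.ofReal ((max (G m (w x) - r⁻¹) 0) ^ m) ∂μ
      ≤ ∫⁻ x, liminf (fun k => ENNReal.ofReal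
          ((max (G m (nem μ (Ph m r) (U (φ k) t) x) - r⁻¹) 0) ^ m)) atTop ∂μ := by
        apply lintegral_mono_ae
        filter_upwards [hx] with x h1
        exact ((hc.tendsto _).comp h1).liminf_eq.ge
    _ ≤ liminf (fun k => ∫⁻ x, ENNReal.ofReal
          ((max (G m (nem μ (Ph m r) (U (φ k) t) x) - r⁻¹) 0) ^ m) ∂μ) atTop :=
        lintegral_liminf_le' fun k =>
          hc.measurable.comp_aemeasurable (Lp.aestronglyMeasurable _).aemeasurable
    _ ≤ K := by
        refine liminf_le_of_frequently_le' (Eventually.of_forall fun k => ?_).frequently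
        refine le_trans (le_of_eq ?_) (hK (φ k))
        apply lintegral_congr_ae
        filter_upwards [h.mem (φ k) ht] with x h1
        rw [h1.2.2]

/-- One term of the weak formulation. -/
lemma term (h : Lev μ j m p r T κ u0 A U) {W : ℝ → Lp ℝ 2 μ}
    (hW : ∀ᵐ t ∂(volume.restrict (Ioo 0 T)),
      Tendsto (fun k => nem μ (Ph m r) (U k t)) atTop (𝓝 (W t)))
    {g Ψ : ℝ → ℝ} (hg : Continuous g) (hΨ : LZ Ψ) {B M : ℝ} (hB : 0 ≤ B)
    (hgb : ∀ s ∈ Icc 0 r, g (s ^ m) = Ψ s ∧ |Ψ s| ≤ B)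
    {Q : ℝ → Lp ℝ 2 μ} (cQ : ContinuousOn Q (Icc 0 T)) (iQ : ∀ t ∈ Icc 0 T, IB M (Q t)) :
    AEStronglyMeasurable (fun t => ∫ x, g (W t x) * Q t x ∂μ) (volume.restrict (Ioo 0 T)) ∧
    Tendsto (fun k => ∫ t in (0:ℝ)..T, inner ℝ (nem μ Ψ (U k t)) (Q t)) atTop
      (𝓝 (∫ t in Ioo 0 T, ∫ x, g (W t x) * Q t x ∂μ)) := by
  have e : ∀ k, ∀ t ∈ Icc 0 T, ∀ᵐ x ∂μ, nem μ Ψ (U k t) x = g (nem μ (Ph m r) (U k t) x) ∧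
      |nem μ Ψ (U k t) x| ≤ B := by
    intro k t ht
    filter_upwards [h.mem k ht, coe_nem hΨ (U k t)] with x h1 h2
    rw [h2, h1.2.1, (hgb _ h1.1).1]
    exact ⟨rfl, (hgb _ h1.1).2⟩
  have c : ∀ k, ContinuousOn (fun t => inner ℝ (nem μ Ψ (U k t)) (Q t)) (Icc 0 T) := fun k =>
    ContinuousOn.inner ((nem_continuous hΨ).comp_continuousOn (h.sol k).cont) cQ
  have ms : ∀ k, AEStronglyMeasurable (fun t => inner ℝ (nem μ Ψ (U k t)) (Q t))
      (volume.restrict (Ioo 0 T)) := fun k =>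
    ((c k).mono Ioo_subset_Icc_self).aestronglyMeasurable measurableSet_Ioo
  have hlim : ∀ᵐ t ∂(volume.restrict (Ioo 0 T)), Tendsto (fun k => inner ℝ (nem μ Ψ (U k t)) (Q t))
      atTop (𝓝 (∫ x, g (W t x) * Q t x ∂μ)) := by
    filter_upwards [hW, ae_restrict_mem measurableSet_Ioo] with t h1 h2
    have ht := Ioo_subset_Icc_self h2
    refine (conv h1 hg (M := B) (fun k => ?_) (iQ t ht).1).congr fun k => ?_
    · filter_upwards [e k t ht] with x h3
      rw [← h3.1]; exact h3.2
    · rw [inner_eq]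
      apply integral_congr_ae
      filter_upwards [e k t ht] with x h3
      rw [h3.1]
  refine ⟨aestronglyMeasurable_of_tendsto_ae atTop ms hlim, ?_⟩
  simp_rw [intervalIntegral.integral_of_le h.hT.le, integral_Ioc_eq_integral_Ioo]
  refine tendsto_integral_of_dominated_convergence (fun _ => B * M) ms (integrable_const _)
    (fun k => ?_) hlim
  filter_upwards [ae_restrict_mem measurableSet_Ioo] with t h2
  have ht := Ioo_subset_Icc_self h2
  rw [inner_eq]
  calc _ ≤ ∫ x, B * |Q t x| ∂μ := by
        apply norm_integral_le_of_norm_le ((iQ t ht).1.abs.const_mul B)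
        filter_upwards [e k t ht] with x h3
        rw [Real.norm_eq_abs, abs_mul]
        exact mul_le_mul_of_nonneg_right h3.2 (abs_nonneg _)
    _ ≤ B * M := by rw [integral_const_mul]; exact mul_le_mul_of_nonneg_left (iQ t ht).2.1 hB

lemma weak [SigmaFinite μ] (h : Lev μ j m p r T κ u0 A U) {W : ℝ → Lp ℝ 2 μ}
    (hW : ∀ᵐ t ∂(volume.restrict (Ioo 0 T)),
      Tendsto (fun k => nem μ (Ph m r) (U k t)) atTop (𝓝 (W t)))
    {M : ℝ} {P Q S : ℝ → Lp ℝ 2 μ} (ht : Test j T M P Q S) :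
    AEStronglyMeasurable (fun t => ∫ x, G m (W t x) * Q t x ∂μ) (volume.restrict (Ioo 0 T)) ∧
    AEStronglyMeasurable (fun t => ∫ x, W t x * S t x ∂μ) (volume.restrict (Ioo 0 T)) ∧
    AEStronglyMeasurable (fun t => ∫ x, Fr p r (G m (W t x)) * P t x ∂μ)
      (volume.restrict (Ioo 0 T)) ∧
    (∫ t in Ioo 0 T, ∫ x, G m (W t x) * Q t x ∂μ) - (∫ t in Ioo 0 T, ∫ x, W t x * S t x ∂μ)
      + (∫ t in Ioo 0 T, ∫ x, Fr p r (G m (W t x)) * P t x ∂μ) = - inner ℝ u0 (P 0) := by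
  have hm := h.hm
  have eG : ∀ s ∈ Icc 0 r, G m (s ^ m) = s := fun s hs => by
    rw [← Ph_eq (r := r) (m := m) hs.1 hs.2]; exact G_Ph hm hs
  obtain ⟨m1, t1⟩ := h.term hW (G_cont hm) (clp_LZ h.hr0) h.hr0 (fun s hs => by
    rw [eG s hs, clp_eq hs.1 hs.2, abs_of_nonneg hs.1]; exact ⟨rfl, hs.2⟩) ht.cQ ht.iQ
  obtain ⟨m2, t2⟩ := h.term hW continuous_id h.zΦ (Real.rpow_nonneg h.hr0 m) (fun s hs =>
    ⟨(Ph_eq hs.1 hs.2).symm, by rw [abs_of_nonneg (Ph_nonneg h.hr0 _)]; exact Ph_le hm.le h.hr0 _⟩) ht.cS ht.iS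
  obtain ⟨m3, t3⟩ := h.term hW (h.zF.continuous.comp (G_cont hm)) h.zF (Real.rpow_nonneg h.hr0 p)
    (fun s hs => ⟨by simp only [Function.comp]; rw [eG s hs], by
      rw [abs_of_nonneg (Fr_nonneg h.hr0 _)]
      refine (Fr_le _).trans ?_
      rw [max_eq_left hs.1]
      exact Real.rpow_le_rpow hs.1 hs.2 (by linarith [h.hp])⟩) ht.cP ht.iP
  refine ⟨m1, m2, m3, ?_⟩
  -- the vanishing term
  obtain ⟨D, hD0, hD⟩ := sol_energy (T := T) (m := m) h.hp.le hm.le h.hr0 h.h0 h.hT.le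
  obtain ⟨s, hs⟩ := isCompact_Icc.exists_bound_of_continuousOn ht.cS
  have hs0 : 0 ≤ s := (norm_nonneg _).trans (hs 0 ⟨le_rfl, h.hT.le⟩)
  have t4 : Tendsto (fun k => ∫ t in (0:ℝ)..T,
      (1/16 : ℝ) ^ k * inner ℝ (A k (nem μ (Ph m r) (U k t))) (S t)) atTop (𝓝 0) := by
    have hb : ∀ k, ‖∫ t in (0:ℝ)..T, (1/16 : ℝ) ^ k * inner ℝ (A k (nem μ (Ph m r) (U k t))) (S t)‖
        ≤ (1/4) ^ k * s * (T + D) := by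
      intro k
      have c3 : ContinuousOn (fun t => A k (nem μ (Ph m r) (U k t))) (Icc 0 T) :=
        (A k).continuous.comp_continuousOn
          ((nem_continuous h.zΦ).comp_continuousOn (h.sol k).cont)
      have i1 : IntervalIntegrable (fun t => (1/16 : ℝ) ^ k * ‖A k (nem μ (Ph m r) (U k t))‖ ^ 2)
          volume 0 T := (continuousOn_const.mul (c3.norm.pow 2)).intervalIntegrable_of_Icc h.hT.le
      calc _ ≤ ∫ t in (0:ℝ)..T, (1/4 : ℝ) ^ k * s *
            (1 + (1/16 : ℝ) ^ k * ‖A k (nem μ (Ph m r) (U k t))‖ ^ 2) := by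
            apply intervalIntegral.norm_integral_le_of_norm_le h.hT.le
            · refine ae_of_all _ fun t ht' => ?_
              have hst := hs t (Ioc_subset_Icc_self ht')
              set a := A k (nem μ (Ph m r) (U k t))
              have e4 : (1/16 : ℝ) ^ k = (1/4) ^ k * (1/4) ^ k := by rw [← mul_pow]; norm_num
              rw [norm_mul, Real.norm_of_nonneg (by positivity : (0:ℝ) ≤ (1/16) ^ k)]
              have h5 : ‖inner ℝ a (S t)‖ ≤ ‖a‖ * s :=
                (norm_inner_le_norm _ _).trans (by gcongr)
              have hq : (0:ℝ) ≤ (1/4) ^ k := by positivity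
              rw [e4]
              set q := (1/4 : ℝ) ^ k
              have h6 : q * ‖a‖ ≤ 1 + q * q * ‖a‖ ^ 2 := by nlinarith [sq_nonneg (q * ‖a‖ - 1), norm_nonneg a]
              calc q * q * ‖inner ℝ a (S t)‖ ≤ q * q * (‖a‖ * s) := by gcongr
                _ = q * s * (q * ‖a‖) := by ring
                _ ≤ _ := by gcongr
            · exact ((intervalIntegrable_const (c := (1:ℝ))).add i1).const_mul _
        _ = (1/4) ^ k * s * (T + ∫ t in (0:ℝ)..T, (1/16 : ℝ) ^ k * ‖A k (nem μ (Ph m r) (U k t))‖ ^ 2) := by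
            rw [intervalIntegral.integral_const_mul,
              intervalIntegral.integral_add intervalIntegrable_const i1]
            simp
        _ ≤ _ := by gcongr; exact hD _ κ _ _ (h.res k) (h.sol k)
    refine squeeze_zero_norm hb ?_
    have := ((tendsto_pow_atTop_nhds_zero_of_lt_one (r := (1/4:ℝ)) (by norm_num) (by norm_num)).mul_const
      s).mul_const (T + D)
    simpa using this
  have key : ∀ k, (∫ t in (0:ℝ)..T, inner ℝ (nem μ (clp r) (U k t)) (Q t))
      - (∫ t in (0:ℝ)..T, inner ℝ (nem μ (Ph m r) (U k t)) (S t))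
      + (∫ t in (0:ℝ)..T, (1/16 : ℝ) ^ k * inner ℝ (A k (nem μ (Ph m r) (U k t))) (S t))
      + (∫ t in (0:ℝ)..T, inner ℝ (nem μ (Fr p r) (U k t)) (P t)) = - inner ℝ u0 (P 0) := by
    intro k
    rw [← weak_eps ht h.hT.le (h.hj k) h.zΦ h.zF (h.sol k)]
    congr 3
    apply intervalIntegral.integral_congr
    intro t ht'
    rw [uIcc_of_le h.hT.le] at ht'
    have : nem μ (clp r) (U k t) = U k t := by
      apply Lp.ext
      filter_upwards [coe_nem (clp_LZ h.hr0) (U k t), h.mem k ht'] with x h1 h2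
      rw [h1, clp_eq h2.1.1 h2.1.2]
    simp only [this]
  have t5 := ((t1.sub t2).add t4).add t3
  have := tendsto_nhds_unique t5 (tendsto_const_nhds.congr fun k => (key k).symm)
  simpa using this

end Lev
end VW


namespace VW
open Set Filter Topology
open scoped NNReal ENNReal

variable {α : Type*} [MeasurableSpace α] {μ : Measure α}
  {V : Type*} [NormedAddCommGroup V] [InnerProductSpace ℝ V]

lemma dct2 {T M K : ℝ} {Q : ℝ → Lp ℝ 2 μ} (iQ : ∀ t ∈ Icc 0 T, IB M (Q t))
    {g : ℕ → ℝ → α → ℝ} {z b : ℝ → α → ℝ}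
    (hm : ∀ n, AEStronglyMeasurable (fun t => ∫ x, g n t x * Q t x ∂μ) (volume.restrict (Ioo 0 T)))
    (h : ∀ᵐ t ∂(volume.restrict (Ioo 0 T)), (∀ n, AEStronglyMeasurable (g n t) μ) ∧
      Integrable (b t) μ ∧ ∫ x, b t x ∂μ ≤ K ∧ ∀ᵐ x ∂μ, (∀ n, |g n t x| ≤ 1 + b t x) ∧ 0 ≤ b t x ∧
        Tendsto (fun n => g n t x) atTop (𝓝 (z t x))) :
    Tendsto (fun n => ∫ t in Ioo 0 T, ∫ x, g n t x * Q t x ∂μ) atTop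
      (𝓝 (∫ t in Ioo 0 T, ∫ x, z t x * Q t x ∂μ)) := by
  have dom : ∀ t ∈ Icc 0 T, (Integrable (b t) μ) → (∀ᵐ x ∂μ, 0 ≤ b t x) → ∫ x, b t x ∂μ ≤ K →
      Integrable (fun x => |Q t x| + M * b t x) μ ∧ ∫ x, |Q t x| + M * b t x ∂μ ≤ M + M * K ∧
      ∀ᵐ x ∂μ, (1 + b t x) * |Q t x| ≤ |Q t x| + M * b t x := by
    intro t ht h1 h2 h3
    refine ⟨(iQ t ht).1.abs.add (h1.const_mul M), ?_, ?_⟩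
    · rw [integral_add (iQ t ht).1.abs (h1.const_mul M), integral_const_mul]
      have hM : 0 ≤ M := (integral_nonneg fun x => abs_nonneg _).trans (iQ t ht).2.1
      have := (iQ t ht).2.1
      gcongr
    · filter_upwards [h2, (iQ t ht).2.2] with x h4 h5
      nlinarith
  refine tendsto_integral_of_dominated_convergence (fun _ => M + M * K) hm (integrable_const _)
    (fun n => ?_) ?_
  · filter_upwards [h, ae_restrict_mem measurableSet_Ioo] with t h1 h2
    obtain ⟨d1, d2, d3⟩ := dom t (Ioo_subset_Icc_self h2) h1.2.1 (h1.2.2.2.mono fun x h => h.2.1) h1.2.2.1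
    refine (norm_integral_le_of_norm_le d1 ?_).trans d2
    filter_upwards [h1.2.2.2, d3] with x h3 h4
    rw [Real.norm_eq_abs, abs_mul]
    exact (mul_le_mul_of_nonneg_right (h3.1 n) (abs_nonneg _)).trans h4
  · filter_upwards [h, ae_restrict_mem measurableSet_Ioo] with t h1 h2
    obtain ⟨d1, d2, d3⟩ := dom t (Ioo_subset_Icc_self h2) h1.2.1 (h1.2.2.2.mono fun x h => h.2.1) h1.2.2.1
    refine tendsto_integral_of_dominated_convergence _ (fun n => ?_) d1 (fun n => ?_) ?_
    · exact (h1.1 n).mul (iQ t (Ioo_subset_Icc_self h2)).1.aestronglyMeasurable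
    · filter_upwards [h1.2.2.2, d3] with x h3 h4
      rw [Real.norm_eq_abs, abs_mul]
      exact (mul_le_mul_of_nonneg_right (h3.1 n) (abs_nonneg _)).trans h4
    · filter_upwards [h1.2.2.2] with x h3
      exact h3.2.2.mul_const _

lemma exists_data [SigmaFinite μ] {u0 : α → ℝ} (hu : Measurable u0) (h0 : ∀ x, 0 ≤ u0 x) :
    ∃ v : ℕ → Lp ℝ 2 μ, (∀ n : ℕ, ∀ᵐ x ∂μ, v n x ∈ Icc 0 ((n:ℝ) + 1) ∧ v n x ≤ u0 x) ∧
      (∀ n, ∀ᵐ x ∂μ, v n x ≤ v (n+1) x) ∧ ∀ᵐ x ∂μ, Tendsto (fun n => v n x) atTop (𝓝 (u0 x)) := by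
  set f : ℕ → α → ℝ := fun n => (spanningSets μ n).indicator fun x => min (u0 x) (n+1)
  have hf0 : ∀ n x, 0 ≤ f n x := fun n x =>
    indicator_nonneg (fun x _ => le_min (h0 x) (by positivity)) x
  have hf1 : ∀ n x, f n x ≤ n + 1 := fun n x =>
    indicator_le' (fun x _ => min_le_right _ _) (fun _ _ => by positivity) x
  have hf2 : ∀ n x, f n x ≤ u0 x := fun n x =>
    indicator_le' (fun x _ => min_le_left _ _) (fun _ _ => by simpa using h0 _) x
  have hf3 : ∀ n x, f n x ≤ f (n+1) x := by
    intro n x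
    refine indicator_le_indicator_of_subset (monotone_spanningSets μ (Nat.le_succ n))
      (fun x => le_min (h0 x) (by positivity)) x |>.trans ?_
    apply indicator_le_indicator
    apply min_le_min le_rfl
    push_cast; linarith
  have hmem : ∀ n, MemLp (f n) 2 μ := by
    intro n
    have h1 : MemLp ((spanningSets μ n).indicator fun _ => (n:ℝ) + 1) 2 μ :=
      memLp_indicator_const 2 (measurableSet_spanningSets μ n) _ (Or.inr (measure_spanningSets_lt_top μ n).ne)
    refine h1.mono ((hu.min measurable_const).indicator
      (measurableSet_spanningSets μ n)).aestronglyMeasurable (ae_of_all _ fun x => ?_)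
    rw [Real.norm_of_nonneg (hf0 n x)]
    refine le_trans ?_ (le_abs_self _)
    exact indicator_le_indicator (min_le_right _ _)
  have hc : ∀ n, ∀ᵐ x ∂μ, (hmem n).toLp (f n) x = f n x := fun n => (hmem n).coeFn_toLp
  refine ⟨fun n => (hmem n).toLp (f n), fun n => ?_, fun n => ?_, ?_⟩
  · filter_upwards [hc n] with x h; rw [h]; exact ⟨⟨hf0 n x, hf1 n x⟩, hf2 n x⟩
  · filter_upwards [hc n, hc (n+1)] with x h h'; rw [h, h']; exact hf3 n x
  · filter_upwards [ae_all_iff.2 hc] with x h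
    simp_rw [h]
    refine tendsto_const_nhds.congr' ?_
    obtain ⟨n1, hn1⟩ : ∃ n, x ∈ spanningSets μ n := ⟨_, mem_spanningSetsIndex μ x⟩
    obtain ⟨n2, hn2⟩ := exists_nat_ge (u0 x)
    filter_upwards [eventually_ge_atTop (max n1 n2)] with n hn
    have h1 : x ∈ spanningSets μ n := monotone_spanningSets μ ((le_max_left _ _).trans hn) hn1
    have h2 : (n2:ℝ) ≤ n := by exact_mod_cast (le_max_right _ _).trans hn
    simp only [f, indicator_of_mem h1]
    rw [min_eq_left (by linarith)]

/-- pointwise limit of a monotone sequence. -/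
lemma limit_slice {m : ℝ} (hm : 1 < m) {K : ℝ} {g : ℕ → α → ℝ} (hg : ∀ n, AEMeasurable (g n) μ)
    (h0 : ∀ n x, 0 ≤ g n x) (hmon : ∀ n, ∀ᵐ x ∂μ, g n x ≤ g (n+1) x)
    (hK : ∀ n : ℕ, ∫⁻ x, ENNReal.ofReal ((max (g n x - ((n:ℝ)+1)⁻¹) 0) ^ m) ∂μ ≤ ENNReal.ofReal K) :
    ∫⁻ x, ENNReal.ofReal ((⨆ n, ENNReal.ofReal (g n x)).toReal ^ m) ∂μ ≤ ENNReal.ofReal K ∧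
    ∀ᵐ x ∂μ, Tendsto (fun n => g n x) atTop (𝓝 ((⨆ n, ENNReal.ofReal (g n x)).toReal)) ∧
      ∀ n, g n x ≤ (⨆ n, ENNReal.ofReal (g n x)).toReal := by
  have hm0 : 0 < m := by linarith
  set s : α → ℝ≥0∞ := fun x => ⨆ n, ENNReal.ofReal (g n x)
  have hmon' : ∀ᵐ x ∂μ, Monotone fun n => ENNReal.ofReal (g n x) := by
    filter_upwards [ae_all_iff.2 hmon] with x hx
    exact monotone_nat_of_le_succ fun n => ENNReal.ofReal_le_ofReal (hx n)
  have hinv : Tendsto (fun n : ℕ => ENNReal.ofReal (((n:ℝ)+1)⁻¹)) atTop (𝓝 0) := by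
    have : Tendsto (fun n : ℕ => (((n:ℝ)+1)⁻¹)) atTop (𝓝 0) := by
      simpa [one_div] using tendsto_one_div_add_atTop_nhds_zero_nat (𝕜 := ℝ)
    simpa using ENNReal.tendsto_ofReal this
  have hlim : ∀ᵐ x ∂μ, Tendsto (fun n : ℕ => ENNReal.ofReal ((max (g n x - ((n:ℝ)+1)⁻¹) 0) ^ m)) atTop
      (𝓝 (s x ^ m)) := by
    filter_upwards [hmon'] with x hx
    have h1 : Tendsto (fun n => ENNReal.ofReal (g n x)) atTop (𝓝 (s x)) := tendsto_atTop_iSup hx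
    have h2 := ENNReal.Tendsto.sub h1 hinv (Or.inr ENNReal.zero_ne_top)
    rw [tsub_zero] at h2
    have h3 := ((ENNReal.continuous_rpow_const (y := m)).tendsto _).comp h2
    refine h3.congr fun n => ?_
    simp only [Function.comp]
    rw [← ENNReal.ofReal_sub _ (by positivity), ← ENNReal.ofReal_rpow_of_nonneg (le_max_right _ _) hm0.le]
    congr 1
    rcases le_total 0 (g n x - ((n:ℝ)+1)⁻¹) with h | h
    · rw [max_eq_left h]
    · rw [max_eq_right h, ENNReal.ofReal_of_nonpos h, ENNReal.ofReal_zero]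
  have hms : ∀ n : ℕ, AEMeasurable (fun x => ENNReal.ofReal ((max (g n x - ((n:ℝ)+1)⁻¹) 0) ^ m)) μ := by
    intro n
    have := hg n
    fun_prop
  have hs : ∫⁻ x, s x ^ m ∂μ ≤ ENNReal.ofReal K := by
    calc _ = ∫⁻ x, liminf (fun n : ℕ => ENNReal.ofReal ((max (g n x - ((n:ℝ)+1)⁻¹) 0) ^ m)) atTop ∂μ := by
          apply lintegral_congr_ae
          filter_upwards [hlim] with x hx
          exact hx.liminf_eq.symm
      _ ≤ _ := lintegral_liminf_le' hms
      _ ≤ _ := liminf_le_of_frequently_le' (Eventually.of_forall hK).frequently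
  have hsm : AEMeasurable s μ := AEMeasurable.iSup fun n => (hg n).ennreal_ofReal
  have hfin : ∀ᵐ x ∂μ, s x ≠ ∞ := by
    have := ae_lt_top' (hsm.pow_const m) (ne_top_of_le_ne_top ENNReal.ofReal_ne_top hs)
    filter_upwards [this] with x hx h
    rw [h, ENNReal.top_rpow_of_pos hm0] at hx
    exact lt_irrefl _ hx
  refine ⟨le_trans (le_of_eq ?_) hs, ?_⟩
  · apply lintegral_congr_ae
    filter_upwards [hfin] with x hx
    change ENNReal.ofReal ((s x).toReal ^ m) = s x ^ m
    rw [← ENNReal.ofReal_rpow_of_nonneg ENNReal.toReal_nonneg hm0.le, ENNReal.ofReal_toReal hx]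
  · filter_upwards [hfin, hmon'] with x hx hmo
    have h1 : Tendsto (fun n => ENNReal.ofReal (g n x)) atTop (𝓝 (s x)) := tendsto_atTop_iSup hmo
    refine ⟨?_, fun n => ?_⟩
    · refine ((ENNReal.tendsto_toReal hx).comp h1).congr fun n => ?_
      simp only [Function.comp, ENNReal.toReal_ofReal (h0 n x)]
    · rw [← ENNReal.toReal_ofReal (h0 n x)]
      exact ENNReal.toReal_mono hx (le_iSup (fun n => ENNReal.ofReal (g n x)) n)

lemma pow_le_one_add {p m s : ℝ} (hp : 0 ≤ p) (hpm : p ≤ m) (hs : 0 ≤ s) : s ^ p ≤ 1 + s ^ m := by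
  rcases le_total s 1 with h | h
  · have := Real.rpow_le_one hs h hp
    have := Real.rpow_nonneg hs m
    linarith
  · have := Real.rpow_le_rpow_of_exponent_le h hpm
    linarith

set_option maxHeartbeats 1000000 in
theorem abstract_existence [SigmaFinite μ] (j : Lp ℝ 2 μ →L[ℝ] V) {m p T κ : ℝ} (hp : 1 < p)
    (hpm : p < m) (hT : 0 < T) (hκ : 0 < κ) (A : ℕ → Lp ℝ 2 μ →L[ℝ] Lp ℝ 2 μ)
    (res : ∀ k, Res μ ((1/16) ^ k) κ (A k))
    (hj : ∀ k f g, inner ℝ (j (A k f)) (j g) = inner ℝ f g - (1/16) ^ k * inner ℝ (A k f) g)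
    {u0 : α → ℝ} (hu0 : Measurable u0) (h0 : ∀ x, 0 ≤ u0 x) (hi : Integrable (fun x => u0 x ^ m) μ) :
    ∃ u : α × ℝ → ℝ, Measurable u ∧ (∀ q, 0 ≤ u q) ∧
      (∃ K : ℝ, ∀ᵐ t ∂(volume.restrict (Ioo 0 T)),
        ∫⁻ x, ENNReal.ofReal (u (x, t) ^ m) ∂μ ≤ ENNReal.ofReal K) ∧
      ∀ M P Q S, Test j T M P Q S →
        (∫ t in Ioo 0 T, ∫ x, u (x, t) * Q t x ∂μ) - (∫ t in Ioo 0 T, ∫ x, u (x, t) ^ m * S t x ∂μ)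
          + (∫ t in Ioo 0 T, ∫ x, u (x, t) ^ p * P t x ∂μ) = - ∫ x, u0 x * P 0 x ∂μ := by
  have hm : 1 < m := hp.trans hpm
  have hm0 : 0 < m := by linarith
  obtain ⟨v, hv1, hv2, hv3⟩ := exists_data (μ := μ) hu0 h0
  choose U hU using fun (n k : ℕ) => exists_sol (T := T) (A k)
    (Ph_LZ (r := (n:ℝ)+1) hm.le (by positivity)) (Fr_LZ (p := p) (r := (n:ℝ)+1) hp.le (by positivity))
    hT.le (v n)
  have L : ∀ n : ℕ, Lev μ j m p ((n:ℝ)+1) T κ (v n) A (U n) := fun n =>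
    { hp := hp, hpm := hpm, hr := by simp, hT := hT, h0 := (hv1 n).mono fun x h => h.1,
      res := res, hj := hj, sol := hU n }
  choose W hWm hW using fun n => (L n).lim
  choose w hwm hw using fun n => joint_meas (hWm n)
  obtain ⟨C, hC0, hC⟩ := sol_unif (μ := μ) (T := T) hp hpm hκ
  set K := C * ∫ x, u0 x ^ m ∂μ
  have hgood : ∀ᵐ t ∂(volume.restrict (Ioo 0 T)), t ∈ Icc 0 T ∧
      ∀ n : ℕ, Tendsto (fun k => nem μ (Ph m ((n:ℝ)+1)) (U n k t)) atTop (𝓝 (W n t)) := by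
    filter_upwards [ae_all_iff.2 hW, ae_restrict_mem measurableSet_Ioo] with t h1 h2
    exact ⟨Ioo_subset_Icc_self h2, h1⟩
  set u : α × ℝ → ℝ := fun q => (⨆ n, ENNReal.ofReal (G m (w n q))).toReal
  have hu_m : Measurable u := by
    refine (Measurable.iSup fun n => ?_).ennreal_toReal
    exact ((G_cont hm).measurable.comp (hwm n)).ennreal_ofReal
  have hslice : ∀ᵐ t ∂(volume.restrict (Ioo 0 T)),
      ∫⁻ x, ENNReal.ofReal (u (x, t) ^ m) ∂μ ≤ ENNReal.ofReal K ∧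
      ∀ᵐ x ∂μ, (Tendsto (fun n => G m (W n t x)) atTop (𝓝 (u (x, t))) ∧
        ∀ n, G m (W n t x) ≤ u (x, t)) ∧ ∀ n, 0 ≤ W n t x := by
    filter_upwards [hgood] with t ⟨ht, hl⟩
    have := limit_slice (μ := μ) (K := K) (g := fun n x => G m (w n (x, t))) hm
      (fun n => (((G_cont hm).measurable.comp (hwm n)).comp measurable_prodMk_right).aemeasurable)
      (fun n x => G_nonneg _ _)
      (fun n => by
        have h1 := (L n).mono (L (n+1)) (by push_cast; linarith) (hv2 n) ht (hl n) (hl (n+1))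
        filter_upwards [h1, hw n t, hw (n+1) t] with x h1 h2 h3
        rw [h2, h3]; exact G_mono hm h1)
      (fun n => by
        have h1 := (L n).fatou ht (K := ENNReal.ofReal K) (fun k => by
          refine (hC _ (by simp) (v n) ((hv1 n).mono fun x h => h.1) ?_ _ _ _ (res k) (hU n k) t ht).trans ?_
          · refine hi.mono' ((Lp.aestronglyMeasurable (v n)).aemeasurable.pow_const m).aestronglyMeasurable ?_
            filter_upwards [hv1 n] with x hx
            rw [Real.norm_of_nonneg (Real.rpow_nonneg hx.1.1 _)]
            exact Real.rpow_le_rpow hx.1.1 hx.2 hm0.le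
          · apply ENNReal.ofReal_le_ofReal
            apply mul_le_mul_of_nonneg_left _ hC0
            apply integral_mono_of_nonneg ?_ hi ?_
            · filter_upwards [hv1 n] with x hx using Real.rpow_nonneg hx.1.1 _
            · filter_upwards [hv1 n] with x hx
              exact Real.rpow_le_rpow hx.1.1 hx.2 hm0.le) (hl n)
        refine le_trans (le_of_eq (lintegral_congr_ae ?_)) h1
        filter_upwards [hw n t] with x h2
        rw [h2])
    refine ⟨this.1, ?_⟩
    filter_upwards [this.2, ae_all_iff.2 fun n => hw n t,
      ae_all_iff.2 fun n => (L n).nonneg ht (hl n)] with x h1 h2 h3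
    simp only [h2] at h1
    refine ⟨?_, h3⟩
    have e : u (x, t) = (⨆ n, ENNReal.ofReal (G m (W n t x))).toReal := by simp only [u, h2]
    rw [e]; exact h1
  have hK0 : 0 ≤ K := mul_nonneg hC0 (integral_nonneg fun x => Real.rpow_nonneg (h0 x) _)
  have hu0' : ∀ q, 0 ≤ u q := fun q => ENNReal.toReal_nonneg
  refine ⟨u, hu_m, hu0', ⟨K, hslice.mono fun t h => h.1⟩, ?_⟩
  intro M P Q S ht
  have hb : ∀ᵐ t ∂(volume.restrict (Ioo 0 T)), Integrable (fun x => u (x, t) ^ m) μ ∧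
      ∫ x, u (x, t) ^ m ∂μ ≤ K := by
    filter_upwards [hslice] with t h
    have hme : AEStronglyMeasurable (fun x => u (x, t) ^ m) μ :=
      ((hu_m.comp measurable_prodMk_right).pow_const m).aestronglyMeasurable
    have hnn : 0 ≤ᵐ[μ] fun x => u (x, t) ^ m := ae_of_all _ fun x => Real.rpow_nonneg (hu0' _) _
    refine ⟨(lintegral_ofReal_ne_top_iff_integrable hme hnn).1
      (ne_top_of_le_ne_top ENNReal.ofReal_ne_top h.1), ?_⟩
    rw [integral_eq_lintegral_of_nonneg_ae hnn hme]
    exact ENNReal.toReal_le_of_le_ofReal hK0 h.1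
  have wk := fun n => (L n).weak (hW n) ht
  have t1 : Tendsto (fun n => ∫ t in Ioo 0 T, ∫ x, G m (W n t x) * Q t x ∂μ) atTop
      (𝓝 (∫ t in Ioo 0 T, ∫ x, u (x, t) * Q t x ∂μ)) := by
    refine dct2 (g := fun n t x => G m (W n t x)) (z := fun t x => u (x, t))
      (b := fun t x => u (x, t) ^ m) ht.iQ (fun n => (wk n).1) (K := K) ?_
    filter_upwards [hslice, hb] with t h1 h2
    refine ⟨fun n => (G_cont hm).comp_aestronglyMeasurable (Lp.aestronglyMeasurable _), h2.1, h2.2, ?_⟩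
    filter_upwards [h1.2] with x hx
    refine ⟨fun n => ?_, Real.rpow_nonneg (hu0' _) _, hx.1.1⟩
    rw [abs_of_nonneg (G_nonneg _ _)]
    refine (hx.1.2 n).trans ?_
    simpa using pow_le_one_add zero_le_one hm.le (hu0' (x, t))
  have t2 : Tendsto (fun n => ∫ t in Ioo 0 T, ∫ x, W n t x * S t x ∂μ) atTop
      (𝓝 (∫ t in Ioo 0 T, ∫ x, u (x, t) ^ m * S t x ∂μ)) := by
    refine dct2 (g := fun n t x => W n t x) (z := fun t x => u (x, t) ^ m)
      (b := fun t x => u (x, t) ^ m) ht.iS (fun n => (wk n).2.1) (K := K) ?_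
    filter_upwards [hslice, hb] with t h1 h2
    refine ⟨fun n => Lp.aestronglyMeasurable _, h2.1, h2.2, ?_⟩
    filter_upwards [h1.2] with x hx
    refine ⟨fun n => ?_, Real.rpow_nonneg (hu0' _) _, ?_⟩
    · rw [abs_of_nonneg (hx.2 n), ← G_pow hm (hx.2 n)]
      have := Real.rpow_le_rpow (G_nonneg m _) (hx.1.2 n) hm0.le
      linarith
    · refine (hx.1.1.rpow_const (Or.inr hm0.le)).congr fun n => ?_
      exact G_pow hm (hx.2 n)
  have t3 : Tendsto (fun n : ℕ => ∫ t in Ioo 0 T, ∫ x, Fr p ((n:ℝ)+1) (G m (W n t x)) * P t x ∂μ) atTop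
      (𝓝 (∫ t in Ioo 0 T, ∫ x, u (x, t) ^ p * P t x ∂μ)) := by
    refine dct2 (g := fun n t x => Fr p ((n:ℝ)+1) (G m (W n t x))) (z := fun t x => u (x, t) ^ p)
      (b := fun t x => u (x, t) ^ m) ht.iP (fun n => (wk n).2.2.1) (K := K) ?_
    filter_upwards [hslice, hb] with t h1 h2
    refine ⟨fun n => ((L n).zF.continuous.comp (G_cont hm)).comp_aestronglyMeasurable
      (Lp.aestronglyMeasurable _), h2.1, h2.2, ?_⟩
    filter_upwards [h1.2] with x hx
    refine ⟨fun n => ?_, Real.rpow_nonneg (hu0' _) _, ?_⟩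
    · rw [abs_of_nonneg (Fr_nonneg (L n).hr0 _)]
      refine (Fr_le _).trans ?_
      rw [max_eq_left (G_nonneg _ _)]
      exact (Real.rpow_le_rpow (G_nonneg _ _) (hx.1.2 n) (by linarith)).trans
        (pow_le_one_add (by linarith) hpm.le (hu0' (x, t)))
    · refine Fr_tendsto hp.le hx.1.1 ?_ fun n => G_nonneg _ _
      exact tendsto_atTop_add_const_right _ _ tendsto_natCast_atTop_atTop
  have iP0 := ht.iP 0 ⟨le_rfl, hT.le⟩
  have t4 : Tendsto (fun n => - inner ℝ (v n) (P 0)) atTop (𝓝 (- ∫ x, u0 x * P 0 x ∂μ)) := by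
    refine Tendsto.neg ?_
    simp_rw [inner_eq]
    refine tendsto_integral_of_dominated_convergence (fun x => |P 0 x| + M * u0 x ^ m) (fun n => ?_)
      (iP0.1.abs.add (hi.const_mul M)) (fun n => ?_) ?_
    · exact (int_mul _ _).aestronglyMeasurable
    · filter_upwards [hv1 n, iP0.2.2] with x h1 h2
      rw [norm_mul, Real.norm_of_nonneg h1.1.1, Real.norm_eq_abs]
      have h3 : v n x ≤ 1 + u0 x ^ m := h1.2.trans (by
        simpa using pow_le_one_add zero_le_one hm.le (h0 x))
      have h4 := Real.rpow_nonneg (h0 x) m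
      calc _ ≤ (1 + u0 x ^ m) * |P 0 x| := by gcongr
        _ ≤ _ := by nlinarith
    · filter_upwards [hv3] with x hx
      exact hx.mul_const _
  have t5 := (t1.sub t2).add t3
  exact tendsto_nhds_unique (t5.congr fun n => (wk n).2.2.2) t4

end VW


namespace VW
open Set Filter Topology
open scoped NNReal ENNReal

variable {α : Type*} [MeasurableSpace α] {μ : Measure α}
  {H : Type*} [NormedAddCommGroup H] [InnerProductSpace ℝ H] [CompleteSpace H]

lemma exists_res (ι : H →L[ℝ] Lp ℝ 2 μ) {D : Type*} (gr : D → H) (em : D → Lp ℝ 2 μ)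
    (hd : DenseRange gr) (he : ∀ φ, ι (gr φ) = em φ)
    (tr : ∀ (c δ : ℝ), 0 ≤ c → 0 < δ → ∀ φ, ∃ ψ, ‖gr ψ‖ ≤ ‖gr φ‖ ∧ ∀ᵐ x ∂μ, em ψ x ≤ c + δ ∧
      ∀ v ≤ c, |em ψ x - v| ≤ |em φ x - v|)
    {ε : ℝ} (h0 : 0 < ε) (h1 : ε ≤ 1) :
    ∃ A : Lp ℝ 2 μ →L[ℝ] Lp ℝ 2 μ,
      Res μ ε (1 / (‖ContinuousLinearMap.adjoint ι‖ ^ 2 + 1)) A ∧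
      ∀ f g, inner ℝ (ContinuousLinearMap.adjoint ι (A f)) (ContinuousLinearMap.adjoint ι g)
        = inner ℝ f g - ε * inner ℝ (A f) g := by
  set j := ContinuousLinearMap.adjoint ι with hj
  let B : Lp ℝ 2 μ →L[ℝ] Lp ℝ 2 μ →L[ℝ] ℝ :=
    (innerSL ℝ).bilinearComp j j + ε • innerSL ℝ
  have hB : ∀ f g, B f g = inner ℝ (j f) (j g) + ε * inner ℝ f g := fun f g => by
    simp only [B, ContinuousLinearMap.add_apply, ContinuousLinearMap.smul_apply, smul_eq_mul,
      ContinuousLinearMap.bilinearComp_apply]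
    rfl
  have hc : IsCoercive B := by
    refine ⟨ε, h0, fun u => ?_⟩
    rw [hB, real_inner_self_eq_norm_sq, real_inner_self_eq_norm_sq]
    nlinarith [sq_nonneg ‖j u‖]
  let E := hc.continuousLinearEquivOfBilin
  let A : Lp ℝ 2 μ →L[ℝ] Lp ℝ 2 μ := E.symm
  have hA : ∀ f g, inner ℝ (j (A f)) (j g) + ε * inner ℝ (A f) g = inner ℝ f g := by
    intro f g
    rw [← hB, ← hc.continuousLinearEquivOfBilin_apply]
    congr 1
    exact E.apply_symm_apply f
  have hι : ∀ f, ι (j (A f)) = f - ε • A f := by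
    intro f
    refine ext_inner_right ℝ fun g => ?_
    rw [← ContinuousLinearMap.adjoint_inner_right, inner_sub_left, real_inner_smul_left, ← hA f g]
    ring
  have hAA : ∀ f, inner ℝ (A f) f = ‖j (A f)‖ ^ 2 + ε * ‖A f‖ ^ 2 := by
    intro f
    rw [real_inner_comm, ← hA f (A f), real_inner_self_eq_norm_sq, real_inner_self_eq_norm_sq]
  refine ⟨A, ⟨h0, ?_, ?_, ?_, ?_⟩, fun f g => by linarith [hA f g]⟩
  · intro f g
    have e1 := hA g (A f)
    have e2 := hA f (A g)
    rw [real_inner_comm, ← e1, ← e2, real_inner_comm (j (A f)), real_inner_comm (A f)]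
  · intro f
    have e := hA f f
    have l1 : inner ℝ (j (A f)) (j f) ≤ ‖j (A f)‖ * (‖j‖ * ‖f‖) :=
      (real_inner_le_norm _ _).trans (by gcongr; exact j.le_opNorm f)
    have l2 : inner ℝ (A f) f ≤ ‖A f‖ * ‖f‖ := real_inner_le_norm _ _
    rw [real_inner_self_eq_norm_sq] at e
    rw [hAA, div_mul_eq_mul_div, one_mul, div_le_iff₀ (by positivity)]
    set a := ‖j (A f)‖
    set b := ‖A f‖
    set J := ‖j‖
    set n := ‖f‖
    have a0 : 0 ≤ a := norm_nonneg _
    have b0 : 0 ≤ b := norm_nonneg _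
    have n0 : 0 ≤ n := norm_nonneg _
    have J0 : 0 ≤ J := norm_nonneg _
    rcases eq_or_lt_of_le n0 with h | h
    · rw [← h]; simp; positivity
    have l3 : n ≤ a * J + ε * b := by
      have : n * n ≤ (a * J + ε * b) * n := by nlinarith [mul_le_mul_of_nonneg_left l2 h0.le]
      exact le_of_mul_le_mul_right this h
    have l4 : n ^ 2 ≤ (a * J + ε * b) ^ 2 := by gcongr
    have l5 : (a * J + ε * b) ^ 2 ≤ (a ^ 2 + ε * b ^ 2) * (J ^ 2 + ε) := by
      nlinarith [mul_nonneg h0.le (sq_nonneg (a - J * b))]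
    have l6 : (a ^ 2 + ε * b ^ 2) * (J ^ 2 + ε) ≤ (a ^ 2 + ε * b ^ 2) * (J ^ 2 + 1) := by gcongr
    linarith
  · intro f
    rw [hAA]; nlinarith [sq_nonneg ‖j (A f)‖]
  · intro v c hc0 hv
    set a := A v
    set h := j a with hh
    have hιh : ι h = v - ε • a := hι v
    rw [← hιh]
    have key : ∀ w, ‖ι w - ι h‖ ^ 2 ≤ (ε * ‖w‖ ^ 2 + ‖ι w - v‖ ^ 2) - (ε * ‖h‖ ^ 2 + ‖ι h - v‖ ^ 2) := by
      intro w
      have e1 : ι w - v = (ι w - ι h) - ε • a := by rw [hιh]; abel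
      have e2 : ι h - v = - (ε • a) := by rw [hιh]; abel
      have e3 : w = (w - h) + h := by abel
      have e4 : inner ℝ (ι w - ι h) a = inner ℝ (w - h) h := by
        rw [← map_sub, hh, ContinuousLinearMap.adjoint_inner_right]
      have e5 : ‖w‖ ^ 2 = ‖w - h‖ ^ 2 + 2 * inner ℝ (w - h) h + ‖h‖ ^ 2 := by
        conv_lhs => rw [e3]
        exact norm_add_sq_real _ _
      rw [e1, e2, norm_neg, norm_sub_sq_real (ι w - ι h), real_inner_smul_right, e4, e5]
      nlinarith [mul_nonneg h0.le (sq_nonneg ‖w - h‖)]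
    have main : ∀ δ : ℝ, 0 < δ → ∀ᵐ x ∂μ, ι h x ≤ c + δ := by
      intro δ hδ
      obtain ⟨φ, hφ⟩ : ∃ φ : ℕ → D, Tendsto (fun n => gr (φ n)) atTop (𝓝 h) := by
        obtain ⟨s, hs, hs2⟩ := mem_closure_iff_seq_limit.1 (hd h)
        choose φ hφ using hs
        exact ⟨φ, by simpa only [hφ] using hs2⟩
      choose ψ hψ using fun n => tr c δ hc0 hδ (φ n)
      have cmp : ∀ n, ‖ι (gr (ψ n)) - v‖ ≤ ‖ι (gr (φ n)) - v‖ := by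
        intro n
        rw [he, he]
        refine Lp.norm_le_norm_of_ae_le ?_
        filter_upwards [(hψ n).2, hv, Lp.coeFn_sub (em (ψ n)) v, Lp.coeFn_sub (em (φ n)) v]
          with x a1 a2 a3 a4
        rw [a3, a4]
        exact a1.2 _ a2
      have t1 : Tendsto (fun n => (ε * ‖gr (φ n)‖ ^ 2 + ‖ι (gr (φ n)) - v‖ ^ 2)
          - (ε * ‖h‖ ^ 2 + ‖ι h - v‖ ^ 2)) atTop (𝓝 0) := by
        have : Tendsto (fun n => (ε * ‖gr (φ n)‖ ^ 2 + ‖ι (gr (φ n)) - v‖ ^ 2)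
          - (ε * ‖h‖ ^ 2 + ‖ι h - v‖ ^ 2)) atTop (𝓝 ((ε * ‖h‖ ^ 2 + ‖ι h - v‖ ^ 2)
          - (ε * ‖h‖ ^ 2 + ‖ι h - v‖ ^ 2))) :=
          (((hφ.norm.pow 2).const_mul ε).add
            (((((ι.continuous.tendsto h).comp hφ).sub_const v).norm).pow 2)).sub_const _
        simpa using this
      have t2 : Tendsto (fun n => ‖ι (gr (ψ n)) - ι h‖ ^ 2) atTop (𝓝 0) := by
        refine squeeze_zero (fun n => by positivity) (fun n => (key _).trans ?_) t1
        have := (hψ n).1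
        have := cmp n
        gcongr
      have t3 : Tendsto (fun n => em (ψ n)) atTop (𝓝 (ι h)) := by
        rw [tendsto_iff_norm_sub_tendsto_zero]
        have := t2.sqrt
        simpa [he, Real.sqrt_sq] using this
      obtain ⟨k, _, hk⟩ := exists_subseq_ae t3
      filter_upwards [hk, ae_all_iff.2 fun n => (hψ n).2] with x b1 b2
      exact le_of_tendsto' b1 fun n => (b2 _).1
    have := ae_all_iff.2 fun n : ℕ => main (1 / ((n : ℝ) + 1)) (by positivity)
    filter_upwards [this] with x hx
    have l : Tendsto (fun n : ℕ => c + 1 / ((n : ℝ) + 1)) atTop (𝓝 (c + 0)) :=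
      tendsto_one_div_add_atTop_nhds_zero_nat.const_add c
    rw [add_zero] at l
    exact ge_of_tendsto' l hx

lemma exist_adj [SigmaFinite μ] (ι : H →L[ℝ] Lp ℝ 2 μ) {D : Type*} (gr : D → H) (em : D → Lp ℝ 2 μ)
    (hd : DenseRange gr) (he : ∀ φ, ι (gr φ) = em φ)
    (tr : ∀ (c δ : ℝ), 0 ≤ c → 0 < δ → ∀ φ, ∃ ψ, ‖gr ψ‖ ≤ ‖gr φ‖ ∧ ∀ᵐ x ∂μ, em ψ x ≤ c + δ ∧
      ∀ v ≤ c, |em ψ x - v| ≤ |em φ x - v|)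
    {m p T : ℝ} (hp : 1 < p) (hpm : p < m) (hT : 0 < T)
    {u0 : α → ℝ} (hu0 : Measurable u0) (h0 : ∀ x, 0 ≤ u0 x)
    (hi : Integrable (fun x => u0 x ^ m) μ) : ∃ u : α × ℝ → ℝ, Measurable u ∧ (∀ q, 0 ≤ u q) ∧
      (∃ K : ℝ, ∀ᵐ t ∂(volume.restrict (Ioo 0 T)),
        ∫⁻ x, ENNReal.ofReal (u (x,t)^m) ∂μ ≤ ENNReal.ofReal K) ∧
      ∀ M P Q S, Test (ContinuousLinearMap.adjoint ι) T M P Q S →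
        (∫ t in Ioo 0 T, ∫ x, u (x,t) * Q t x ∂μ)
          - (∫ t in Ioo 0 T, ∫ x, u (x,t)^m * S t x ∂μ)
          + (∫ t in Ioo 0 T, ∫ x, u (x,t)^p * P t x ∂μ) = - ∫ x, u0 x * P 0 x ∂μ := by
  have ex := fun k : ℕ => exists_res ι gr em hd he tr (ε := (1/16)^k)
    (by positivity) (pow_le_one₀ (by norm_num) (by norm_num))
  choose A hA hj using ex
  exact abstract_existence (ContinuousLinearMap.adjoint ι) hp hpm hT
    (by positivity) A hA hj hu0 h0 hi

end VW


namespace VW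
open Set Filter Topology
open scoped NNReal ENNReal ContDiff

lemma exists_trunc {c δ : ℝ} (hc : 0 ≤ c) (hδ : 0 < δ) : ∃ τ : ℝ → ℝ, ContDiff ℝ ∞ τ ∧ τ 0 = 0 ∧
    (∀ s, |deriv τ s| ≤ 1) ∧ (∀ s, τ s ≤ c + δ) ∧ ∀ s, ∀ v ≤ c, |τ s - v| ≤ |s - v| := by
  let χ : ℝ → ℝ := fun s => 1 - Real.smoothTransition ((s - c) / δ)
  have cχ : ContDiff ℝ ∞ χ :=
    contDiff_const.sub ((Real.smoothTransition.contDiff (n := ⊤)).comp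
      ((contDiff_id.sub contDiff_const).div_const δ))
  have χ0 : ∀ s, 0 ≤ χ s := fun s => sub_nonneg.2 (Real.smoothTransition.le_one _)
  have χ1 : ∀ s, χ s ≤ 1 := fun s => sub_le_self _ (Real.smoothTransition.nonneg _)
  have χc : ∀ s ≤ c, χ s = 1 := fun s hs => by
    simp only [χ]
    rw [Real.smoothTransition.zero_of_nonpos (div_nonpos_of_nonpos_of_nonneg (by linarith) hδ.le)]
    simp
  have χd : ∀ s, c + δ ≤ s → χ s = 0 := fun s hs => by
    simp only [χ]
    rw [Real.smoothTransition.one_of_one_le ((one_le_div hδ).2 (by linarith))]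
    simp
  have ii : ∀ a b, IntervalIntegrable χ volume a b := fun a b => cχ.continuous.intervalIntegrable a b
  let τ : ℝ → ℝ := fun s => ∫ r in (0:ℝ)..s, χ r
  have hd : ∀ s, HasDerivAt τ (χ s) s := fun s => cχ.continuous.integral_hasStrictDerivAt 0 s |>.hasDerivAt
  have hdτ : deriv τ = χ := funext fun s => (hd s).deriv
  have low : ∀ s ≤ c, τ s = s := by
    intro s hs
    have : τ s = ∫ r in (0:ℝ)..s, (1:ℝ) := by
      refine intervalIntegral.integral_congr fun r hr => χc r ?_
      rw [mem_uIcc] at hr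
      rcases hr with h | h <;> linarith [h.1, h.2]
    simpa using this
  have step : ∀ a b, a ≤ b → τ a ≤ τ b ∧ τ b ≤ τ a + (b - a) := by
    intro a b hab
    have e : τ a + ∫ r in a..b, χ r = τ b := intervalIntegral.integral_add_adjacent_intervals (ii _ _) (ii _ _)
    have l1 : 0 ≤ ∫ r in a..b, χ r := intervalIntegral.integral_nonneg hab fun r _ => χ0 r
    have l2 : ∫ r in a..b, χ r ≤ ∫ r in a..b, (1:ℝ) :=
      intervalIntegral.integral_mono_on hab (ii _ _) (by simp) fun r _ => χ1 r
    simp at l2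
    constructor <;> linarith
  have up : ∀ s, c ≤ s → c ≤ τ s ∧ τ s ≤ s := by
    intro s hs
    have := step c s hs
    rw [low c le_rfl] at this
    constructor <;> linarith [this.1, this.2]
  refine ⟨τ, contDiff_infty_iff_deriv.2 ⟨fun s => (hd s).differentiableAt, hdτ ▸ cχ⟩, by simp [τ],
    fun s => ?_, fun s => ?_, fun s v hv => ?_⟩
  · rw [hdτ, abs_of_nonneg (χ0 s)]; exact χ1 s
  · rcases le_total s (c + δ) with h | h
    · rcases le_total s c with h' | h'
      · rw [low s h']; linarith
      · linarith [(up s h').2]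
    · have e : τ (c + δ) + ∫ r in (c + δ)..s, χ r = τ s :=
        intervalIntegral.integral_add_adjacent_intervals (ii _ _) (ii _ _)
      have z : ∫ r in (c + δ)..s, χ r = ∫ r in (c+δ)..s, (0:ℝ) := by
        refine intervalIntegral.integral_congr fun r hr => χd r ?_
        rw [uIcc_of_le h] at hr
        exact hr.1
      simp at z
      linarith [(up (c + δ) (by linarith)).2]
  · rcases le_total s c with h | h
    · rw [low s h]
    · have := up s h
      rw [abs_of_nonneg (by linarith), abs_of_nonneg (by linarith)]
      linarith

/-- Euclidean space. -/
abbrev Eu (N : ℕ) := EuclideanSpace ℝ (Fin N)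

section
variable {N : ℕ}

/-- The weighted measure. -/
noncomputable def wt (ρ : Eu N → ℝ) : Measure (Eu N) :=
  (volume : Measure (Eu N)).withDensity fun x => ENNReal.ofReal (ρ x)

variable {ρ : Eu N → ℝ}

lemma integral_wt (hρ : Continuous ρ) (hp : ∀ x, 0 < ρ x) (f : Eu N → ℝ) :
    ∫ x, f x ∂(wt ρ) = ∫ x, f x * ρ x := by
  rw [wt, integral_withDensity_eq_integral_toReal_smul hρ.measurable.ennreal_ofReal
    (ae_of_all _ fun x => ENNReal.ofReal_lt_top)]
  refine integral_congr_ae (ae_of_all _ fun x => ?_)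
  simp [ENNReal.toReal_ofReal (hp x).le, mul_comm]

lemma integrable_wt (hρ : Continuous ρ) (hp : ∀ x, 0 < ρ x) (f : Eu N → ℝ) :
    Integrable f (wt ρ) ↔ Integrable (fun x => f x * ρ x) := by
  rw [wt, integrable_withDensity_iff hρ.measurable.ennreal_ofReal
    (ae_of_all _ fun x => ENNReal.ofReal_lt_top)]
  simp [ENNReal.toReal_ofReal (hp _).le]

lemma lf_wt (hρ : Continuous ρ) : IsLocallyFiniteMeasure (wt ρ) :=
  IsLocallyFiniteMeasure.withDensity_ofReal hρ

/-- The gradient. -/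
noncomputable def gd (f : Eu N → ℝ) (x : Eu N) : (Eu N) := (InnerProductSpace.toDual ℝ (Eu N)).symm (fderiv ℝ f x)

lemma norm_gd (f : Eu N → ℝ) (x : Eu N) : ‖gd f x‖ = ‖fderiv ℝ f x‖ := LinearIsometryEquiv.norm_map _ _

lemma inner_gd (f : Eu N → ℝ) (x y : Eu N) : inner ℝ (gd f x) y = fderiv ℝ f x y := by
  simp [gd, InnerProductSpace.toDual_symm_apply]

lemma continuous_gd {f : Eu N → ℝ} (hf : ContDiff ℝ ∞ f) : Continuous (gd f) :=
  (LinearIsometryEquiv.continuous _).comp (hf.continuous_fderiv (by simp))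

lemma supp_gd {f : Eu N → ℝ} (hf : HasCompactSupport f) : HasCompactSupport (gd f) :=
  (hf.fderiv ℝ).comp_left (map_zero _)

lemma inner_gd_gd (f g : Eu N → ℝ) (x : Eu N) : inner ℝ (gd f x) (gd g x)
    = ∑ i : Fin N, fderiv ℝ f x (EuclideanSpace.single i 1) * fderiv ℝ g x (EuclideanSpace.single i 1) := by
  rw [← (EuclideanSpace.basisFun (Fin N) ℝ).sum_inner_mul_inner]
  refine Finset.sum_congr rfl fun i _ => ?_
  rw [inner_gd, real_inner_comm, inner_gd, EuclideanSpace.basisFun_apply]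

lemma lap_eq {f : Eu N → ℝ} (hf : ContDiff ℝ ∞ f) (x : Eu N) : lap f x =
    ∑ i : Fin N, fderiv ℝ (fun y => fderiv ℝ f y (EuclideanSpace.single i 1)) x
      (EuclideanSpace.single i 1) := by
  refine Finset.sum_congr rfl fun i _ => ?_
  set e : (Eu N) := EuclideanSpace.single i 1
  have hl : ∀ t : ℝ, HasDerivAt (fun t : ℝ => x + t • e) e t := fun t => by
    simpa using ((hasDerivAt_id t).smul_const e).const_add x
  have h1 : (deriv fun t : ℝ => f (x + t • e)) = fun t => fderiv ℝ f (x + t • e) e := by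
    funext t
    exact ((hf.differentiable (by simp) _).hasFDerivAt.comp_hasDerivAt t (hl t)).deriv
  rw [h1]
  have h2 : ContDiff ℝ ∞ (fun y => fderiv ℝ f y e) := (hf.fderiv_right (by simp)).clm_apply contDiff_const
  have h3 := ((h2.differentiable (by simp) (x + (0:ℝ) • e)).hasFDerivAt.comp_hasDerivAt 0 (hl 0)).deriv
  simpa [Function.comp_def] using h3

lemma green {f g : Eu N → ℝ} (hf : ContDiff ℝ ∞ f) (sf : HasCompactSupport f) (hg : ContDiff ℝ ∞ g)
    (sg : HasCompactSupport g) : ∫ x, inner ℝ (gd f x) (gd g x) = ∫ x, - lap f x * g x := by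
  have sm : ∀ i, ContDiff ℝ ∞ (fun y => fderiv ℝ f y (EuclideanSpace.single i 1)) := fun i =>
    (hf.fderiv_right (by simp)).clm_apply contDiff_const
  have c2 : ∀ i, Continuous fun x => fderiv ℝ (fun y => fderiv ℝ f y (EuclideanSpace.single i 1)) x
      (EuclideanSpace.single i 1) := fun i => ((sm i).continuous_fderiv (by simp)).clm_apply continuous_const
  have c1 : ∀ i, Continuous fun x => fderiv ℝ g x (EuclideanSpace.single i 1) := fun i =>
    (hg.continuous_fderiv (by simp)).clm_apply continuous_const
  have sd : ∀ i, HasCompactSupport fun x => fderiv ℝ g x (EuclideanSpace.single i 1) := fun i =>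
    sg.fderiv_apply (𝕜 := ℝ) _
  have i1 : ∀ i, Integrable fun x => fderiv ℝ f x (EuclideanSpace.single i 1) *
      fderiv ℝ g x (EuclideanSpace.single i 1) := fun i =>
    ((sm i).continuous.mul (c1 i)).integrable_of_hasCompactSupport ((sd i).mul_left)
  have i2 : ∀ i, Integrable fun x => fderiv ℝ (fun y => fderiv ℝ f y (EuclideanSpace.single i 1)) x
      (EuclideanSpace.single i 1) * g x := fun i =>
    ((c2 i).mul hg.continuous).integrable_of_hasCompactSupport sg.mul_left
  simp_rw [inner_gd_gd, lap_eq hf, neg_mul, Finset.sum_mul]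
  rw [integral_neg, integral_finsetSum _ fun i _ => i1 i, integral_finsetSum _ fun i _ => i2 i,
    ← Finset.sum_neg_distrib]
  refine Finset.sum_congr rfl fun i _ => ?_
  exact integral_mul_fderiv_eq_neg_fderiv_mul_of_integrable (i2 i) (i1 i)
    (((sm i).continuous.mul hg.continuous).integrable_of_hasCompactSupport sg.mul_left)
    (fun x _ => (sm i).differentiable (by simp) x) (fun x _ => hg.differentiable (by simp) x)

end
end VW


namespace VW
open Set Filter Topology
open scoped NNReal ENNReal ContDiff

section
variable {N : ℕ}

/-- Test functions in space. -/
def Ds (N : ℕ) : Submodule ℝ (Eu N → ℝ) where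
  carrier := {f | ContDiff ℝ ∞ f ∧ HasCompactSupport f}
  add_mem' := fun h k => ⟨h.1.add k.1, h.2.add k.2⟩
  zero_mem' := ⟨contDiff_const, HasCompactSupport.zero⟩
  smul_mem' := fun c _ h => ⟨contDiff_const.smul h.1, h.2.smul_left (f := fun _ => c)⟩

lemma memLp_gd (v : Ds N) : MemLp (gd (v : Eu N → ℝ)) 2 volume :=
  (continuous_gd v.2.1).memLp_of_hasCompactSupport (supp_gd v.2.2)

/-- The gradient map. -/
noncomputable def grL (N : ℕ) : Ds N →ₗ[ℝ] Lp (Eu N) 2 (volume : Measure (Eu N)) where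
  toFun v := (memLp_gd v).toLp _
  map_add' v w := by
    rw [← MemLp.toLp_add, MemLp.toLp_eq_toLp_iff]
    refine ae_of_all _ fun x => ?_
    have := fderiv_add (v.2.1.differentiable (by simp) x) (w.2.1.differentiable (by simp) x)
    simp only [gd, Submodule.coe_add, Pi.add_apply, this, map_add]
  map_smul' c v := by
    rw [RingHom.id_apply, ← MemLp.toLp_const_smul, MemLp.toLp_eq_toLp_iff]
    refine ae_of_all _ fun x => ?_
    have := fderiv_const_smul (v.2.1.differentiable (by simp) x) c
    simp only [gd, Submodule.coe_smul, Pi.smul_apply, this, map_smul]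

lemma memLp_v {ρ : Eu N → ℝ} (hρ : Continuous ρ) (v : Ds N) : MemLp (v : Eu N → ℝ) 2 (wt ρ) :=
  haveI := lf_wt hρ
  v.2.1.continuous.memLp_of_hasCompactSupport v.2.2

/-- The embedding. -/
noncomputable def emL {ρ : Eu N → ℝ} (hρ : Continuous ρ) : Ds N →ₗ[ℝ] Lp ℝ 2 (wt ρ) where
  toFun v := (memLp_v hρ v).toLp _
  map_add' v w := by
    rw [← MemLp.toLp_add]; rfl
  map_smul' c v := by
    rw [RingHom.id_apply, ← MemLp.toLp_const_smul]; rfl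

/-- The energy space. -/
noncomputable def HH (N : ℕ) : Submodule ℝ (Lp (Eu N) 2 (volume : Measure (Eu N))) :=
  (LinearMap.range (grL N)).topologicalClosure

instance : CompleteSpace (HH N) := (Submodule.isClosed_topologicalClosure _).completeSpace_coe

/-- The gradient map into the energy space. -/
noncomputable def grH (N : ℕ) : Ds N →ₗ[ℝ] HH N :=
  (grL N).codRestrict (HH N) fun v => Submodule.le_topologicalClosure _ (LinearMap.mem_range_self _ v)

lemma dense_grH : DenseRange (grH N) := by
  intro h
  rw [closure_subtype]
  have e : ((↑) : HH N → Lp (Eu N) 2 (volume : Measure (Eu N))) '' range (grH N) = range (grL N) := by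
    rw [← range_comp]; rfl
  rw [e]
  exact h.2

lemma inner_grH (v w : Ds N) : inner ℝ (grH N v) (grH N w) =
    ∫ x, inner ℝ (gd (v : Eu N → ℝ) x) (gd (w : Eu N → ℝ) x) := by
  change inner ℝ (grL N v) (grL N w) = _
  rw [L2.inner_def]
  refine integral_congr_ae ?_
  filter_upwards [(memLp_gd v).coeFn_toLp, (memLp_gd w).coeFn_toLp] with x h1 h2
  change inner ℝ ((memLp_gd v).toLp _ x) ((memLp_gd w).toLp _ x) = _
  rw [h1, h2]

lemma emc {ρ : Eu N → ℝ} (hρ : Continuous ρ) (v : Ds N) : emL hρ v =ᵐ[wt ρ] v :=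
  (memLp_v hρ v).coeFn_toLp

lemma exists_iota {Cp : ℝ} {ρ : Eu N → ℝ} (hρ : Continuous ρ) (hρp : ∀ x, 0 < ρ x)
    (hPo : ∀ v : Eu N → ℝ, ContDiff ℝ ∞ v → HasCompactSupport v →
      (∫ x, v x ^ 2 * ρ x) ^ ((1 : ℝ) / 2) ≤
        Cp⁻¹ * (∫ x, ‖fderiv ℝ v x‖ ^ 2) ^ ((1 : ℝ) / 2)) :
    ∃ ι : HH N →L[ℝ] Lp ℝ 2 (wt ρ), ∀ v, ι (grH N v) = emL hρ v := by
  have nem : ∀ v : Ds N, ‖emL hρ v‖ ^ 2 = ∫ x, (v : Eu N → ℝ) x ^ 2 * ρ x := by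
    intro v
    rw [norm_sq, ← integral_wt hρ hρp]
    refine integral_congr_ae ?_
    filter_upwards [emc hρ v] with x hx
    rw [hx]
  have ngr : ∀ v : Ds N, ‖grH N v‖ ^ 2 = ∫ x, ‖fderiv ℝ (v : Eu N → ℝ) x‖ ^ 2 := by
    intro v
    rw [← real_inner_self_eq_norm_sq, inner_grH]
    simp_rw [real_inner_self_eq_norm_sq, norm_gd]
  have bd : ∃ C, ∀ v, ‖emL hρ v‖ ≤ C * ‖grH N v‖ := by
    refine ⟨Cp⁻¹, fun v => ?_⟩
    have := hPo v v.2.1 v.2.2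
    rwa [← nem, ← ngr, ← Real.sqrt_eq_rpow, ← Real.sqrt_eq_rpow, Real.sqrt_sq (norm_nonneg _),
      Real.sqrt_sq (norm_nonneg _)] at this
  exact ⟨(emL hρ).extendOfNorm (grH N), LinearMap.extendOfNorm_eq dense_grH bd⟩

lemma tr {ρ : Eu N → ℝ} (hρ : Continuous ρ) (c δ : ℝ) (hc : 0 ≤ c) (hδ : 0 < δ) (φ : Ds N) :
    ∃ ψ, ‖grH N ψ‖ ≤ ‖grH N φ‖ ∧
      ∀ᵐ x ∂(wt ρ), emL hρ ψ x ≤ c + δ ∧ ∀ v ≤ c, |emL hρ ψ x - v| ≤ |emL hρ φ x - v| := by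
  obtain ⟨τ, t1, t2, t3, t4, t5⟩ := exists_trunc hc hδ
  let ψ : Ds N := ⟨fun x => τ ((φ : Eu N → ℝ) x), t1.comp φ.2.1, φ.2.2.comp_left t2⟩
  refine ⟨ψ, ?_, ?_⟩
  · change ‖grL N ψ‖ ≤ ‖grL N φ‖
    refine Lp.norm_le_norm_of_ae_le ?_
    filter_upwards [(memLp_gd ψ).coeFn_toLp, (memLp_gd φ).coeFn_toLp] with x h1 h2
    change ‖(memLp_gd ψ).toLp _ x‖ ≤ ‖(memLp_gd φ).toLp _ x‖
    rw [h1, h2, norm_gd, norm_gd]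
    have e : HasFDerivAt (ψ : Eu N → ℝ) (deriv τ ((φ : Eu N → ℝ) x) • fderiv ℝ (φ : Eu N → ℝ) x) x :=
      HasDerivAt.comp_hasFDerivAt x (t1.differentiable (by simp) _).hasDerivAt
        (φ.2.1.differentiable (by simp) x).hasFDerivAt
    rw [e.fderiv, norm_smul]
    exact mul_le_of_le_one_left (norm_nonneg _) (t3 _)
  · filter_upwards [emc hρ ψ, emc hρ φ] with x h1 h2
    rw [h1, h2]
    exact ⟨t4 _, t5 _⟩

lemma adj_S {ρ : Eu N → ℝ} (hρ : Continuous ρ) (hρp : ∀ x, 0 < ρ x)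
    {ι : HH N →L[ℝ] Lp ℝ 2 (wt ρ)} (hι : ∀ v, ι (grH N v) = emL hρ v) (v : Ds N)
    (s : Lp ℝ 2 (wt ρ)) (hs : s =ᵐ[wt ρ] fun x => - lap (v : Eu N → ℝ) x / ρ x) :
    ContinuousLinearMap.adjoint ι s = grH N v := by
  have key : (fun w : HH N => inner ℝ (ContinuousLinearMap.adjoint ι s) w)
      = fun w => inner ℝ (grH N v) w := by
    refine dense_grH.equalizer (continuous_const.inner continuous_id)
      (continuous_const.inner continuous_id) (funext fun w => ?_)
    simp only [Function.comp_apply]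
    rw [ContinuousLinearMap.adjoint_inner_left, hι, inner_grH, green v.2.1 v.2.2 w.2.1 w.2.2,
      inner_eq]
    have : ∫ x, - lap (v : Eu N → ℝ) x * (w : Eu N → ℝ) x
        = ∫ x, (- lap (v : Eu N → ℝ) x / ρ x * (w : Eu N → ℝ) x) ∂(wt ρ) := by
      rw [integral_wt hρ hρp]
      refine integral_congr_ae (ae_of_all _ fun x => ?_)
      have := (hρp x).ne'
      field_simp
    rw [this]
    refine integral_congr_ae ?_
    filter_upwards [hs, emc hρ w] with x h1 h2
    rw [h1, h2]
  exact ext_inner_right ℝ fun w => congrFun key w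

lemma adj_rel_aux {α : Type*} [MeasurableSpace α] {μ : Measure α}
    {H : Type*} [NormedAddCommGroup H] [InnerProductSpace ℝ H] [CompleteSpace H]
    (ι : H →L[ℝ] Lp ℝ 2 μ) {f s P : Lp ℝ 2 μ} {h : H} (h1 : ContinuousLinearMap.adjoint ι s = h)
    (h2 : ι h = P) :
    inner ℝ (ContinuousLinearMap.adjoint ι f) (ContinuousLinearMap.adjoint ι s) = inner ℝ f P := by
  rw [h1, ContinuousLinearMap.adjoint_inner_left, h2]

lemma adj_rel {ρ : Eu N → ℝ} (hρ : Continuous ρ) (hρp : ∀ x, 0 < ρ x)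
    {ι : HH N →L[ℝ] Lp ℝ 2 (wt ρ)} (hι : ∀ v, ι (grH N v) = emL hρ v) {v : Eu N → ℝ}
    (a1 : ContDiff ℝ ∞ v) (a2 : HasCompactSupport v)
    (s P f : Lp ℝ 2 (wt ρ)) (hP : P =ᵐ[wt ρ] v) (hs : s =ᵐ[wt ρ] fun x => - lap v x / ρ x) :
    inner ℝ (ContinuousLinearMap.adjoint ι f) (ContinuousLinearMap.adjoint ι s) = inner ℝ f P := by
  have h1 := adj_S hρ hρp hι ⟨v, a1, a2⟩ s hs
  have h2 : P = emL hρ ⟨v, a1, a2⟩ := Lp.ext (hP.trans (emc hρ ⟨v, a1, a2⟩).symm)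
  exact adj_rel_aux ι h1 ((hι _).trans h2.symm)

lemma conc {m p T Cp : ℝ} (hp : 1 < p) (hpm : p < m) (hT : 0 < T)
    {ρ : Eu N → ℝ} (hρ : Continuous ρ) (hρp : ∀ x, 0 < ρ x)
    (hPo : ∀ v : Eu N → ℝ, ContDiff ℝ ∞ v → HasCompactSupport v →
      (∫ x, v x ^ 2 * ρ x) ^ ((1 : ℝ) / 2) ≤
        Cp⁻¹ * (∫ x, ‖fderiv ℝ v x‖ ^ 2) ^ ((1 : ℝ) / 2))
    {u0 : Eu N → ℝ} (hu0 : Measurable u0) (h0 : ∀ x, 0 ≤ u0 x)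
    (hi : Integrable (fun x => u0 x ^ m) (wt ρ)) :
    ∃ u : Eu N × ℝ → ℝ, Measurable u ∧ (∀ q, 0 ≤ u q) ∧
      (∃ K : ℝ, ∀ᵐ t ∂(volume.restrict (Ioo 0 T)),
        ∫⁻ x, ENNReal.ofReal (u (x,t)^m) ∂(wt ρ) ≤ ENNReal.ofReal K) ∧
      ∀ (M : ℝ) (P Q S : ℝ → Lp ℝ 2 (wt ρ)) (φ : ℝ → Eu N → ℝ),
        (∀ t ∈ Icc 0 T, HasDerivWithinAt P (Q t) (Icc 0 T) t) → P T = 0 →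
        ContinuousOn Q (Icc 0 T) → ContinuousOn S (Icc 0 T) →
        (∀ t ∈ Icc 0 T, IB M (P t) ∧ IB M (Q t) ∧ IB M (S t)) →
        (∀ t ∈ Icc 0 T, ContDiff ℝ ∞ (φ t) ∧ HasCompactSupport (φ t) ∧ P t =ᵐ[wt ρ] φ t ∧
          S t =ᵐ[wt ρ] fun x => - lap (φ t) x / ρ x) →
        (∫ t in Ioo 0 T, ∫ x, u (x,t) * Q t x ∂(wt ρ))
          - (∫ t in Ioo 0 T, ∫ x, u (x,t)^m * S t x ∂(wt ρ))
          + (∫ t in Ioo 0 T, ∫ x, u (x,t)^p * P t x ∂(wt ρ)) = - ∫ x, u0 x * P 0 x ∂(wt ρ) := by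
  have := lf_wt hρ
  obtain ⟨ι, hι⟩ := exists_iota hρ hρp hPo
  obtain ⟨u, u1, u2, u3, u4⟩ := exist_adj ι (grH N) (emL hρ) dense_grH hι (tr hρ) hp hpm hT hu0 h0 hi
  refine ⟨u, u1, u2, u3, fun M P Q S φ dP PT cQ cS hI hφ => u4 M P Q S
    ⟨dP, PT, cQ, cS, fun t ht f => ?_, fun t ht => (hI t ht).1, fun t ht => (hI t ht).2.1,
      fun t ht => (hI t ht).2.2⟩⟩
  exact adj_rel hρ hρp hι (hφ t ht).1 (hφ t ht).2.1 _ _ _ (hφ t ht).2.2.1 (hφ t ht).2.2.2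

end
end VW


namespace VW
open Set Filter Topology
open scoped NNReal ENNReal ContDiff

section
variable {N : ℕ} {μ : Measure (Eu N)} [IsLocallyFiniteMeasure μ]

lemma nb {K : Set (Eu N)} (hK : IsCompact K) {C : ℝ} (hC : 0 ≤ C) {f : Lp ℝ 2 μ} {g : Eu N → ℝ}
    (hf : f =ᵐ[μ] g) (h1 : ∀ x, |g x| ≤ C) (h2 : ∀ x, x ∉ K → g x = 0) :
    ‖f‖ ≤ C * √(μ.real K) := by
  have e : ‖f‖ ^ 2 = ∫ x in K, g x ^ 2 ∂μ := by
    rw [norm_sq, setIntegral_eq_integral_of_forall_compl_eq_zero (fun x hx => by simp [h2 x hx])]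
    refine integral_congr_ae ?_
    filter_upwards [hf] with x hx
    rw [hx]
  have l : ‖∫ x in K, g x ^ 2 ∂μ‖ ≤ C ^ 2 * μ.real K := by
    refine norm_setIntegral_le_of_norm_le_const hK.measure_lt_top fun x _ => ?_
    rw [norm_pow, Real.norm_eq_abs]
    exact pow_le_pow_left₀ (abs_nonneg _) (h1 x) 2
  rw [← e, Real.norm_of_nonneg (by positivity)] at l
  refine abs_le_of_sq_le_sq' ?_ (by positivity) |>.2
  rwa [mul_pow, Real.sq_sqrt measureReal_nonneg]

lemma off_K {F : Eu N × ℝ → ℝ} {x : Eu N} (hx : x ∉ Prod.fst '' tsupport F) (t : ℝ) : F (x, t) = 0 := by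
  by_contra h
  exact hx ⟨(x, t), subset_tsupport _ h, rfl⟩

lemma exists_slice {F : Eu N × ℝ → ℝ} (hF : Continuous F) (sF : HasCompactSupport F) :
    ∃ L : ℝ → Lp ℝ 2 μ, (∀ t, L t =ᵐ[μ] fun x => F (x, t)) ∧ Continuous L ∧
      ∃ M, ∀ M' ≥ M, ∀ t, IB M' (L t) := by
  set K := Prod.fst '' tsupport F with hKd
  have hK : IsCompact K := sF.isCompact.image continuous_fst
  have ml : ∀ t, MemLp (fun x => F (x, t)) 2 μ := fun t =>
    (hF.comp (Continuous.prodMk_left t)).memLp_of_hasCompactSupport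
      (HasCompactSupport.intro hK fun x hx => off_K hx t)
  let L : ℝ → Lp ℝ 2 μ := fun t => (ml t).toLp _
  have hL : ∀ t, L t =ᵐ[μ] fun x => F (x, t) := fun t => (ml t).coeFn_toLp
  refine ⟨L, hL, ?_, ?_⟩
  · have uc := sF.uniformContinuous_of_continuous hF
    rw [Metric.continuous_iff]
    intro t ε hε
    set r := √(μ.real K)
    have r0 : 0 ≤ r := Real.sqrt_nonneg _
    obtain ⟨δ, hδ, h⟩ := Metric.uniformContinuous_iff.1 uc (ε / (r + 1)) (by positivity)
    refine ⟨δ, hδ, fun s hs => ?_⟩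
    rw [dist_eq_norm]
    have : ‖L s - L t‖ ≤ ε / (r + 1) * r := by
      refine nb hK (g := fun x => F (x, s) - F (x, t)) (by positivity) ?_ (fun x => ?_) fun x hx => ?_
      · filter_upwards [hL s, hL t, Lp.coeFn_sub (L s) (L t)] with x a1 a2 a3
        rw [a3, Pi.sub_apply, a1, a2]
      · have : dist (x, s) (x, t) < δ := by simpa [Prod.dist_eq] using hs
        exact (h this).le
      · simp [off_K hx]
    refine this.trans_lt ?_
    rw [div_mul_eq_mul_div, div_lt_iff₀ (by positivity)]
    nlinarith
  · obtain ⟨C, hC⟩ := hF.bounded_above_of_compact_support sF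
    have C0 : 0 ≤ C := (norm_nonneg _).trans (hC (0, 0))
    refine ⟨C + C * μ.real K, fun M' hM t => ⟨?_, ?_, ?_⟩⟩
    · exact ((hF.comp (Continuous.prodMk_left t)).integrable_of_hasCompactSupport
        (HasCompactSupport.intro hK fun x hx => off_K hx t)).congr (hL t).symm
    · have e : ∫ x, |L t x| ∂μ = ∫ x in K, |F (x, t)| ∂μ := by
        rw [setIntegral_eq_integral_of_forall_compl_eq_zero (fun x hx => by simp [off_K hx])]
        refine integral_congr_ae ?_
        filter_upwards [hL t] with x hx
        rw [hx]
      have l : ‖∫ x in K, |F (x, t)| ∂μ‖ ≤ C * μ.real K :=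
        norm_setIntegral_le_of_norm_le_const hK.measure_lt_top fun x _ => by
          rw [norm_abs_eq_norm]; exact hC _
      rw [e]
      linarith [(le_abs_self _).trans l]
    · filter_upwards [hL t] with x hx
      rw [hx]
      have : 0 ≤ C * μ.real K := mul_nonneg C0 measureReal_nonneg
      linarith [hC (x, t), Real.norm_eq_abs (F (x, t))]

lemma slice_deriv {F G : Eu N × ℝ → ℝ} (sF : HasCompactSupport F) (hG : Continuous G)
    (sG : HasCompactSupport G) (hd : ∀ x t, HasDerivAt (fun s => F (x, s)) (G (x, t)) t)
    {L Q : ℝ → Lp ℝ 2 μ} (hL : ∀ t, L t =ᵐ[μ] fun x => F (x, t)) (hQ : ∀ t, Q t =ᵐ[μ] fun x => G (x, t))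
    (t : ℝ) : HasDerivAt L (Q t) t := by
  set K := Prod.fst '' tsupport F ∪ Prod.fst '' tsupport G with hKd
  have hK : IsCompact K := (sF.isCompact.image continuous_fst).union (sG.isCompact.image continuous_fst)
  have uc := sG.uniformContinuous_of_continuous hG
  rw [hasDerivAt_iff_isLittleO, Asymptotics.isLittleO_iff]
  intro ε hε
  set r := √(μ.real K)
  have r0 : 0 ≤ r := Real.sqrt_nonneg _
  obtain ⟨δ, hδ, h⟩ := Metric.uniformContinuous_iff.1 uc (ε / (r + 1)) (by positivity)
  filter_upwards [Metric.ball_mem_nhds t hδ] with s hs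
  have : ‖L s - L t - (s - t) • Q t‖ ≤ (ε / (r + 1) * |s - t|) * r := by
    refine nb hK (g := fun x => F (x, s) - F (x, t) - (s - t) * G (x, t)) (by positivity) ?_
      (fun x => ?_) fun x hx => ?_
    · filter_upwards [hL s, hL t, hQ t, Lp.coeFn_sub (L s) (L t), Lp.coeFn_smul (s - t) (Q t),
        Lp.coeFn_sub (L s - L t) ((s - t) • Q t)] with x a1 a2 a3 a4 a5 a6
      rw [a6, Pi.sub_apply, a4, Pi.sub_apply, a5, Pi.smul_apply, a1, a2, a3, smul_eq_mul]
    · have := Convex.norm_image_sub_le_of_norm_hasDerivWithin_le (s := Metric.ball t δ)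
        (f := fun s => F (x, s) - (s - t) * G (x, t)) (f' := fun s => G (x, s) - G (x, t))
        (C := ε / (r + 1)) (x := t) (y := s) (fun w hw => by
          have := (hd x w).sub (((hasDerivAt_id w).sub_const t).mul_const (G (x, t)))
          rw [one_mul] at this
          exact this.hasDerivWithinAt)
        (fun w hw => by
          have : dist (x, w) (x, t) < δ := by simpa [Prod.dist_eq] using hw
          exact (h this).le) (convex_ball _ _) (Metric.mem_ball_self hδ) hs
      rw [← Real.norm_eq_abs, ← Real.norm_eq_abs]
      refine le_trans (le_of_eq ?_) this
      congr 1
      ring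
    · rw [mem_union, not_or] at hx
      simp [off_K hx.1, off_K hx.2]
  refine this.trans ?_
  rw [Real.norm_eq_abs, mul_right_comm]
  gcongr
  rw [div_mul_eq_mul_div, div_le_iff₀ (by positivity)]
  nlinarith

end

section
variable {N : ℕ}

lemma fderiv_slice {F : Eu N × ℝ → ℝ} (hF : ContDiff ℝ ∞ F) (x e : Eu N) (t : ℝ) :
    fderiv ℝ (fun y => F (y, t)) x e = fderiv ℝ F (x, t) (e, 0) := by
  have h1 : HasFDerivAt (fun y : Eu N => (y, t)) (ContinuousLinearMap.inl ℝ (Eu N) ℝ) x :=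
    hasFDerivAt_prodMk_left x t
  have := ((hF.differentiable (by simp) (x, t)).hasFDerivAt.comp x h1).fderiv
  simp only [Function.comp_def] at this
  rw [this]
  simp

lemma exists_lap {F : Eu N × ℝ → ℝ} (hF : ContDiff ℝ ∞ F) (sF : HasCompactSupport F) :
    ∃ G : Eu N × ℝ → ℝ, Continuous G ∧ HasCompactSupport G ∧
      ∀ x t, G (x, t) = lap (fun y => F (y, t)) x := by
  let D : Fin N → Eu N × ℝ → ℝ := fun i q => fderiv ℝ F q (EuclideanSpace.single i 1, 0)
  have hD : ∀ i, ContDiff ℝ ∞ (D i) := fun i => (hF.fderiv_right (by simp)).clm_apply contDiff_const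
  have sD : ∀ i, HasCompactSupport (D i) := fun i => sF.fderiv_apply (𝕜 := ℝ) _
  refine ⟨fun q => ∑ i, fderiv ℝ (D i) q (EuclideanSpace.single i 1, 0), ?_, ?_, fun x t => ?_⟩
  · exact continuous_finsetSum _ fun i _ => ((hD i).continuous_fderiv (by simp)).clm_apply continuous_const
  · refine HasCompactSupport.intro sF.isCompact fun q hq => Finset.sum_eq_zero fun i _ => ?_
    refine image_eq_zero_of_notMem_tsupport (f := fun q => fderiv ℝ (D i) q (EuclideanSpace.single i 1, 0)) fun h => hq ?_
    exact (tsupport_fderiv_apply_subset ℝ _).trans (tsupport_fderiv_apply_subset ℝ _) h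
  · have hs : ContDiff ℝ ∞ fun y => F (y, t) := hF.comp (contDiff_prodMk_left t)
    rw [lap_eq hs]
    refine Finset.sum_congr rfl fun i _ => ?_
    simp_rw [fderiv_slice hF]
    rw [fderiv_slice (hD i)]

end
end VW


namespace VW
open Set Filter Topology
open scoped NNReal ENNReal ContDiff

lemma prod_int {N : ℕ} {m T K : ℝ} {ρ : Eu N → ℝ} (hρ : Continuous ρ) (hρp : ∀ x, 0 < ρ x)
    {u : Eu N × ℝ → ℝ} (u1 : Measurable u) (u2 : ∀ q, 0 ≤ u q)
    (u3 : ∀ᵐ t ∂(volume.restrict (Ioo 0 T)),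
        ∫⁻ x, ENNReal.ofReal (u (x,t)^m) ∂(wt ρ) ≤ ENNReal.ofReal K) :
    Integrable (fun q : Eu N × ℝ => u (q.1, q.2) ^ m * ρ q.1)
      (volume.prod (volume.restrict (Ioo 0 T))) := by
  have hm : Measurable (fun q : Eu N × ℝ => u (q.1, q.2) ^ m * ρ q.1) :=
    (u1.pow_const m).mul (hρ.measurable.comp measurable_fst)
  refine ⟨hm.aestronglyMeasurable, ?_⟩
  rw [hasFiniteIntegral_iff_ofReal (ae_of_all _ fun q =>
    mul_nonneg (Real.rpow_nonneg (u2 _) _) (hρp _).le), lintegral_prod_symm' _ hm.ennreal_ofReal]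
  have e : ∀ t, ∫⁻ x, ENNReal.ofReal (u (x, t) ^ m * ρ x)
      = ∫⁻ x, ENNReal.ofReal (u (x,t)^m) ∂(wt ρ) := by
    intro t
    have h1 : Measurable fun x => ENNReal.ofReal (u (x,t)^m) :=
      ((u1.comp measurable_prodMk_right).pow_const m).ennreal_ofReal
    rw [wt, lintegral_withDensity_eq_lintegral_mul _ hρ.measurable.ennreal_ofReal h1]
    refine lintegral_congr fun x => ?_
    rw [Pi.mul_apply, mul_comm, ENNReal.ofReal_mul (hρp x).le]
  calc ∫⁻ t in Ioo 0 T, ∫⁻ x, ENNReal.ofReal (u (x, t) ^ m * ρ x)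
      = ∫⁻ t in Ioo 0 T, ∫⁻ x, ENNReal.ofReal (u (x,t)^m) ∂(wt ρ) := lintegral_congr fun t => e t
    _ ≤ ∫⁻ t in Ioo 0 T, ENNReal.ofReal K := lintegral_mono_ae u3
    _ < (⊤ : ENNReal) := by
      rw [setLIntegral_const, Real.volume_Ioo]
      exact ENNReal.mul_lt_top ENNReal.ofReal_lt_top ENNReal.ofReal_lt_top

end VW

/-- Global existence of very weak solutions for the weighted
reaction-diffusion problem `ρ u_t = Δ(u^m) + ρ u^p`, `1 < p < m`, with data in `L^m_ρ`,
under the weighted Poincaré inequality. -/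
theorem exists_veryWeakSolution
    (N : ℕ) (hN : 3 ≤ N) (m p : ℝ) (hp : 1 < p) (hpm : p < m)
    (ρ : EuclideanSpace ℝ (Fin N) → ℝ) (hρc : Continuous ρ)
    (hρb : ∃ M : ℝ, ∀ x, ρ x ≤ M) (hρpos : ∀ x, 0 < ρ x)
    (Cp : ℝ) (hCp : 0 < Cp)
    (hPoincare : ∀ v : EuclideanSpace ℝ (Fin N) → ℝ, ContDiff ℝ (⊤ : ℕ∞) v → HasCompactSupport v →
      (∫ x, v x ^ 2 * ρ x) ^ ((1 : ℝ) / 2) ≤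
        Cp⁻¹ * (∫ x, ‖fderiv ℝ v x‖ ^ 2) ^ ((1 : ℝ) / 2))
    (u0 : EuclideanSpace ℝ (Fin N) → ℝ) (hu0meas : Measurable u0)
    (hu0nonneg : ∀ x, 0 ≤ u0 x)
    (hu0m : Integrable (fun x => u0 x ^ m * ρ x)) :
    ∀ T : ℝ, 0 < T → ∃ u, IsVeryWeakSolution N m p T ρ u0 u := by
  intro T hT
  have hi : Integrable (fun x => u0 x ^ m) (VW.wt ρ) := (VW.integrable_wt hρc hρpos _).2 hu0m
  have lf := VW.lf_wt hρc
  obtain ⟨u, u1, u2, ⟨K, u3⟩, u4⟩ := VW.conc hp hpm hT hρc hρpos hPoincare hu0meas hu0nonneg hi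
  refine ⟨fun x t => u (x, t), fun x t => u2 _, u1, ?_, fun φ hφ sφ hφT => ?_⟩
  · exact VW.prod_int hρc hρpos u1 u2 u3
  obtain ⟨G, G1, G2, G3⟩ := VW.exists_lap hφ sφ
  let R : EuclideanSpace ℝ (Fin N) × ℝ → ℝ := fun q => G q * (-(ρ q.1)⁻¹)
  have hR : Continuous R := G1.mul ((hρc.comp continuous_fst).inv₀ fun q => (hρpos _).ne').neg
  have sR : HasCompactSupport R := G2.mul_right
  let W : EuclideanSpace ℝ (Fin N) × ℝ → ℝ := fun q => fderiv ℝ φ q (0, 1)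
  have hW : Continuous W := (hφ.continuous_fderiv (by simp)).clm_apply continuous_const
  have sW : HasCompactSupport W := sφ.fderiv_apply (𝕜 := ℝ) _
  have hd : ∀ x t, HasDerivAt (fun s => φ (x, s)) (W (x, t)) t := by
    intro x t
    have h1 : HasDerivAt (fun s : ℝ => (x, s)) ((0 : EuclideanSpace ℝ (Fin N)), (1 : ℝ)) t :=
      (hasDerivAt_const t x).prodMk (hasDerivAt_id t)
    exact (hφ.differentiable (by simp) (x, t)).hasFDerivAt.comp_hasDerivAt t h1
  obtain ⟨P, P1, P2, MP, P3⟩ := VW.exists_slice (μ := VW.wt ρ) hφ.continuous sφ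
  obtain ⟨Q, Q1, Q2, MQ, Q3⟩ := VW.exists_slice (μ := VW.wt ρ) hW sW
  obtain ⟨S, S1, S2, MS, S3⟩ := VW.exists_slice (μ := VW.wt ρ) hR sR
  have M1 : max MP (max MQ MS) ≥ MP := le_max_left _ _
  have M2 : max MP (max MQ MS) ≥ MQ := (le_max_left _ _).trans (le_max_right _ _)
  have M3 : max MP (max MQ MS) ≥ MS := (le_max_right _ _).trans (le_max_right _ _)
  have key := u4 (max MP (max MQ MS)) P Q S (fun t x => φ (x, t))
    (fun t _ => (VW.slice_deriv sφ hW sW hd P1 Q1 t).hasDerivWithinAt)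
    (Lp.ext ((P1 T).trans (by
      filter_upwards [Lp.coeFn_zero ℝ 2 (VW.wt ρ)] with x hx
      rw [hx, hφT]; rfl)))
    Q2.continuousOn S2.continuousOn (fun t _ => ⟨P3 _ M1 t, Q3 _ M2 t, S3 _ M3 t⟩)
    (fun t _ => ⟨hφ.comp (contDiff_prodMk_left t),
      HasCompactSupport.intro (sφ.isCompact.image continuous_fst) fun x hx => VW.off_K hx t, P1 t, by
      filter_upwards [S1 t] with x hx
      rw [hx]
      simp only [R, G3]
      rw [mul_neg, ← div_eq_mul_inv, neg_div]⟩)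
  have e1 : ∀ t, ∫ x, u (x, t) * Q t x ∂(VW.wt ρ) = ∫ x, u (x, t) * deriv (fun s => φ (x, s)) t * ρ x := by
    intro t
    rw [← VW.integral_wt hρc hρpos]
    refine integral_congr_ae ?_
    filter_upwards [Q1 t] with x hx
    rw [hx, (hd x t).deriv]
  have e2 : ∀ t, ∫ x, u (x, t) ^ m * S t x ∂(VW.wt ρ)
      = - ∫ x, u (x, t) ^ m * lap (fun y => φ (y, t)) x := by
    intro t
    rw [← integral_neg]
    have : ∫ x, u (x, t) ^ m * S t x ∂(VW.wt ρ) = ∫ x, u (x, t) ^ m * R (x, t) ∂(VW.wt ρ) := by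
      refine integral_congr_ae ?_
      filter_upwards [S1 t] with x hx
      rw [hx]
    rw [this, VW.integral_wt hρc hρpos]
    refine integral_congr_ae (ae_of_all _ fun x => ?_)
    have := (hρpos x).ne'
    simp only [R, G3]
    field_simp
  have e3 : ∀ t, ∫ x, u (x, t) ^ p * P t x ∂(VW.wt ρ) = ∫ x, u (x, t) ^ p * φ (x, t) * ρ x := by
    intro t
    rw [← VW.integral_wt hρc hρpos]
    refine integral_congr_ae ?_
    filter_upwards [P1 t] with x hx
    rw [hx]
  have e4 : ∫ x, u0 x * P 0 x ∂(VW.wt ρ) = ∫ x, u0 x * φ (x, 0) * ρ x := by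
    rw [← VW.integral_wt hρc hρpos]
    refine integral_congr_ae ?_
    filter_upwards [P1 0] with x hx
    rw [hx]
  simp_rw [e1, e2, e3, e4, integral_neg] at key
  linarith
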